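/- Let q ∈ {2,3,4,5}, let k, n−k ≥ 2, and assume either n ≥ 5, or n = 4 and q = 2. Then every Boolean degree 1 function f on the Grassmann scheme J_q(n,k) is trivial: f or 1−f is the constant 1, or p^+ for a point p, or π^+ for a hyperplane π, or p^+ ∨ π^+ for a point p and hyperplane π with p not contained in π. -/

import Mathlib

open Module

attribute [local instance] Classical.propDecidable

/-- The Grassmann scheme `J_q(n,k)`: the `k`-dimensional subspaces of `F^n`,
where `F` is a finite field of order `q`. -/
def Gr (F : Type*) [Field F] (n k : ℕ) :=
  {S : Submodule F (Fin n → F) // finrank F S = k}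

/-- A Boolean function `f` on `J_q(n,k)` has degree 1 if
`f(S) = c + ∑_p c_p · 1_{p ⊆ S}`, summing over all points (1-dimensional
subspaces) `p` of `F^n`. -/
def GrDegOne {F : Type*} [Field F] [Fintype F] {n k : ℕ} (f : Gr F n k → Bool) : Prop :=
  ∃ (c : ℝ) (C : Submodule F (Fin n → F) → ℝ), ∀ S : Gr F n k,
    (if f S then (1 : ℝ) else 0) =
      c + ∑ᶠ p ∈ {p : Submodule F (Fin n → F) | finrank F p = 1},
            C p * (if p ≤ S.val then (1 : ℝ) else 0)

/-- `f` is of one of the forms: constant 1, `p⁺`, `π⁺`, or `p⁺ ∨ π⁺` with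
`p ⊄ π`, for a point `p` and a hyperplane `π`. -/
def GrTrivPat {F : Type*} [Field F] {n k : ℕ} (f : Gr F n k → Bool) : Prop :=
  (∀ S, f S = true) ∨
  (∃ p : Submodule F (Fin n → F), finrank F p = 1 ∧
    ∀ S : Gr F n k, (f S = true ↔ p ≤ S.val)) ∨
  (∃ pi : Submodule F (Fin n → F), finrank F pi = n - 1 ∧
    ∀ S : Gr F n k, (f S = true ↔ S.val ≤ pi)) ∨
  (∃ p pi : Submodule F (Fin n → F), finrank F p = 1 ∧ finrank F pi = n - 1 ∧
    ¬ p ≤ pi ∧ ∀ S : Gr F n k, (f S = true ↔ (p ≤ S.val ∨ S.val ≤ pi)))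

/-- A Boolean function on `J_q(n,k)` is trivial if it or its complement is the
constant 1, `p⁺` for a point `p`, `π⁺` for a hyperplane `π`, or `p⁺ ∨ π⁺` with
`p ⊄ π`. -/
def GrTrivial {F : Type*} [Field F] {n k : ℕ} (f : Gr F n k → Bool) : Prop :=
  GrTrivPat f ∨ GrTrivPat (fun S => !(f S))

set_option linter.unusedSectionVars false
set_option linter.unusedVariables false

set_option linter.unusedSectionVars false
set_option linter.unusedSimpArgs false
namespace GC
section
variable {F V : Type*} [Field F] [Fintype F] [AddCommGroup V] [Module F V] [Finite V]

noncomputable def pts (S : Submodule F V) : Finset (Submodule F V) :=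
  (Set.toFinite {p : Submodule F V | finrank F p = 1 ∧ p ≤ S}).toFinset

noncomputable def cov (A B : Submodule F V) : Finset (Submodule F V) :=
  (Set.toFinite {S : Submodule F V | A ≤ S ∧ S ≤ B ∧ finrank F S = finrank F A + 1}).toFinset

noncomputable def subs (j : ℕ) (B : Submodule F V) : Finset (Submodule F V) :=
  (Set.toFinite {S : Submodule F V | S ≤ B ∧ finrank F S = j}).toFinset

noncomputable def wt (h : Submodule F V → ℝ) (S : Submodule F V) : ℝ := ∑ p ∈ pts S, h p

theorem mem_pts {S p : Submodule F V} : p ∈ pts S ↔ finrank F p = 1 ∧ p ≤ S := by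
  simp [pts]

theorem mem_cov {A B S : Submodule F V} :
    S ∈ cov A B ↔ A ≤ S ∧ S ≤ B ∧ finrank F S = finrank F A + 1 := by
  simp [cov]

theorem mem_subs {j : ℕ} {B S : Submodule F V} :
    S ∈ subs j B ↔ S ≤ B ∧ finrank F S = j := by
  simp [subs]

theorem pts_mono {A B : Submodule F V} (h : A ≤ B) : pts A ⊆ pts B := by
  intro p hp
  rw [mem_pts] at *
  exact ⟨hp.1, hp.2.trans h⟩

theorem pt_inf {A p : Submodule F V} (hp : finrank F p = 1) (h : ¬ p ≤ A) : A ⊓ p = ⊥ := by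
  have h1 : finrank F ↥(A ⊓ p) < finrank F p := by
    apply Submodule.finrank_lt_finrank_of_lt
    exact lt_of_le_of_ne inf_le_right (fun e => h (e ▸ inf_le_left))
  rw [hp] at h1
  have : finrank F ↥(A ⊓ p) = 0 := by omega
  exact Submodule.finrank_eq_zero.mp this

theorem finrank_sup_pt {A p : Submodule F V} (hp : finrank F p = 1) (h : ¬ p ≤ A) :
    finrank F ↥(A ⊔ p) = finrank F A + 1 := by
  have := Submodule.finrank_sup_add_finrank_inf_eq A p
  rw [pt_inf hp h, hp] at this
  simpa using this

theorem eq_sup_pt {A S p : Submodule F V} (hp : finrank F p = 1) (h : ¬ p ≤ A)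
    (hA : A ≤ S) (hpS : p ≤ S) (hS : finrank F S = finrank F A + 1) : A ⊔ p = S := by
  apply Submodule.eq_of_le_of_finrank_eq (sup_le hA hpS)
  rw [finrank_sup_pt hp h, hS]

theorem exists_pt_of_not_le {A B : Submodule F V} (h : ¬ B ≤ A) :
    ∃ p : Submodule F V, finrank F p = 1 ∧ p ≤ B ∧ ¬ p ≤ A := by
  obtain ⟨v, hv, hvA⟩ := SetLike.not_le_iff_exists.mp h
  refine ⟨Submodule.span F {v}, finrank_span_singleton ?_, ?_, ?_⟩
  · rintro rfl; exact hvA (zero_mem _)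
  · simpa using hv
  · simpa using hvA

theorem pt_le_pt {p r : Submodule F V} (hp : finrank F p = 1) (hr : finrank F r = 1)
    (h : p ≤ r) : p = r :=
  Submodule.eq_of_le_of_finrank_eq h (by rw [hp, hr])

theorem cov_sum (h : Submodule F V → ℝ) {A B : Submodule F V} (hAB : A ≤ B) :
    ∑ S ∈ cov A B, wt h S = wt h B + ((cov A B).card - 1) * wt h A := by
  have h1 : ∀ S ∈ cov A B, wt h S = wt h A +
      ∑ p ∈ pts B \ pts A with A ⊔ p = S, h p := by
    intro S hS
    rw [mem_cov] at hS
    rw [wt, ← Finset.sum_sdiff (pts_mono hS.1), add_comm]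
    congr 1
    apply Finset.sum_congr _ (fun _ _ => rfl)
    ext p
    simp only [Finset.mem_sdiff, Finset.mem_filter, mem_pts]
    constructor
    · rintro ⟨⟨a, b⟩, c⟩
      have c' : ¬ p ≤ A := fun hc => c ⟨a, hc⟩
      exact ⟨⟨⟨a, b.trans hS.2.1⟩, c⟩, eq_sup_pt a c' hS.1 b hS.2.2⟩
    · rintro ⟨⟨⟨a, b⟩, c⟩, d⟩
      exact ⟨⟨a, d ▸ le_sup_right⟩, c⟩
  rw [Finset.sum_congr rfl h1, Finset.sum_add_distrib, Finset.sum_fiberwise_of_maps_to]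
  · rw [Finset.sum_const, nsmul_eq_mul, wt, wt, ← Finset.sum_sdiff (pts_mono hAB)]
    ring
  · intro p hp
    simp only [Finset.mem_sdiff, mem_pts] at hp
    rw [mem_cov]
    refine ⟨le_sup_left, sup_le hAB hp.1.2, finrank_sup_pt hp.1.1 (fun hc => hp.2 ⟨hp.1.1, hc⟩)⟩

theorem card_pts (S : Submodule F V) :
    ((pts S).card : ℝ) * ((Fintype.card F : ℝ) - 1) = (Fintype.card F : ℝ) ^ finrank F S - 1 := by
  have hc : ∀ T : Submodule F V, Nat.card T = Fintype.card F ^ finrank F T := by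
    intro T
    rw [← Nat.card_eq_fintype_card]
    exact Module.natCard_eq_pow_finrank
  let N : Submodule F V → Finset V := fun T => (Set.toFinite {v : V | v ∈ T ∧ v ≠ 0}).toFinset
  have hN : ∀ T : Submodule F V, (N T).card + 1 = Fintype.card F ^ finrank F T := by
    intro T
    rw [← hc T]
    have : (insert 0 (N T)) = (Set.toFinite (T : Set V)).toFinset := by
      ext v; simp only [N, Finset.mem_insert, Set.Finite.mem_toFinset, Set.mem_ofPred_eq, SetLike.mem_coe]
      constructor
      · rintro (rfl | h); exacts [zero_mem _, h.1]
      · intro h; by_cases h0 : v = 0; exacts [Or.inl h0, Or.inr ⟨h, h0⟩]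
    rw [← Finset.card_insert_of_notMem (a := (0:V)) (by simp [N]), this]
    exact (Nat.card_eq_card_finite_toFinset (Set.toFinite (T : Set V))).symm
  have h1 : (N S).card = ∑ p ∈ pts S, ((N S).filter (fun v => Submodule.span F {v} = p)).card := by
    apply Finset.card_eq_sum_card_fiberwise
    intro v hv
    simp only [N, Set.Finite.coe_toFinset, Set.mem_ofPred_eq, Finset.mem_coe] at hv
    simp only [Finset.mem_coe, mem_pts]
    exact ⟨finrank_span_singleton hv.2, by simpa using hv.1⟩
  have h2 : ∀ p ∈ pts S, (N S).filter (fun v => Submodule.span F {v} = p) = N p := by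
    intro p hp
    rw [mem_pts] at hp
    ext v
    simp only [N, Finset.mem_filter, Set.Finite.mem_toFinset, Set.mem_ofPred_eq]
    constructor
    · rintro ⟨⟨a, b⟩, rfl⟩; exact ⟨Submodule.mem_span_singleton_self v, b⟩
    · rintro ⟨a, b⟩
      exact ⟨⟨hp.2 a, b⟩, pt_le_pt (finrank_span_singleton b) hp.1 (by simpa using a)⟩
  have h3 : ((N S).card : ℝ) = ∑ p ∈ pts S, ((Fintype.card F : ℝ) - 1) := by
    rw [h1, Nat.cast_sum]
    apply Finset.sum_congr rfl
    intro p hp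
    rw [h2 p hp]
    have := hN p
    rw [(mem_pts.mp hp).1, pow_one] at this
    rw [← this]; push_cast; ring
  rw [Finset.sum_const, nsmul_eq_mul] at h3
  rw [← h3]
  have := hN S
  rw [eq_sub_iff_add_eq]
  exact_mod_cast this

theorem q_gt_one : (1 : ℝ) < (Fintype.card F : ℝ) := by
  exact_mod_cast Fintype.one_lt_card

theorem card_cov {A B : Submodule F V} (hAB : A ≤ B) :
    ((cov A B).card : ℝ) * ((Fintype.card F : ℝ) - 1)
      = (Fintype.card F : ℝ) ^ (finrank F B - finrank F A) - 1 := by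
  have hs := cov_sum (fun _ => (1:ℝ)) hAB
  have hw : ∀ S : Submodule F V, wt (fun _ => (1:ℝ)) S = (pts S).card := by
    intro S; simp [wt]
  rw [Finset.sum_congr rfl (fun S _ => hw S), hw, hw] at hs
  have hs2 := congrArg (fun x => x * ((Fintype.card F : ℝ) - 1)) hs
  simp only [Finset.sum_mul, add_mul, mul_assoc, card_pts] at hs2
  have hs3 : ∀ S ∈ cov A B, (Fintype.card F : ℝ) ^ finrank F S - 1 = 
     (Fintype.card F : ℝ) ^ (finrank F A + 1) - 1 := by
    intro S hS; rw [(mem_cov.mp hS).2.2]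
  rw [Finset.sum_congr rfl hs3, Finset.sum_const, nsmul_eq_mul] at hs2
  have hle : finrank F A ≤ finrank F B := Submodule.finrank_mono hAB
  obtain ⟨d, hd⟩ := Nat.exists_eq_add_of_le hle
  rw [hd] at hs2 ⊢
  rw [Nat.add_sub_cancel_left]
  have hq := q_gt_one (F := F)
  have : (Fintype.card F : ℝ) ^ finrank F A ≠ 0 := by positivity
  apply mul_left_cancel₀ this
  rw [pow_add, pow_succ] at hs2
  linear_combination hs2

end
end GC

namespace GC
section
variable {F V : Type*} [Field F] [Fintype F] [AddCommGroup V] [Module F V] [Finite V]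

def LB (k : ℕ) (w : Submodule F V → ℝ) : Prop :=
  ∀ S : Submodule F V, finrank F S = k → wt w S = 0 ∨ wt w S = 1

theorem cov_card_eq {A B : Submodule F V} (hAB : A ≤ B) {r : ℝ}
    (hr : r * ((Fintype.card F : ℝ) - 1) =
      (Fintype.card F : ℝ) ^ (finrank F B - finrank F A) - 1) :
    ((cov A B).card : ℝ) = r := by
  have hq := q_gt_one (F := F)
  have : (Fintype.card F : ℝ) - 1 ≠ 0 := by linarith
  apply mul_right_cancel₀ this
  rw [hr, card_cov hAB]

theorem pts_pt {p : Submodule F V} (hp : finrank F p = 1) : pts p = {p} := by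
  ext r
  rw [mem_pts, Finset.mem_singleton]
  constructor
  · rintro ⟨a, b⟩; exact pt_le_pt a hp b
  · rintro rfl; exact ⟨hp, le_refl _⟩

theorem wt_pt (w : Submodule F V → ℝ) {p : Submodule F V} (hp : finrank F p = 1) :
    wt w p = w p := by
  rw [wt, pts_pt hp, Finset.sum_singleton]

theorem wt_bot (w : Submodule F V → ℝ) : wt w (⊥ : Submodule F V) = 0 := by
  rw [wt]
  apply Finset.sum_eq_zero
  intro p hp
  rw [mem_pts] at hp
  have := hp.1
  rw [le_bot_iff.mp hp.2] at this
  simp at this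

theorem line_sum (w : Submodule F V → ℝ) {p S : Submodule F V} (hp : p ∈ pts S) {r : ℝ}
    (hr : r * ((Fintype.card F : ℝ) - 1) = (Fintype.card F : ℝ) ^ (finrank F S - 1) - 1) :
    ∑ l ∈ cov p S, wt w l = wt w S + (r - 1) * w p := by
  rw [mem_pts] at hp
  rw [cov_sum w hp.2, wt_pt w hp.1, cov_card_eq hp.2 (by rw [hp.1]; exact hr)]

theorem E_id {w : Submodule F V → ℝ} (hL : LB 2 w) (S : Submodule F V) {r : ℝ}
    (hr : r * ((Fintype.card F : ℝ) - 1) = (Fintype.card F : ℝ) ^ (finrank F S - 1) - 1) :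
    (r - 1) * wt (fun p => w p ^ 2) S + (wt w S) ^ 2 = r * wt w S := by
  have h1 : ∑ p ∈ pts S, ∑ l ∈ cov p S, w p * (wt w l - 1) = 0 := by
    rw [Finset.sum_comm' (t' := subs 2 S) (s' := fun l => pts l)]
    · apply Finset.sum_eq_zero
      intro l hl
      rw [← Finset.sum_mul]
      rcases hL l (mem_subs.mp hl).2 with h | h
      · rw [h]; rw [wt] at h; rw [h]; ring
      · rw [h]; ring
    · intro p l
      rw [mem_pts, mem_cov, mem_pts, mem_subs]
      constructor
      · rintro ⟨⟨a, b⟩, c, d, e⟩; exact ⟨⟨a, c⟩, d, by omega⟩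
      · rintro ⟨⟨a, b⟩, c, d⟩; exact ⟨⟨a, b.trans c⟩, b, c, by omega⟩
  have h2 : ∀ p ∈ pts S, ∑ l ∈ cov p S, w p * (wt w l - 1) =
      w p * (wt w S - r) + (r - 1) * w p ^ 2 := by
    intro p hp
    rw [← Finset.mul_sum, Finset.sum_sub_distrib, line_sum w hp hr, Finset.sum_const,
      nsmul_eq_mul, cov_card_eq (mem_pts.mp hp).2 (by rw [(mem_pts.mp hp).1]; exact hr)]
    ring
  rw [Finset.sum_congr rfl h2, Finset.sum_add_distrib, ← Finset.sum_mul, ← Finset.mul_sum] at h1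
  rw [wt]
  change wt w S * (wt w S - r) + _ = 0 at h1
  linarith

theorem sum01_int {ι : Type*} (s : Finset ι) (g : ι → ℝ) (h : ∀ i ∈ s, g i = 0 ∨ g i = 1) :
    ∃ d : ℤ, (d : ℝ) = ∑ i ∈ s, g i ∧ 0 ≤ d ∧ (d : ℝ) ≤ s.card := by
  induction s using Finset.induction_on with
  | empty => exact ⟨0, by simp⟩
  | insert a s ha ih =>
    obtain ⟨d, h1, h2, h3⟩ := ih (fun i hi => h i (Finset.mem_insert_of_mem hi))
    rw [Finset.sum_insert ha, Finset.card_insert_of_notMem ha]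
    rcases h a (Finset.mem_insert_self _ _) with h0 | h0
    · exact ⟨d, by rw [h0, h1]; ring, h2, by push_cast; linarith⟩
    · exact ⟨d + 1, by rw [h0, ← h1]; push_cast; ring, by omega, by push_cast; linarith⟩

theorem deg_int {w : Submodule F V → ℝ} (hL : LB 2 w) {p S : Submodule F V} (hp : p ∈ pts S)
    {r : ℝ}
    (hr : r * ((Fintype.card F : ℝ) - 1) = (Fintype.card F : ℝ) ^ (finrank F S - 1) - 1) :
    ∃ d : ℤ, (d : ℝ) = wt w S + (r - 1) * w p ∧ 0 ≤ d ∧ (d : ℝ) ≤ r := by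
  rw [← line_sum w hp hr]
  rw [mem_pts] at hp
  rw [← cov_card_eq (r := r) hp.2 (by rw [hp.1]; exact hr)]
  apply sum01_int
  intro l hl
  apply hL
  rw [(mem_cov.mp hl).2.2, hp.1]

theorem exists_between {A B : Submodule F V} (hAB : A ≤ B) {k : ℕ} (h1 : finrank F A ≤ k)
    (h2 : k ≤ finrank F B) : ∃ S : Submodule F V, A ≤ S ∧ S ≤ B ∧ finrank F S = k := by
  induction k, h1 using Nat.le_induction with
  | base => exact ⟨A, le_refl _, hAB, rfl⟩
  | succ k hk ih =>
    obtain ⟨S, a, b, c⟩ := ih (by omega)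
    have : ¬ B ≤ S := by
      intro h
      have := Submodule.finrank_mono h
      omega
    obtain ⟨p, hp, hpB, hpS⟩ := exists_pt_of_not_le this
    exact ⟨S ⊔ p, le_sup_of_le_left a, sup_le b hpB, by rw [finrank_sup_pt hp hpS, c]⟩

theorem finrank_line {p r : Submodule F V} (hp : finrank F p = 1) (hr : finrank F r = 1)
    (h : p ≠ r) : finrank F ↥(p ⊔ r) = 2 := by
  rw [finrank_sup_pt hr (fun hc => h (pt_le_pt hr hp hc).symm), hp]

theorem uniq {u : Submodule F V → ℝ} {U : Submodule F V} {k : ℕ} (hk : 1 ≤ k)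
    (hU : k < finrank F U) (h : ∀ S ≤ U, finrank F S = k → wt u S = 0) :
    ∀ p ∈ pts U, u p = 0 := by
  have key : ∀ i j : ℕ, i + j = k → ∃ c : ℝ, ∀ S ≤ U, finrank F S = j → wt u S = c := by
    intro i
    induction i with
    | zero => intro j hj; exact ⟨0, fun S hS hd => h S hS (by omega)⟩
    | succ i ih =>
      intro j hj
      obtain ⟨c, hc⟩ := ih (j + 1) (by omega)
      have hq := q_gt_one (F := F)
      obtain ⟨N, hN⟩ : ∃ N : ℝ, N = ((Fintype.card F : ℝ) ^ (finrank F U - j) - 1) /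
        ((Fintype.card F : ℝ) - 1) := ⟨_, rfl⟩
      have hq1 : (Fintype.card F : ℝ) - 1 ≠ 0 := by linarith
      have hN1 : N - 1 ≠ 0 := by
        obtain ⟨e, he⟩ : ∃ e, finrank F U - j = e + 2 := ⟨finrank F U - j - 2, by omega⟩
        rw [hN, he]
        have : (Fintype.card F : ℝ) < (Fintype.card F : ℝ) ^ (e + 2) := by
          conv_lhs => rw [← pow_one (Fintype.card F : ℝ)]
          exact pow_lt_pow_right₀ hq (by omega)
        have h3 : 1 < ((Fintype.card F : ℝ) ^ (e + 2) - 1) / ((Fintype.card F : ℝ) - 1) := by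
          rw [lt_div_iff₀ (by linarith)]; linarith
        linarith
      refine ⟨(N * c - wt u U) / (N - 1), fun S hS hd => ?_⟩
      have := cov_sum u hS
      have hcard : ((cov S U).card : ℝ) = N := by
        apply cov_card_eq hS
        rw [hd, hN]; field_simp
      rw [Finset.sum_congr rfl (fun T hT => hc T (mem_cov.mp hT).2.1
        (by rw [(mem_cov.mp hT).2.2, hd])), Finset.sum_const, nsmul_eq_mul, hcard] at this
      field_simp
      linarith
  obtain ⟨c, hc⟩ := key (k - 1) 1 (by omega)
  have hp : ∀ p ∈ pts U, u p = c := by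
    intro p hp
    rw [mem_pts] at hp
    rw [← wt_pt u hp.1]
    exact hc p hp.2 hp.1
  obtain ⟨S, -, hS, hSk⟩ := exists_between (bot_le : ⊥ ≤ U) (k := k) (by simp) (by omega)
  have h0 := h S hS hSk
  rw [wt, Finset.sum_congr rfl (fun p hpS => hp p (pts_mono hS hpS)), Finset.sum_const,
    nsmul_eq_mul] at h0
  have hS0 : ¬ S ≤ ⊥ := by
    intro hb
    rw [le_bot_iff.mp hb] at hSk
    simp at hSk; omega
  obtain ⟨p, hp1, hpS, -⟩ := exists_pt_of_not_le hS0
  have hcard : ((pts S).card : ℝ) ≠ 0 := by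
    have : p ∈ pts S := mem_pts.mpr ⟨hp1, hpS⟩
    exact_mod_cast Finset.card_ne_zero_of_mem this
  have hc0 : c = 0 := by
    rcases mul_eq_zero.mp h0 with h | h
    · exact absurd h hcard
    · exact h
  intro p hpU
  rw [hp p hpU, hc0]

theorem fsp {v : V} (h : v ≠ 0) : finrank F (Submodule.span F ({v} : Set V)) = 1 :=
  finrank_span_singleton h

theorem span_pt {p : Submodule F V} (hp : finrank F p = 1) :
    ∃ v : V, v ≠ 0 ∧ p = Submodule.span F {v} := by
  have hb : ¬ p ≤ ⊥ := by
    intro h; rw [le_bot_iff.mp h] at hp; simp at hp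
  obtain ⟨v, hv, hv0⟩ := SetLike.not_le_iff_exists.mp hb
  have hv0' : v ≠ 0 := fun h => hv0 (by simp [h])
  exact ⟨v, hv0', (pt_le_pt (fsp hv0') hp (by simpa using hv)).symm⟩

theorem hyper {U : Submodule F V} {Z : Submodule F V → Prop}
    (h1 : ∀ p ∈ pts U, ∀ r ∈ pts U, p ≠ r → Z p → Z r → ∀ s ∈ pts (p ⊔ r), Z s)
    (h2 : ∀ p ∈ pts U, ∀ r ∈ pts U, p ≠ r → ∃ s ∈ pts (p ⊔ r), Z s)
    {p0 : Submodule F V} (hp0 : p0 ∈ pts U) (hZ : ¬ Z p0) :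
    ∃ H ≤ U, finrank F H + 1 = finrank F U ∧ ∀ p ∈ pts U, (Z p ↔ p ≤ H) := by
  have spn : ∀ v ∈ U, v ≠ 0 → Submodule.span F {v} ∈ pts U := by
    intro v hv h0
    exact mem_pts.mpr ⟨fsp h0, by simpa using hv⟩
  have hadd : ∀ a b : V, (a ∈ U ∧ (a ≠ 0 → Z (Submodule.span F {a}))) →
      (b ∈ U ∧ (b ≠ 0 → Z (Submodule.span F {b}))) →
      (a + b ∈ U ∧ (a + b ≠ 0 → Z (Submodule.span F {a + b}))) := by
    rintro a b ⟨ha, ha'⟩ ⟨hb, hb'⟩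
    refine ⟨add_mem ha hb, fun hab => ?_⟩
    by_cases a0 : a = 0
    · rw [a0, zero_add] at hab ⊢; exact hb' hab
    by_cases b0 : b = 0
    · rw [b0, add_zero] at hab ⊢; exact ha' hab
    have hmem : Submodule.span F {a + b} ≤ Submodule.span F {a} ⊔ Submodule.span F {b} := by
      rw [Submodule.span_singleton_le_iff_mem]
      exact Submodule.add_mem_sup (Submodule.mem_span_singleton_self a)
        (Submodule.mem_span_singleton_self b)
    by_cases e : Submodule.span F {a} = Submodule.span F {b}
    · rw [← e, sup_idem] at hmem
      have hh := pt_le_pt (fsp hab) (fsp (F := F) a0) hmem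
      rw [hh]
      exact ha' a0
    · have hm : Submodule.span F {a + b} ∈ pts (Submodule.span F {a} ⊔ Submodule.span F {b}) :=
        mem_pts.mpr ⟨fsp hab, hmem⟩
      exact h1 _ (spn a ha a0) _ (spn b hb b0) e (ha' a0) (hb' b0) _ hm
  have hsmul : ∀ (c : F) (a : V), (a ∈ U ∧ (a ≠ 0 → Z (Submodule.span F {a}))) →
      (c • a ∈ U ∧ (c • a ≠ 0 → Z (Submodule.span F {c • a}))) := by
    rintro c a ⟨ha, ha'⟩
    refine ⟨Submodule.smul_mem _ _ ha, fun hc => ?_⟩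
    have a0 : a ≠ 0 := fun h => hc (by rw [h, smul_zero])
    have hle : Submodule.span F {c • a} ≤ Submodule.span F {a} := by
      rw [Submodule.span_singleton_le_iff_mem]
      exact Submodule.smul_mem _ _ (Submodule.mem_span_singleton_self a)
    have hh := pt_le_pt (fsp hc) (fsp (F := F) a0) hle
    rw [hh]
    exact ha' a0
  obtain ⟨H, hHm⟩ : ∃ H : Submodule F V, ∀ v, v ∈ H ↔
      (v ∈ U ∧ (v ≠ 0 → Z (Submodule.span F {v}))) :=
    ⟨{ carrier := {v | v ∈ U ∧ (v ≠ 0 → Z (Submodule.span F {v}))}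
       zero_mem' := ⟨zero_mem _, fun h => absurd rfl h⟩
       add_mem' := fun {a b} ha hb => hadd a b ha hb
       smul_mem' := fun c a ha => hsmul c a ha }, fun v => Iff.rfl⟩
  have hHU : H ≤ U := fun v hv => ((hHm v).mp hv).1
  have hZH : ∀ p ∈ pts U, (Z p ↔ p ≤ H) := by
    intro p hp
    rw [mem_pts] at hp
    obtain ⟨v, hv, rfl⟩ := span_pt hp.1
    rw [Submodule.span_singleton_le_iff_mem]
    constructor
    · intro h; exact (hHm v).mpr ⟨by simpa using hp.2, fun _ => h⟩
    · intro h; exact ((hHm v).mp h).2 hv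
  have hp0' := mem_pts.mp hp0
  have hn : ¬ p0 ≤ H := fun h => hZ ((hZH p0 hp0).mpr h)
  refine ⟨H, hHU, ?_, hZH⟩
  rw [← finrank_sup_pt hp0'.1 hn]
  have : H ⊔ p0 = U := by
    apply le_antisymm (sup_le hHU hp0'.2)
    by_contra hc
    obtain ⟨p, hp1, hpU, hpn⟩ := exists_pt_of_not_le hc
    have hne : p ≠ p0 := by rintro rfl; exact hpn le_sup_right
    obtain ⟨s, hs, hsZ⟩ := h2 p (mem_pts.mpr ⟨hp1, hpU⟩) p0 hp0 hne
    rw [mem_pts] at hs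
    have hsU : s ∈ pts U := mem_pts.mpr ⟨hs.1, hs.2.trans (sup_le hpU hp0'.2)⟩
    have hsH := (hZH s hsU).mp hsZ
    have hsp : s ≠ p0 := by rintro rfl; exact hZ hsZ
    have hl : s ⊔ p0 = p ⊔ p0 := by
      apply Submodule.eq_of_le_of_finrank_eq (sup_le hs.2 le_sup_right)
      rw [finrank_line hs.1 hp0'.1 hsp, finrank_line hp1 hp0'.1 hne]
    exact hpn ((le_sup_left.trans hl.ge).trans (sup_le_sup_right hsH p0))
  rw [this]

noncomputable def comp (k : ℕ) (w : Submodule F V → ℝ) : Submodule F V → ℝ :=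
  fun p => ((Fintype.card F : ℝ) - 1) / ((Fintype.card F : ℝ) ^ k - 1) - w p

theorem comp_comp (k : ℕ) (w : Submodule F V → ℝ) : comp k (comp k w) = w := by
  funext p; simp [comp]

theorem wt_comp {k : ℕ} (hk : k ≠ 0) (w : Submodule F V → ℝ) {S : Submodule F V}
    (hS : finrank F S = k) : wt (comp k w) S = 1 - wt w S := by
  have h := card_pts S
  rw [hS] at h
  have hq := q_gt_one (F := F)
  have : (1:ℝ) < (Fintype.card F : ℝ) ^ k := one_lt_pow₀ hq hk
  have h2 : (Fintype.card F : ℝ) ^ k - 1 ≠ 0 := by linarith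
  simp only [wt, comp]
  rw [Finset.sum_sub_distrib, Finset.sum_const, nsmul_eq_mul, mul_div_assoc', h, div_self h2]

theorem LB_comp {k : ℕ} (hk : k ≠ 0) {w : Submodule F V → ℝ} (h : LB k w) : LB k (comp k w) := by
  intro S hS
  rw [wt_comp hk w hS]
  rcases h S hS with h | h <;> rw [h] <;> norm_num

end
end GC

namespace GC
section
variable {F V : Type*} [Field F] [Fintype F] [AddCommGroup V] [Module F V] [Finite V]

theorem sum_lin {ι : Type*} (s : Finset ι) (f g : ι → ℝ) (a b c : ℝ) :
    ∑ i ∈ s, (a * f i + b * g i + c) = a * ∑ i ∈ s, f i + b * ∑ i ∈ s, g i + s.card * c := by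
  rw [Finset.sum_add_distrib, Finset.sum_add_distrib, Finset.mul_sum, Finset.mul_sum,
    Finset.sum_const, nsmul_eq_mul]

theorem cc2 {q : ℝ} (hq : (Fintype.card F : ℝ) = q) {A B : Submodule F V} (h : A ≤ B)
    (hd : finrank F B = finrank F A + 2) : ((cov A B).card : ℝ) = q + 1 := by
  apply cov_card_eq h
  rw [hd, Nat.add_sub_cancel_left, hq]; ring

theorem cc3 {q : ℝ} (hq : (Fintype.card F : ℝ) = q) {A B : Submodule F V} (h : A ≤ B)
    (hd : finrank F B = finrank F A + 3) : ((cov A B).card : ℝ) = q ^ 2 + q + 1 := by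
  apply cov_card_eq h
  rw [hd, Nat.add_sub_cancel_left, hq]; ring

theorem cc4 {q : ℝ} (hq : (Fintype.card F : ℝ) = q) {A B : Submodule F V} (h : A ≤ B)
    (hd : finrank F B = finrank F A + 4) : ((cov A B).card : ℝ) = q ^ 3 + q ^ 2 + q + 1 := by
  apply cov_card_eq h
  rw [hd, Nat.add_sub_cancel_left, hq]; ring

theorem card_pts_eq {q : ℝ} (hq : (Fintype.card F : ℝ) = q) {S : Submodule F V} {r : ℝ}
    (hr : r * (q - 1) = q ^ finrank F S - 1) : ((pts S).card : ℝ) = r := by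
  have h := card_pts S
  have hq1 := q_gt_one (F := F)
  rw [hq] at h hq1
  have : q - 1 ≠ 0 := by linarith
  apply mul_right_cancel₀ this
  rw [hr, h]

theorem cp2 {q : ℝ} (hq : (Fintype.card F : ℝ) = q) {S : Submodule F V}
    (hd : finrank F S = 2) : ((pts S).card : ℝ) = q + 1 := by
  apply card_pts_eq hq; rw [hd]; ring

theorem E3 {w : Submodule F V → ℝ} (hL : LB 2 w) {q : ℝ} (hq : (Fintype.card F : ℝ) = q)
    {S : Submodule F V} (hS : finrank F S = 3) :
    q * wt (fun p => w p ^ 2) S + wt w S ^ 2 = (q + 1) * wt w S := by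
  have := E_id hL S (r := q + 1) (by rw [hS, hq]; ring)
  linarith

theorem E4 {w : Submodule F V → ℝ} (hL : LB 2 w) {q : ℝ} (hq : (Fintype.card F : ℝ) = q)
    {S : Submodule F V} (hS : finrank F S = 4) :
    (q ^ 2 + q) * wt (fun p => w p ^ 2) S + wt w S ^ 2 = (q ^ 2 + q + 1) * wt w S := by
  have := E_id hL S (r := q ^ 2 + q + 1) (by rw [hS, hq]; ring)
  linarith

theorem E5 {w : Submodule F V → ℝ} (hL : LB 2 w) {q : ℝ} (hq : (Fintype.card F : ℝ) = q)
    {S : Submodule F V} (hS : finrank F S = 5) :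
    (q ^ 3 + q ^ 2 + q) * wt (fun p => w p ^ 2) S + wt w S ^ 2
      = (q ^ 3 + q ^ 2 + q + 1) * wt w S := by
  have := E_id hL S (r := q ^ 3 + q ^ 2 + q + 1) (by rw [hS, hq]; ring)
  linarith

theorem f01 {w : Submodule F V → ℝ} (hL : LB 2 w) {l : Submodule F V} (hl : finrank F l = 2) :
    wt w l ^ 2 = wt w l := by
  rcases hL l hl with h | h <;> rw [h] <;> norm_num

/-- first moment identity on a line, any affine normalisation -/
theorem tau1 (w : Submodule F V → ℝ) {q : ℝ} (hq : (Fintype.card F : ℝ) = q) (κ : ℝ)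
    {l : Submodule F V} (hl : finrank F l = 2) :
    ∑ p ∈ pts l, (κ + q * w p) = (q + 1) * κ + q * wt w l := by
  rw [Finset.sum_add_distrib, Finset.sum_const, nsmul_eq_mul, cp2 hq hl, ← Finset.mul_sum]
  rfl

theorem tau2 (w : Submodule F V → ℝ) {q : ℝ} (hq : (Fintype.card F : ℝ) = q) (κ : ℝ)
    {l : Submodule F V} (hl : finrank F l = 2) :
    ∑ p ∈ pts l, (κ + q * w p) * (κ + q * w p - 1) =
      q ^ 2 * wt (fun p => w p ^ 2) l + q * (2 * κ - 1) * wt w l + (q + 1) * κ * (κ - 1) := by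
  have : ∀ p ∈ pts l, (κ + q * w p) * (κ + q * w p - 1) =
    q ^ 2 * (w p ^ 2) + q * (2 * κ - 1) * w p + κ * (κ - 1) := by intro p _; ring
  rw [Finset.sum_congr rfl this, sum_lin, cp2 hq hl]
  simp only [wt]; ring

theorem F1a (w : Submodule F V → ℝ) {q : ℝ} (hq : (Fintype.card F : ℝ) = q) (κ : ℝ)
    {l σ : Submodule F V} (hl : finrank F l = 2) (hσ : finrank F σ = 4) (h : l ≤ σ) :
    ∑ π ∈ cov l σ, (wt w π - κ) = (wt w σ - (q + 1) * κ) + q * wt w l := by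
  have hc := cc2 hq h (by omega)
  rw [Finset.sum_sub_distrib, cov_sum w h, Finset.sum_const, nsmul_eq_mul, hc]
  ring

theorem F1b {w : Submodule F V → ℝ} (hL : LB 2 w) {q : ℝ} (hq : (Fintype.card F : ℝ) = q) (κ : ℝ)
    {l σ : Submodule F V} (hl : finrank F l = 2) (hσ : finrank F σ = 4) (h : l ≤ σ) :
    (q + 1) * (∑ π ∈ cov l σ, (wt w π - κ) * (wt w π - κ - 1) +
      ∑ p ∈ pts l, (κ + q * w p) * (κ + q * w p - 1) - q * (q - 1) * wt w l) =
    ((q + 1) * κ) * ((q + 1) * κ - 1) +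
      (wt w σ - (q + 1) * κ) * (wt w σ - (q + 1) * κ - 1) := by
  have hc := cc2 hq h (by omega)
  have e : ∀ π ∈ cov l σ, (wt w π - κ) * (wt w π - κ - 1) =
      (q - 2 * κ) * wt w π + (- q) * wt (fun p => w p ^ 2) π + κ * (κ + 1) := by
    intro π hπ
    have := E3 hL hq (S := π) (by rw [(mem_cov.mp hπ).2.2]; omega)
    linear_combination this
  rw [Finset.sum_congr rfl e, sum_lin, cov_sum w h, cov_sum _ h, hc, tau2 w hq κ hl]
  have e4 := E4 hL hq hσ
  have f := f01 hL hl
  linear_combination (-1) * e4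

theorem b1 (w : Submodule F V → ℝ) {q : ℝ} (hq : (Fintype.card F : ℝ) = q) (κ : ℝ)
    {π U : Submodule F V} (hπ : finrank F π = 3) (hU : finrank F U = 5) (h : π ≤ U)
    (hκ : wt w U = (q ^ 2 + q + 1) * κ) :
    ∑ σ ∈ cov π U, (wt w σ - (q + 1) * κ) = q * (wt w π - κ) := by
  have hc := cc2 hq h (by omega)
  rw [Finset.sum_sub_distrib, cov_sum w h, Finset.sum_const, nsmul_eq_mul, hc, hκ]
  ring

theorem b2 {w : Submodule F V → ℝ} (hL : LB 2 w) {q : ℝ} (hq : (Fintype.card F : ℝ) = q) (κ : ℝ)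
    {π U : Submodule F V} (hπ : finrank F π = 3) (hU : finrank F U = 5) (h : π ≤ U)
    (hκ : wt w U = (q ^ 2 + q + 1) * κ) :
    ∑ σ ∈ cov π U, (wt w σ - (q + 1) * κ) * (wt w σ - (q + 1) * κ - 1)
      = q * (q + 1) * ((wt w π - κ) * (wt w π - κ - 1)) := by
  have hc := cc2 hq h (by omega)
  have e : ∀ σ ∈ cov π U, (wt w σ - (q + 1) * κ) * (wt w σ - (q + 1) * κ - 1) =
      (q ^ 2 + q - 2 * ((q + 1) * κ)) * wt w σ + (- (q ^ 2 + q)) * wt (fun p => w p ^ 2) σ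
        + ((q + 1) * κ) * ((q + 1) * κ + 1) := by
    intro σ hσ
    have := E4 hL hq (S := σ) (by rw [(mem_cov.mp hσ).2.2]; omega)
    linear_combination this
  have hq1 := q_gt_one (F := F)
  rw [hq] at hq1
  have hne : q ^ 2 + q + 1 ≠ 0 := by positivity
  rw [Finset.sum_congr rfl e, sum_lin, cov_sum w h, cov_sum _ h, hc]
  have e5 := E5 hL hq hU
  have e3 := E3 hL hq hπ
  have e5' : (q ^ 2 + q + 1) * (q * wt (fun p => w p ^ 2) U) =
     (q ^ 2 + q + 1) * (κ * (q ^ 3 + q ^ 2 + q + 1 - (q ^ 2 + q + 1) * κ)) := by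
    rw [hκ] at e5; linear_combination e5
  have e5'' := mul_left_cancel₀ hne e5'
  rw [hκ]
  linear_combination (-(q + 1)) * e5'' - q * (q+1) * e3

theorem F3 (w : Submodule F V → ℝ) {q : ℝ} (hq : (Fintype.card F : ℝ) = q) (κ : ℝ)
    {l U : Submodule F V} (hl : finrank F l = 2) (hU : finrank F U = 5) (h : l ≤ U)
    (hκ : wt w U = (q ^ 2 + q + 1) * κ) :
    ∑ π ∈ cov l U, (wt w π - κ) = q * (q + 1) * wt w l := by
  have hc := cc3 hq h (by omega)
  rw [Finset.sum_sub_distrib, cov_sum w h, Finset.sum_const, nsmul_eq_mul, hc, hκ]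
  ring

theorem L0 {w : Submodule F V → ℝ} (hL : LB 2 w) {q : ℝ} (hq : (Fintype.card F : ℝ) = q) (κ : ℝ)
    {l U : Submodule F V} (hl : finrank F l = 2) (hU : finrank F U = 5) (h : l ≤ U)
    (hκ : wt w U = (q ^ 2 + q + 1) * κ) :
    ∑ π ∈ cov l U, (wt w π - κ) ^ 2 = q ^ 2 * (q + 1) * wt w l +
      ((q + 1) * κ) * ((q + 1) * κ - 1) -
      (q + 1) * ∑ p ∈ pts l, (κ + q * w p) * (κ + q * w p - 1) := by
  have hc := cc3 hq h (by omega)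
  have e : ∀ π ∈ cov l U, (wt w π - κ) ^ 2 =
      (q + 1 - 2 * κ) * wt w π + (- q) * wt (fun p => w p ^ 2) π + κ ^ 2 := by
    intro π hπ
    have := E3 hL hq (S := π) (by rw [(mem_cov.mp hπ).2.2]; omega)
    linear_combination this
  have hq1 := q_gt_one (F := F)
  rw [hq] at hq1
  have hne : q ^ 2 + q + 1 ≠ 0 := by positivity
  rw [Finset.sum_congr rfl e, sum_lin, cov_sum w h, cov_sum _ h, hc, tau2 w hq κ hl]
  have e5 := E5 hL hq hU
  have e5' : (q ^ 2 + q + 1) * (q * wt (fun p => w p ^ 2) U) =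
     (q ^ 2 + q + 1) * (κ * (q ^ 3 + q ^ 2 + q + 1 - (q ^ 2 + q + 1) * κ)) := by
    rw [hκ] at e5; linear_combination e5
  have e5'' := mul_left_cancel₀ hne e5'
  rw [hκ]
  have f := f01 hL hl
  linear_combination (-1) * e5''

/-- type step on a zero line -/
theorem type_step {w : Submodule F V → ℝ} (hL : LB 2 w) {q : ℝ} (hq : (Fintype.card F : ℝ) = q)
    {l U : Submodule F V} (hl : finrank F l = 2) (hU : finrank F U = 5) (h : l ≤ U)
    (hz : wt w l = 0) {p0 : Submodule F V} {d0 : ℝ}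
    (hd : d0 = wt w U + (q ^ 3 + q ^ 2 + q) * w p0) :
    (q ^ 2 + q + 1) * (∑ π ∈ cov l U, (wt w π + q * w p0) ^ 2
      - (∑ p ∈ pts l, q * (w p - w p0)) ^ 2 + (q + 1) * ∑ p ∈ pts l, (q * (w p - w p0)) ^ 2
      - q * (∑ p ∈ pts l, q * (w p - w p0)) - d0) = d0 ^ 2 - d0 := by
  have hc := cc3 hq h (by omega)
  have e : ∀ π ∈ cov l U, (wt w π + q * w p0) ^ 2 =
      (q + 1 + 2 * (q * w p0)) * wt w π + (- q) * wt (fun p => w p ^ 2) π + (q * w p0) ^ 2 := by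
    intro π hπ
    have := E3 hL hq (S := π) (by rw [(mem_cov.mp hπ).2.2]; omega)
    linear_combination this
  have e5 := E5 hL hq hU
  have m1 : ∑ p ∈ pts l, q * (w p - w p0) = - (q + 1) * (q * w p0) := by
    rw [← Finset.mul_sum, Finset.sum_sub_distrib, Finset.sum_const, nsmul_eq_mul, cp2 hq hl]
    change q * (wt w l - _) = _
    rw [hz]; ring
  have m2 : ∑ p ∈ pts l, (q * (w p - w p0)) ^ 2 =
     q ^ 2 * wt (fun p => w p ^ 2) l + (q + 1) * (q * w p0) ^ 2 := by
    have : ∀ p ∈ pts l, (q * (w p - w p0)) ^ 2 =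
      q ^ 2 * (w p ^ 2) + (-2 * q ^ 2 * w p0) * w p + (q * w p0) ^ 2 := by intro p _; ring
    rw [Finset.sum_congr rfl this, sum_lin, cp2 hq hl]
    change q ^ 2 * wt (fun p => w p ^ 2) l + _ * wt w l + _ = _
    rw [hz]; ring
  rw [Finset.sum_congr rfl e, sum_lin, cov_sum w h, cov_sum _ h, hc, hz, m1, m2, hd]
  linear_combination (-1) * e5

theorem wt_range {w : Submodule F V → ℝ} (hL : LB 2 w) (S : Submodule F V) {r t : ℝ}
    (hr : r * ((Fintype.card F : ℝ) - 1) = (Fintype.card F : ℝ) ^ (finrank F S - 1) - 1)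
    (ht : t * ((Fintype.card F : ℝ) - 1) = (Fintype.card F : ℝ) ^ (finrank F S) - 1) :
    0 ≤ wt w S * (t + r - 1) ∧ wt w S * (t + r - 1) ≤ t * r := by
  have hc : ((pts S).card : ℝ) = t := card_pts_eq rfl ht
  have e : wt w S * (t + r - 1) = ∑ p ∈ pts S, (wt w S + (r - 1) * w p) := by
    rw [Finset.sum_add_distrib, Finset.sum_const, nsmul_eq_mul, hc, ← Finset.mul_sum]
    change _ = t * _ + (r - 1) * wt w S
    ring
  rw [e]
  constructor
  · apply Finset.sum_nonneg
    intro p hp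
    obtain ⟨d, h1, h2, h3⟩ := deg_int hL hp hr
    rw [← h1]; exact_mod_cast h2
  · rw [← hc, ← nsmul_eq_mul, ← Finset.sum_const]
    apply Finset.sum_le_sum
    intro p hp
    obtain ⟨d, h1, h2, h3⟩ := deg_int hL hp hr
    rw [← h1]; exact h3

theorem mdiff {w : Submodule F V → ℝ} (hL : LB 2 w) {q : ℝ} (hq : (Fintype.card F : ℝ) = q)
    {U p r : Submodule F V} (hU : 3 ≤ finrank F U) (hp : p ∈ pts U) (hr : r ∈ pts U) :
    ∃ m : ℤ, (m : ℝ) = q * (w p - w r) := by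
  rw [mem_pts] at hp hr
  obtain ⟨S, h1, h2, h3⟩ := exists_between (sup_le hp.2 hr.2) (k := 3) (by
    by_cases e : p = r
    · rw [e, sup_idem, hr.1]; omega
    · rw [finrank_line hp.1 hr.1 e]; omega) hU
  obtain ⟨d1, e1, -⟩ := deg_int hL (p := p) (S := S) (r := q + 1)
    (mem_pts.mpr ⟨hp.1, le_sup_left.trans h1⟩) (by rw [h3, hq]; ring)
  obtain ⟨d2, e2, -⟩ := deg_int hL (p := r) (S := S) (r := q + 1)
    (mem_pts.mpr ⟨hr.1, le_sup_right.trans h1⟩) (by rw [h3, hq]; ring)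
  exact ⟨d1 - d2, by push_cast; rw [e1, e2]; ring⟩

end
end GC

namespace GC
section
variable {F V : Type*} [Field F] [Fintype F] [AddCommGroup V] [Module F V] [Finite V]

structure T0 (q : ℤ) (U : Submodule F V) (y : ℤ) (t s z f : Submodule F V → ℤ) : Prop where
  hU : finrank F U = 5
  hq : (Fintype.card F : ℤ) = q
  hf : ∀ l ∈ subs 2 U, f l = 0 ∨ f l = 1
  ht : ∀ p ∈ pts U, 0 ≤ t p ∧ t p ≤ q
  hy : 0 ≤ y ∧ y ≤ q ^ 2
  hs : ∀ π ∈ subs 3 U, 0 ≤ (q + 1) * s π + y ∧ (q + 1) * s π + y ≤ q ^ 2 + q + 1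
  hz : ∀ σ ∈ subs 4 U, - y ≤ z σ ∧ z σ ≤ q ^ 2 + 1 - y
  line : ∀ l ∈ subs 2 U, ∑ p ∈ pts l, t p = y + q * f l
  degU : ∀ p ∈ pts U, ∑ l ∈ cov p U, f l = (q ^ 2 + q + 1) * t p
  degP : ∀ π ∈ subs 3 U, ∀ p ∈ pts π, ∑ l ∈ cov p π, f l = t p + s π
  F1a : ∀ l ∈ subs 2 U, ∀ σ ∈ subs 4 U, l ≤ σ → ∑ π ∈ cov l σ, s π = z σ + q * f l
  F1b : ∀ l ∈ subs 2 U, ∀ σ ∈ subs 4 U, l ≤ σ →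
    (q + 1) * (∑ π ∈ cov l σ, s π * (s π - 1) + ∑ p ∈ pts l, t p * (t p - 1)
      - q * (q - 1) * f l) = y * (y - 1) + z σ * (z σ - 1)
  b1 : ∀ π ∈ subs 3 U, ∑ σ ∈ cov π U, z σ = q * s π
  b2 : ∀ π ∈ subs 3 U, ∑ σ ∈ cov π U, z σ * (z σ - 1) = q * (q + 1) * (s π * (s π - 1))
  F3 : ∀ l ∈ subs 2 U, ∑ π ∈ cov l U, s π = q * (q + 1) * f l
  L0 : ∀ l ∈ subs 2 U, ∑ π ∈ cov l U, s π ^ 2 = q ^ 2 * (q + 1) * f l + y * (y - 1)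
    - (q + 1) * ∑ p ∈ pts l, t p * (t p - 1)

def ZR : Subring ℝ := (Int.castRingHom ℝ).range

theorem mem_ZR {x : ℝ} : x ∈ ZR ↔ ∃ n : ℤ, (n : ℝ) = x := by
  simp [ZR]

theorem floor_ZR {x : ℝ} (h : x ∈ ZR) : ((⌊x⌋ : ℤ) : ℝ) = x := by
  obtain ⟨n, rfl⟩ := mem_ZR.mp h
  simp

theorem mem_subs_of_cov {p l U : Submodule F V} {j : ℕ} (h : l ∈ cov p U)
    (hp : finrank F p = j) : l ∈ subs (j + 1) U := by
  rw [mem_cov] at h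
  exact mem_subs.mpr ⟨h.2.1, by rw [h.2.2, hp]⟩

theorem exists_T0 {w : Submodule F V → ℝ} (hL : LB 2 w) {q : ℤ}
    (hq : (Fintype.card F : ℤ) = q) {U : Submodule F V} (hU : finrank F U = 5) {κ : ℝ}
    (hκ : wt w U = ((q : ℝ) ^ 2 + q + 1) * κ)
    (ht : ∀ p ∈ pts U, κ + q * w p ∈ ZR) :
    ∃ (y : ℤ) (t s z f : Submodule F V → ℤ), T0 q U y t s z f ∧
      (y : ℝ) = (q + 1) * κ ∧ (∀ p ∈ pts U, (t p : ℝ) = κ + q * w p) ∧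
      ∀ l : Submodule F V, finrank F l = 2 → (f l : ℝ) = wt w l := by
  have hq' : (Fintype.card F : ℝ) = (q : ℝ) := by rw [← hq]; simp
  have hq1 := q_gt_one (F := F)
  rw [hq'] at hq1
  have hq1' : 1 < q := by exact_mod_cast hq1
  have qZ : (q : ℝ) ∈ ZR := mem_ZR.mpr ⟨q, rfl⟩
  have oZ : (1 : ℝ) ∈ ZR := ZR.one_mem
  have fZ : ∀ l : Submodule F V, finrank F l = 2 → wt w l ∈ ZR := by
    intro l hl
    rcases hL l hl with h | h <;> rw [h]
    exacts [ZR.zero_mem, oZ]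
  have ptex : ∀ S : Submodule F V, 1 ≤ finrank F S → ∃ p, p ∈ pts S := by
    intro S hS
    obtain ⟨p, -, h1, h2⟩ := exists_between (bot_le : ⊥ ≤ S) (k := 1) (by simp) hS
    exact ⟨p, mem_pts.mpr ⟨h2, h1⟩⟩
  have yZ : (q + 1) * κ ∈ ZR := by
    obtain ⟨l, -, h1, h2⟩ := exists_between (bot_le : ⊥ ≤ U) (k := 2) (by simp) (by omega)
    have e := tau1 w hq' κ h2
    have : (q + 1) * κ = ∑ p ∈ pts l, (κ + q * w p) - q * wt w l := by rw [e]; ring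
    rw [this]
    exact sub_mem (sum_mem (fun p hp => ht p (pts_mono h1 hp))) (mul_mem qZ (fZ l h2))
  have sZ : ∀ π ∈ subs 3 U, wt w π - κ ∈ ZR := by
    intro π hπ
    rw [mem_subs] at hπ
    obtain ⟨p, hp⟩ := ptex π (by omega)
    obtain ⟨d, hd, -⟩ := deg_int hL hp (r := q + 1) (by rw [hπ.2, hq']; ring)
    have : wt w π - κ = d - (κ + q * w p) := by rw [hd]; ring
    rw [this]
    exact sub_mem (mem_ZR.mpr ⟨d, rfl⟩) (ht p (pts_mono hπ.1 hp))
  have zZ : ∀ σ ∈ subs 4 U, wt w σ - (q + 1) * κ ∈ ZR := by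
    intro σ hσ
    rw [mem_subs] at hσ
    obtain ⟨p, hp⟩ := ptex σ (by omega)
    obtain ⟨d, hd, -⟩ := deg_int hL hp (r := (q : ℝ) ^ 2 + q + 1) (by rw [hσ.2, hq']; ring)
    have : wt w σ - (q + 1) * κ = d - (q + 1) * (κ + q * w p) := by rw [hd]; ring
    rw [this]
    exact sub_mem (mem_ZR.mpr ⟨d, rfl⟩) (mul_mem (add_mem qZ oZ) (ht p (pts_mono hσ.1 hp)))
  refine ⟨⌊(q + 1) * κ⌋, fun p => ⌊κ + q * w p⌋, fun π => ⌊wt w π - κ⌋,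
    fun σ => ⌊wt w σ - (q + 1) * κ⌋, fun l => ⌊wt w l⌋, ?_, floor_ZR yZ,
    fun p hp => floor_ZR (ht p hp), fun l hl => floor_ZR (fZ l hl)⟩
  obtain ⟨y, hy⟩ : ∃ y : ℤ, y = ⌊(q + 1) * κ⌋ := ⟨_, rfl⟩
  obtain ⟨t, htt⟩ : ∃ t : Submodule F V → ℤ, t = fun p => ⌊κ + q * w p⌋ := ⟨_, rfl⟩
  obtain ⟨s, hs⟩ : ∃ s : Submodule F V → ℤ, s = fun π => ⌊wt w π - κ⌋ := ⟨_, rfl⟩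
  obtain ⟨z, hz⟩ : ∃ z : Submodule F V → ℤ, z = fun σ => ⌊wt w σ - (q + 1) * κ⌋ := ⟨_, rfl⟩
  obtain ⟨f, hf⟩ : ∃ f : Submodule F V → ℤ, f = fun l => ⌊wt w l⌋ := ⟨_, rfl⟩
  rw [← hy, ← htt, ← hs, ← hz, ← hf]
  have yR : (y : ℝ) = (q + 1) * κ := by rw [hy]; exact floor_ZR yZ
  have tR : ∀ p ∈ pts U, (t p : ℝ) = κ + q * w p := by
    intro p hp; rw [htt]; exact floor_ZR (ht p hp)
  have sR : ∀ π ∈ subs 3 U, (s π : ℝ) = wt w π - κ := by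
    intro p hp; rw [hs]; exact floor_ZR (sZ p hp)
  have zR : ∀ π ∈ subs 4 U, (z π : ℝ) = wt w π - (q + 1) * κ := by
    intro p hp; rw [hz]; exact floor_ZR (zZ p hp)
  have fR : ∀ l ∈ subs 2 U, (f l : ℝ) = wt w l := by
    intro p hp; rw [hf]; exact floor_ZR (fZ p (mem_subs.mp hp).2)
  clear hy htt hs hz hf
  have tl : ∀ l ∈ subs 2 U, ∀ p ∈ pts l, (t p : ℝ) = κ + q * w p :=
    fun l hl p hp => tR p (pts_mono (mem_subs.mp hl).1 hp)
  have e1 : ∀ l ∈ subs 2 U, ∑ p ∈ pts l, (t p : ℝ) * ((t p : ℝ) - 1) =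
     ∑ p ∈ pts l, (κ + q * w p) * (κ + q * w p - 1) := by
    intro l hl
    apply Finset.sum_congr rfl
    intro p hp; rw [tl l hl p hp]
  refine ⟨hU, hq, ?_, ?_, ?_, ?_, ?_, ?_, ?_, ?_, ?_, ?_, ?_, ?_, ?_, ?_⟩
  · intro l hl
    have := fR l hl
    rcases hL l (mem_subs.mp hl).2 with h | h <;> rw [h] at this
    · left; exact_mod_cast this
    · right; exact_mod_cast this
  · intro p hp
    obtain ⟨d, h1, h2, h3⟩ := deg_int hL hp (r := (q : ℝ) ^ 3 + q ^ 2 + q + 1)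
      (by rw [hU, hq']; ring)
    have e : (d : ℝ) = (q ^ 2 + q + 1) * t p := by rw [tR p hp, h1, hκ]; ring
    have e' : d = (q ^ 2 + q + 1) * t p := by exact_mod_cast e
    have h3' : d ≤ q ^ 3 + q ^ 2 + q + 1 := by exact_mod_cast h3
    constructor
    · by_contra hc
      push Not at hc
      nlinarith
    · by_contra hc
      push Not at hc
      nlinarith
  · have := wt_range hL U (r := (q : ℝ) ^ 3 + q ^ 2 + q + 1)
      (t := (q : ℝ) ^ 4 + q ^ 3 + q ^ 2 + q + 1) (by rw [hU, hq']; ring) (by rw [hU, hq']; ring)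
    have e : wt w U * ((q : ℝ) ^ 4 + q ^ 3 + q ^ 2 + q + 1 + (q ^ 3 + q ^ 2 + q + 1) - 1) =
      (q ^ 2 + q + 1) * y * (q ^ 3 + q ^ 2 + q + 1) := by rw [hκ, yR]; ring
    rw [e] at this
    have h1 : 0 ≤ (q ^ 2 + q + 1) * y * (q ^ 3 + q ^ 2 + q + 1) := by exact_mod_cast this.1
    have h2 : (q ^ 2 + q + 1) * y * (q ^ 3 + q ^ 2 + q + 1) ≤
      (q ^ 4 + q ^ 3 + q ^ 2 + q + 1) * (q ^ 3 + q ^ 2 + q + 1) := by exact_mod_cast this.2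
    have h3 := le_of_mul_le_mul_right h2 (by positivity)
    have h4 : 0 ≤ (q ^ 2 + q + 1) * y := by
      by_contra hc
      push Not at hc
      have : (q ^ 2 + q + 1) * y * (q ^ 3 + q ^ 2 + q + 1) < 0 :=
        mul_neg_of_neg_of_pos hc (by positivity)
      omega
    constructor
    · by_contra hc
      push Not at hc
      have : (q ^ 2 + q + 1) * y < 0 := mul_neg_of_pos_of_neg (by positivity) hc
      omega
    · by_contra hc
      push Not at hc
      have : (q ^ 2 + q + 1) * (q ^ 2 + 1) ≤ (q ^ 2 + q + 1) * y :=
        mul_le_mul_of_nonneg_left (by omega) (by positivity)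
      nlinarith
  · intro π hπ
    have hd := (mem_subs.mp hπ).2
    have := wt_range hL π (r := (q : ℝ) + 1)
      (t := (q : ℝ) ^ 2 + q + 1) (by rw [hd, hq']; ring) (by rw [hd, hq']; ring)
    have e : wt w π * ((q : ℝ) ^ 2 + q + 1 + (q + 1) - 1) =
      ((q + 1) * s π + y) * (q + 1) := by rw [sR π hπ, yR]; ring
    rw [e] at this
    have h1 : 0 ≤ ((q + 1) * s π + y) * (q + 1) := by exact_mod_cast this.1
    have h2 : ((q + 1) * s π + y) * (q + 1) ≤ (q ^ 2 + q + 1) * (q + 1) := by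
      exact_mod_cast this.2
    exact ⟨nonneg_of_mul_nonneg_left h1 (by positivity), le_of_mul_le_mul_right h2 (by positivity)⟩
  · intro σ hσ
    have hd := (mem_subs.mp hσ).2
    have := wt_range hL σ (r := (q : ℝ) ^ 2 + q + 1)
      (t := (q : ℝ) ^ 3 + q ^ 2 + q + 1) (by rw [hd, hq']; ring) (by rw [hd, hq']; ring)
    have e : wt w σ * ((q : ℝ) ^ 3 + q ^ 2 + q + 1 + (q ^ 2 + q + 1) - 1) =
      (z σ + y) * ((q + 1) * (q ^ 2 + q + 1)) := by rw [zR σ hσ, yR]; ring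
    rw [e] at this
    have h1 : 0 ≤ (z σ + y) * ((q + 1) * (q ^ 2 + q + 1)) := by exact_mod_cast this.1
    have h2 : (z σ + y) * ((q + 1) * (q ^ 2 + q + 1)) ≤
      (q ^ 3 + q ^ 2 + q + 1) * (q ^ 2 + q + 1) := by exact_mod_cast this.2
    have h2' : (z σ + y) * ((q + 1) * (q ^ 2 + q + 1)) ≤
      (q ^ 2 + 1) * ((q + 1) * (q ^ 2 + q + 1)) := by linarith
    have h3 := nonneg_of_mul_nonneg_left h1 (by positivity)
    have h4 := le_of_mul_le_mul_right h2' (by positivity)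
    constructor <;> omega
  · intro l hl
    have := tau1 w hq' κ (mem_subs.mp hl).2
    rw [← Finset.sum_congr rfl (tl l hl), ← yR, ← fR l hl] at this
    exact_mod_cast this
  · intro p hp
    have := line_sum w hp (r := (q : ℝ) ^ 3 + q ^ 2 + q + 1) (by rw [hU, hq']; ring)
    rw [← Finset.sum_congr rfl (fun l hl => fR l (mem_subs_of_cov hl (mem_pts.mp hp).1))] at this
    have e : ∑ l ∈ cov p U, (f l : ℝ) = (q ^ 2 + q + 1) * t p := by
      rw [this, tR p hp, hκ]; ring
    exact_mod_cast e
  · intro π hπ p hp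
    have hd := (mem_subs.mp hπ)
    have := line_sum w hp (r := (q : ℝ) + 1) (by rw [hd.2, hq']; ring)
    rw [← Finset.sum_congr rfl (fun l hl => fR l (by
      have := mem_subs_of_cov hl (mem_pts.mp hp).1
      rw [mem_subs] at this ⊢
      exact ⟨this.1.trans hd.1, this.2⟩))] at this
    have e : ∑ l ∈ cov p π, (f l : ℝ) = t p + s π := by
      rw [this, tR p (pts_mono hd.1 hp), sR π hπ]; ring
    exact_mod_cast e
  · intro l hl σ hσ h
    have h1 := mem_subs.mp hl
    have h2 := mem_subs.mp hσ
    have := F1a w hq' κ h1.2 h2.2 h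
    rw [← Finset.sum_congr rfl (fun π hπ => sR π (by
      have := mem_subs_of_cov hπ h1.2
      rw [mem_subs] at this ⊢
      exact ⟨this.1.trans h2.1, this.2⟩)), ← zR σ hσ, ← fR l hl] at this
    exact_mod_cast this
  · intro l hl σ hσ h
    have h1 := mem_subs.mp hl
    have h2 := mem_subs.mp hσ
    have := F1b hL hq' κ h1.2 h2.2 h
    have e2 : ∑ π ∈ cov l σ, (wt w π - κ) * (wt w π - κ - 1) =
        ∑ π ∈ cov l σ, (s π : ℝ) * (s π - 1) := by
      apply Finset.sum_congr rfl
      intro π hπ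
      rw [sR π (by
        have := mem_subs_of_cov hπ h1.2
        rw [mem_subs] at this ⊢
        exact ⟨this.1.trans h2.1, this.2⟩)]
    rw [← e1 l hl, e2, ← zR σ hσ, ← fR l hl, ← yR] at this
    exact_mod_cast this
  · intro π hπ
    have h1 := mem_subs.mp hπ
    have := b1 w hq' κ h1.2 hU h1.1 hκ
    rw [← Finset.sum_congr rfl (fun σ hσ => zR σ (mem_subs_of_cov hσ h1.2)), ← sR π hπ] at this
    exact_mod_cast this
  · intro π hπ
    have h1 := mem_subs.mp hπ
    have := b2 hL hq' κ h1.2 hU h1.1 hκ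
    have e2 : ∑ σ ∈ cov π U, (wt w σ - (q + 1) * κ) * (wt w σ - (q + 1) * κ - 1) =
        ∑ σ ∈ cov π U, (z σ : ℝ) * (z σ - 1) := by
      apply Finset.sum_congr rfl
      intro σ hσ
      rw [zR σ (mem_subs_of_cov hσ h1.2)]
    rw [e2, ← sR π hπ] at this
    exact_mod_cast this
  · intro l hl
    have h1 := mem_subs.mp hl
    have := F3 w hq' κ h1.2 hU h1.1 hκ
    rw [← Finset.sum_congr rfl (fun σ hσ => sR σ (mem_subs_of_cov hσ h1.2)), ← fR l hl] at this
    exact_mod_cast this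
  · intro l hl
    have h1 := mem_subs.mp hl
    have := L0 hL hq' κ h1.2 hU h1.1 hκ
    have e2 : ∑ σ ∈ cov l U, (wt w σ - κ) ^ 2 =
        ∑ σ ∈ cov l U, (s σ : ℝ) ^ 2 := by
      apply Finset.sum_congr rfl
      intro σ hσ
      rw [sR σ (mem_subs_of_cov hσ h1.2)]
    rw [e2, ← e1 l hl, ← yR, ← fR l hl] at this
    exact_mod_cast this

/-- on a zero line -/
theorem type_dvd {w : Submodule F V → ℝ} (hL : LB 2 w) {q : ℤ}
    (hq : (Fintype.card F : ℤ) = q) {U : Submodule F V} (hU : finrank F U = 5)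
    {l : Submodule F V} (hl : l ∈ subs 2 U) (hz : wt w l = 0) :
    ∃ d0 : ℤ, (q ^ 2 + q + 1) ∣ d0 * (d0 - 1) ∧ ∀ p ∈ pts U, ∃ m : ℤ,
      (d0 : ℝ) + (q ^ 2 + q + 1) * m = wt w U + (q ^ 3 + q ^ 2 + q) * w p := by
  have hq' : (Fintype.card F : ℝ) = (q : ℝ) := by rw [← hq]; simp
  have qZ : (q : ℝ) ∈ ZR := mem_ZR.mpr ⟨q, rfl⟩
  have oZ : (1 : ℝ) ∈ ZR := ZR.one_mem
  rw [mem_subs] at hl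
  obtain ⟨p0, -, h1, h2⟩ := exists_between (bot_le : ⊥ ≤ l) (k := 1) (by simp) (by omega)
  have hp0 : p0 ∈ pts U := mem_pts.mpr ⟨h2, h1.trans hl.1⟩
  obtain ⟨d0, hd, -, -⟩ := deg_int hL hp0 (r := (q : ℝ) ^ 3 + q ^ 2 + q + 1)
      (by rw [hU, hq']; ring)
  have hd' : (d0 : ℝ) = wt w U + (q ^ 3 + q ^ 2 + q) * w p0 := by rw [hd]; ring
  refine ⟨d0, ?_, ?_⟩
  · have key := type_step hL hq' hl.2 hU hl.1 hz hd'
    have mZ : ∀ p ∈ pts l, q * (w p - w p0) ∈ ZR := fun p hp =>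
      mem_ZR.mpr (mdiff hL hq' (U := U) (by omega) (pts_mono hl.1 hp) hp0)
    have eZ : ∀ π ∈ cov l U, wt w π + q * w p0 ∈ ZR := by
      intro π hπ
      rw [mem_cov] at hπ
      obtain ⟨d, hd, -⟩ := deg_int hL (mem_pts.mpr ⟨h2, h1.trans hπ.1⟩) (r := q + 1)
        (by rw [hπ.2.2, hl.2, hq']; ring)
      exact mem_ZR.mpr ⟨d, by rw [hd]; ring⟩
    have XZ : (∑ π ∈ cov l U, (wt w π + q * w p0) ^ 2
      - (∑ p ∈ pts l, q * (w p - w p0)) ^ 2 + (q + 1) * ∑ p ∈ pts l, (q * (w p - w p0)) ^ 2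
      - q * (∑ p ∈ pts l, q * (w p - w p0)) - d0) ∈ ZR := by
      refine sub_mem (sub_mem (add_mem (sub_mem (sum_mem fun π hπ => pow_mem (eZ π hπ) 2)
        (pow_mem (sum_mem mZ) 2)) (mul_mem (add_mem qZ oZ)
        (sum_mem fun p hp => pow_mem (mZ p hp) 2))) (mul_mem qZ (sum_mem mZ)))
        (mem_ZR.mpr ⟨d0, rfl⟩)
    obtain ⟨X, hX⟩ := mem_ZR.mp XZ
    rw [← hX] at key
    refine ⟨X, ?_⟩
    have : (d0 * (d0 - 1) : ℝ) = (q ^ 2 + q + 1) * X := by rw [key]; ring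
    exact_mod_cast this
  · intro p hp
    obtain ⟨m, hm⟩ := mdiff hL hq' (U := U) (by omega) hp hp0
    exact ⟨m, by rw [hm, hd']; ring⟩

end
end GC

namespace GC
section
variable {F V : Type*} [Field F] [Fintype F] [AddCommGroup V] [Module F V] [Finite V]
variable {q : ℤ} {U : Submodule F V} {y : ℤ} {t s z f : Submodule F V → ℤ}

theorem T0.hqR (T : T0 q U y t s z f) : (Fintype.card F : ℝ) = (q : ℝ) := by
  rw [← T.hq]; simp

theorem T0.q1 (T : T0 q U y t s z f) : 1 < q := by
  have := q_gt_one (F := F)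
  rw [T.hqR] at this
  exact_mod_cast this

theorem T0.cpl (T : T0 q U y t s z f) {l : Submodule F V} (hl : finrank F l = 2) :
    ((pts l).card : ℤ) = q + 1 := by
  have := cp2 T.hqR hl
  exact_mod_cast this

theorem T0.cc2 (T : T0 q U y t s z f) {A B : Submodule F V} (h : A ≤ B)
    (hd : finrank F B = finrank F A + 2) : ((cov A B).card : ℤ) = q + 1 := by
  have := GC.cc2 T.hqR h hd
  exact_mod_cast this

theorem T0.cc3 (T : T0 q U y t s z f) {A B : Submodule F V} (h : A ≤ B)
    (hd : finrank F B = finrank F A + 3) : ((cov A B).card : ℤ) = q ^ 2 + q + 1 := by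
  have := GC.cc3 T.hqR h hd
  exact_mod_cast this

theorem T0.cc4 (T : T0 q U y t s z f) {A B : Submodule F V} (h : A ≤ B)
    (hd : finrank F B = finrank F A + 4) : ((cov A B).card : ℤ) = q ^ 3 + q ^ 2 + q + 1 := by
  have := GC.cc4 T.hqR h hd
  exact_mod_cast this

theorem subs_trans {j : ℕ} {A B S : Submodule F V} (h : S ∈ subs j A) (hAB : A ≤ B) :
    S ∈ subs j B := by
  rw [mem_subs] at *
  exact ⟨h.1.trans hAB, h.2⟩

theorem exists_sub {A : Submodule F V} {j : ℕ} (h : j ≤ finrank F A) : ∃ S, S ∈ subs j A := by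
  obtain ⟨p, -, h1, h2⟩ := exists_between (bot_le : ⊥ ≤ A) (k := j) (by simp) h
  exact ⟨p, mem_subs.mpr ⟨h1, h2⟩⟩

theorem exists_pt {A : Submodule F V} (h : 1 ≤ finrank F A) : ∃ S, S ∈ pts A := by
  obtain ⟨p, -, h1, h2⟩ := exists_between (bot_le : ⊥ ≤ A) (k := 1) (by simp) h
  exact ⟨p, mem_pts.mpr ⟨h2, h1⟩⟩

theorem sum_all_one {ι : Type*} {C : Finset ι} {g : ι → ℤ} (h : ∀ i ∈ C, g i = 1) :
    ∑ i ∈ C, g i = C.card := by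
  rw [Finset.sum_congr rfl h]; simp

theorem T0.tsq (T : T0 q U y t s z f) {l : Submodule F V} (hl : l ∈ subs 2 U) :
    (y + q * f l) ^ 2 ≤ (q + 1) * (∑ p ∈ pts l, t p * (t p - 1) + (y + q * f l)) := by
  have h := sq_sum_le_card_mul_sum_sq (s := pts l) (f := t)
  rw [T.cpl (mem_subs.mp hl).2, T.line l hl] at h
  have e : ∑ p ∈ pts l, t p ^ 2 = ∑ p ∈ pts l, t p * (t p - 1) + (y + q * f l) := by
    rw [← T.line l hl, ← Finset.sum_add_distrib]
    apply Finset.sum_congr rfl; intro p _; ring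
  rwa [e] at h

theorem T0.bound (T : T0 q U y t s z f) {l : Submodule F V} (hl : l ∈ subs 2 U) :
    ∑ π ∈ cov l U, s π ^ 2 ≤ q ^ 2 * (q + 1) * f l + y * (y - 1) - (y + q * f l) ^ 2
      + (q + 1) * (y + q * f l) := by
  have := T.tsq hl
  rw [T.L0 l hl]; linarith

theorem T0.ex0 (T : T0 q U y t s z f) : ∃ l ∈ subs 2 U, f l = 0 := by
  by_contra hc
  push Not at hc
  obtain ⟨p, hp⟩ := exists_pt (A := U) (by rw [T.hU]; omega)
  have hp' := mem_pts.mp hp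
  have h1 := T.degU p hp
  rw [sum_all_one (fun l hl => by
    have hm := mem_subs_of_cov hl hp'.1
    rcases T.hf l hm with h | h
    · exact absurd h (hc l hm)
    · exact h), T.cc4 hp'.2 (by rw [hp'.1, T.hU])] at h1
  have hq := T.q1
  have h2 : (q ^ 2 + q + 1) * (t p - q) = 1 := by linarith
  have h3 : (q ^ 2 + q + 1) ∣ 1 := ⟨_, h2.symm⟩
  have h4 := Int.le_of_dvd (by norm_num) h3
  nlinarith

theorem T0.ex1 (T : T0 q U y t s z f) (hy : 0 < y) : ∃ l ∈ subs 2 U, f l = 1 := by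
  by_contra hc
  push Not at hc
  have h0 : ∀ l ∈ subs 2 U, f l = 0 := fun l hl => (T.hf l hl).resolve_right (hc l hl)
  obtain ⟨l, hl⟩ := exists_sub (A := U) (j := 2) (by rw [T.hU]; omega)
  have h1 := T.line l hl
  have hq := T.q1
  rw [h0 l hl, Finset.sum_eq_zero] at h1
  · omega
  · intro p hp
    have hpU := pts_mono (mem_subs.mp hl).1 hp
    have h2 := T.degU p hpU
    rw [Finset.sum_eq_zero (fun m hm => h0 m (mem_subs_of_cov hm (mem_pts.mp hp).1))] at h2
    rcases mul_eq_zero.mp h2.symm with h | h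
    · nlinarith
    · exact h

theorem T0.plane0 (T : T0 q U y t s z f) {π : Submodule F V} (hπ : π ∈ subs 3 U)
    (h : ∀ l ∈ subs 2 π, f l = 1) {p : Submodule F V} (hp : p ∈ pts π) : t p + s π = q + 1 := by
  have h1 := T.degP π hπ p hp
  have hp' := mem_pts.mp hp
  rw [sum_all_one (fun l hl => h l (mem_subs_of_cov hl hp'.1)),
    T.cc2 hp'.2 (by rw [hp'.1, (mem_subs.mp hπ).2])] at h1
  omega

theorem T0.ex0plane (T : T0 q U y t s z f) {π : Submodule F V} (hπ : π ∈ subs 3 U)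
    (h : s π ≤ 0) : ∃ l ∈ subs 2 π, f l = 0 := by
  by_contra hc
  push Not at hc
  have h1 : ∀ l ∈ subs 2 π, f l = 1 := fun l hl =>
    (T.hf l (subs_trans hl (mem_subs.mp hπ).1)).resolve_left (hc l hl)
  obtain ⟨p, hp⟩ := exists_pt (A := π) (by rw [(mem_subs.mp hπ).2]; omega)
  have h2 := T.plane0 hπ h1 hp
  have h3 := (T.ht p (pts_mono (mem_subs.mp hπ).1 hp)).2
  omega

theorem T0.F4 (T : T0 q U y t s z f) (hy : 0 < y) (hy2 : y < q ^ 2) :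
    ∃ π ∈ subs 3 U, s π ≠ 0 ∧ s π ≠ 1 := by
  by_contra hc
  push Not at hc
  have hq := T.q1
  obtain ⟨l, hl, hl1⟩ := T.ex1 hy
  have hl' := mem_subs.mp hl
  have h3 := T.F3 l hl
  have : ∃ π ∈ cov l U, s π ≠ 0 := by
    by_contra hc2
    push Not at hc2
    rw [Finset.sum_eq_zero hc2, hl1] at h3
    nlinarith
  obtain ⟨π, hπ, hs⟩ := this
  have hπ3 : π ∈ subs 3 U := mem_subs_of_cov hπ hl'.2
  have hs1 := hc π hπ3 hs
  have hπ' := mem_subs.mp hπ3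
  have all1 : ∀ m ∈ subs 2 π, f m = 1 := by
    intro m hm
    have hmU := subs_trans hm hπ'.1
    refine (T.hf m hmU).resolve_left (fun h0 => ?_)
    have h4 := T.F3 m hmU
    rw [h0, mul_zero, Finset.sum_eq_zero_iff_of_nonneg] at h4
    · have := h4 π (mem_cov.mpr ⟨(mem_subs.mp hm).1, hπ'.1, by rw [hπ'.2, (mem_subs.mp hm).2]⟩)
      omega
    · intro π' hπ''
      by_cases h5 : s π' = 0
      · omega
      · have := hc π' (mem_subs_of_cov hπ'' (mem_subs.mp hm).2) h5
        omega
  have h6 := T.line l hl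
  have hlπ := (mem_cov.mp hπ).1
  rw [Finset.sum_congr rfl (fun p hp => show t p = q by
    have := T.plane0 hπ3 all1 (pts_mono hlπ hp); omega), Finset.sum_const, nsmul_eq_mul,
    T.cpl hl'.2, hl1] at h6
  nlinarith

theorem even_mul_pred (n : ℤ) : ∃ k, n * (n - 1) = 2 * k := by
  have := Int.even_mul_pred_self n
  obtain ⟨k, hk⟩ := this
  exact ⟨k, by omega⟩

theorem T0.dv (T : T0 q U y t s z f) {σ : Submodule F V} (hσ : σ ∈ subs 4 U) :
    ∃ k, y * (y - 1) + z σ * (z σ - 1) = 2 * (q + 1) * k := by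
  have hσ' := mem_subs.mp hσ
  obtain ⟨l, hl⟩ := exists_sub (A := σ) (j := 2) (by rw [hσ'.2]; omega)
  have hlU := subs_trans hl hσ'.1
  have h := T.F1b l hlU σ hσ (mem_subs.mp hl).1
  choose g hg using even_mul_pred
  rw [← h, Finset.sum_congr rfl (fun π _ => hg (s π)), Finset.sum_congr rfl (fun p _ => hg (t p)),
    ← Finset.mul_sum, ← Finset.mul_sum, hg q]
  exact ⟨∑ π ∈ cov l σ, g (s π) + ∑ p ∈ pts l, g (t p) - g q * f l, by ring⟩

theorem zz_nonneg (n : ℤ) : 0 ≤ n * (n - 1) := by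
  rcases le_or_gt n 0 with h | h
  · nlinarith
  · nlinarith

theorem zz_eq {n : ℤ} (h : n * (n - 1) = 0) : n = 0 ∨ n = 1 := by
  rcases mul_eq_zero.mp h with h | h
  · left; exact h
  · right; omega

theorem T0.lemA (T : T0 q U y t s z f) (h : ∀ σ ∈ subs 4 U, z σ ≠ 0 ∧ z σ ≠ 1)
    {π : Submodule F V} (hπ : π ∈ subs 3 U) : s π ≠ 0 ∧ s π ≠ 1 := by
  by_contra hc
  have h0 : s π * (s π - 1) = 0 := by
    by_cases h1 : s π = 0
    · rw [h1]; ring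
    · have : s π = 1 := by
        by_contra h2; exact hc ⟨h1, h2⟩
      rw [this]; ring
  have hπ' := mem_subs.mp hπ
  have hb := T.b2 π hπ
  rw [h0, mul_zero, Finset.sum_eq_zero_iff_of_nonneg (fun σ _ => zz_nonneg (z σ))] at hb
  obtain ⟨σ, h1, h2, h3⟩ := exists_between hπ'.1 (k := 4) (by omega) (by rw [T.hU]; omega)
  have := zz_eq (hb σ (mem_cov.mpr ⟨h1, h2, by rw [h3, hπ'.2]⟩))
  have h4 := h σ (mem_subs.mpr ⟨h2, h3⟩)
  tauto

theorem T0.lemB (T : T0 q U y t s z f) (h : ∀ π ∈ subs 3 U, s π ≠ 0 ∧ s π ≠ 1)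
    {l : Submodule F V} (hl : l ∈ subs 2 U) :
    q * (q + 1) * f l + 2 * (q ^ 2 + q + 1) ≤ q ^ 2 * (q + 1) * f l + y * (y - 1)
      - (y + q * f l) ^ 2 + (q + 1) * (y + q * f l) := by
  have hl' := mem_subs.mp hl
  refine le_trans ?_ (T.bound hl)
  rw [← T.F3 l hl, ← T.cc3 hl'.1 (by rw [hl'.2, T.hU]), mul_comm (2 : ℤ), ← nsmul_eq_mul,
    ← Finset.sum_const, ← Finset.sum_add_distrib]
  apply Finset.sum_le_sum
  intro π hπ
  obtain ⟨h1, h2⟩ := h π (mem_subs_of_cov hπ hl'.2)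
  rcases lt_or_gt_of_ne h1 with h3 | h3
  · nlinarith
  · have : 2 ≤ s π := by omega
    nlinarith

theorem T0.mid2 (T : T0 2 U y t s z f) : y ≤ 1 ∨ 3 ≤ y := by
  by_contra hc
  have hy : y = 2 := by omega
  obtain ⟨σ, hσ⟩ := exists_sub (A := U) (j := 4) (by rw [T.hU]; omega)
  obtain ⟨k, hk⟩ := T.dv hσ
  obtain ⟨a, r, h1, h2, h3⟩ : ∃ a r, z σ = 3 * a + r ∧ 0 ≤ r ∧ r < 3 :=
    ⟨z σ / 3, z σ % 3, by omega, by omega, by omega⟩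
  rw [h1, hy] at hk
  ring_nf at hk
  interval_cases r <;> ring_nf at hk <;> omega

theorem T0.mid3 (T : T0 3 U y t s z f) : y ≤ 1 ∨ 8 ≤ y := by
  by_contra hc
  have hz : ∀ σ ∈ subs 4 U, z σ ≠ 0 ∧ z σ ≠ 1 := by
    intro σ hσ
    obtain ⟨k, hk⟩ := T.dv hσ
    have h1 : 2 ≤ y := by omega
    have h2 : y ≤ 7 := by omega
    constructor
    · intro h; rw [h] at hk; interval_cases y <;> omega
    · intro h; rw [h] at hk; interval_cases y <;> omega
  obtain ⟨l, hl, hf⟩ := T.ex0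
  have := T.lemB (fun π hπ => T.lemA hz hπ) hl
  rw [hf] at this
  ring_nf at this
  omega

theorem counts {ι : Type*} (C : Finset ι) (z : ι → ℤ) (L : Finset ℤ) (h : ∀ i ∈ C, z i ∈ L)
    (g : ℤ → ℤ) : ∑ i ∈ C, g (z i) = ∑ v ∈ L, ((C.filter (fun i => z i = v)).card : ℤ) * g v := by
  rw [← Finset.sum_fiberwise_of_maps_to h]
  apply Finset.sum_congr rfl
  intro v _
  rw [Finset.sum_congr rfl (fun i hi => by rw [(Finset.mem_filter.mp hi).2]), Finset.sum_const,
    nsmul_eq_mul]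

end
end GC

namespace GC
section
variable {F V : Type*} [Field F] [Fintype F] [AddCommGroup V] [Module F V] [Finite V]
variable {U : Submodule F V} {y : ℤ} {t s z f : Submodule F V → ℤ}

theorem mod4 {y z k : ℤ} (h : y * (y - 1) + z * (z - 1) = 2 * (4 + 1) * k) :
    (y % 5 = 0 ∨ y % 5 = 1) ∧ (z % 5 = 0 ∨ z % 5 = 1) := by
  obtain ⟨a, r, h1, h2, h3⟩ : ∃ a r, z = 5 * a + r ∧ 0 ≤ r ∧ r < 5 :=
    ⟨z / 5, z % 5, by omega, by omega, by omega⟩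
  obtain ⟨b, r', h1', h2', h3'⟩ : ∃ a r, y = 5 * a + r ∧ 0 ≤ r ∧ r < 5 :=
    ⟨y / 5, y % 5, by omega, by omega, by omega⟩
  subst h1 h1'
  interval_cases r <;> interval_cases r' <;> ring_nf at h <;> omega

theorem mod5 {y z k : ℤ} (h : y * (y - 1) + z * (z - 1) = 2 * (5 + 1) * k) :
    ((y % 12 = 0 ∨ y % 12 = 1 ∨ y % 12 = 4 ∨ y % 12 = 9) ∧
      (z % 12 = 0 ∨ z % 12 = 1 ∨ z % 12 = 4 ∨ z % 12 = 9)) ∨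
    (¬ (y % 12 = 0 ∨ y % 12 = 1 ∨ y % 12 = 4 ∨ y % 12 = 9) ∧ z ≠ 0 ∧ z ≠ 1) := by
  have key : ∀ x : ℤ, ∃ c, x * (x - 1) = 12 * c + (x % 12) * (x % 12 - 1) := by
    intro x
    refine ⟨12 * (x / 12) * (x / 12) + 2 * (x / 12) * (x % 12) - x / 12, ?_⟩
    have : x = 12 * (x / 12) + x % 12 := by omega
    generalize x / 12 = a at *
    generalize x % 12 = r at *
    subst this; ring
  obtain ⟨c, hc⟩ := key y
  obtain ⟨d, hd⟩ := key z
  have hy1 := Int.emod_nonneg y (show (12:ℤ) ≠ 0 by norm_num)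
  have hy2 := Int.emod_lt_of_pos y (show (0:ℤ) < 12 by norm_num)
  have hz1 := Int.emod_nonneg z (show (12:ℤ) ≠ 0 by norm_num)
  have hz2 := Int.emod_lt_of_pos z (show (0:ℤ) < 12 by norm_num)
  have hz0 : z = 0 → z % 12 = 0 := by omega
  have hz01 : z = 1 → z % 12 = 1 := by omega
  rw [hc, hd] at h
  generalize y % 12 = r at *
  generalize z % 12 = r' at *
  interval_cases r <;> interval_cases r' <;> omega

def feas : List ℤ → ℕ → ℤ → ℤ → Bool
  | [], n, a, b => Nat.beq n 0 && Nat.beq a.natAbs 0 && Nat.beq b.natAbs 0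
  | v :: L, n, a, b =>
    (List.range (n + 1)).any (fun m => feas L (n - m) (a - m * v) (b - m * (v * (v - 1))))

theorem feas_sound (L : List ℤ) : ∀ {ι : Type*} (C : Finset ι) (z : ι → ℤ)
    (_ : ∀ i ∈ C, z i ∈ L),
    feas L C.card (∑ i ∈ C, z i) (∑ i ∈ C, z i * (z i - 1)) = true := by
  induction L with
  | nil =>
    intro ι C z h
    have : C = ∅ := by
      rw [Finset.eq_empty_iff_forall_notMem]
      intro i hi; simpa using h i hi
    subst this
    simp [feas]
  | cons v L ih =>
    intro ι C z h
    rw [feas, List.any_eq_true]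
    have e1 := Finset.card_filter_add_card_filter_not (s := C) (fun i => z i = v)
    refine ⟨(C.filter (fun i => z i = v)).card, by rw [List.mem_range]; omega, ?_⟩
    have := ih (C.filter (fun i => ¬ z i = v)) z (by
      intro i hi
      rw [Finset.mem_filter] at hi
      have := h i hi.1
      rw [List.mem_cons] at this
      exact this.resolve_left hi.2)
    have e2 : ∀ g : ℤ → ℤ, ∑ i ∈ C, g (z i) = (C.filter (fun i => z i = v)).card * g v +
        ∑ i ∈ C.filter (fun i => ¬ z i = v), g (z i) := by
      intro g
      rw [← Finset.sum_filter_add_sum_filter_not C (fun i => z i = v)]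
      congr 1
      rw [Finset.sum_congr rfl (fun i hi => by rw [(Finset.mem_filter.mp hi).2]),
        Finset.sum_const, nsmul_eq_mul]
    have e3 := e2 (fun v => v)
    have e4 := e2 (fun v => v * (v - 1))
    rw [e3, e4, add_sub_cancel_left, add_sub_cancel_left, ← e1, Nat.add_sub_cancel_left]
    exact this

theorem feas_absurd (L : List ℤ) {ι : Type*} (C : Finset ι) (z : ι → ℤ) {n : ℕ} {a b : ℤ}
    (hn : C.card = n) (ha : ∑ i ∈ C, z i = a) (hb : ∑ i ∈ C, z i * (z i - 1) = b)
    (hf : feas L n a b = false) : ∃ i ∈ C, z i ∉ L := by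
  by_contra hc
  push Not at hc
  have := feas_sound L C z hc
  rw [hn, ha, hb, hf] at this
  exact absurd this (by simp)

theorem arith4 {ι : Type*} (C : Finset ι) (z : ι → ℤ) {y s : ℤ} (hn : C.card = 5)
    (ha : ∑ i ∈ C, z i = 4 * s) (hb : ∑ i ∈ C, z i * (z i - 1) = 4 * (4 + 1) * (s * (s - 1)))
    (hz : ∀ i ∈ C, (z i % 5 = 0 ∨ z i % 5 = 1) ∧ -y ≤ z i ∧ z i ≤ 17 - y)
    (hy : y = 5 ∨ y = 6 ∨ y = 10 ∨ y = 11) (h1 : 0 ≤ (4 + 1) * s + y)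
    (h2 : (4 + 1) * s + y ≤ 21) (hs0 : s ≠ 0) (hs1 : s ≠ 1) :
    s = -2 ∧ (y = 10 ∨ y = 11) ∧ ∃ i ∈ C, z i = -5 := by
  have hA : y ≤ 6 → ∀ i ∈ C, z i ∈ ([-5,-4,0,1,5,6,10,11] : List ℤ) := by
    intro h i hi; have := hz i hi; simp; omega
  have hB : 10 ≤ y → ∀ i ∈ C, z i ∈ ([-10,-9,-5,-4,0,1,5,6] : List ℤ) := by
    intro h i hi; have := hz i hi; simp; omega
  by_cases hy6 : y ≤ 6
  · exfalso
    have : s = -1 ∨ s = 2 ∨ s = 3 := by omega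
    rcases this with rfl | rfl | rfl <;>
    · obtain ⟨i, hi, h⟩ := feas_absurd [-5,-4,0,1,5,6,10,11] C z hn ha hb (by decide +kernel)
      exact h (hA hy6 i hi)
  · have hy10 : 10 ≤ y := by omega
    have : s = -1 ∨ s = 2 ∨ s = -2 := by omega
    rcases this with rfl | rfl | rfl
    · exfalso
      obtain ⟨i, hi, h⟩ := feas_absurd [-10,-9,-5,-4,0,1,5,6] C z hn ha hb (by decide +kernel)
      exact h (hB hy10 i hi)
    · exfalso
      obtain ⟨i, hi, h⟩ := feas_absurd [-10,-9,-5,-4,0,1,5,6] C z hn ha hb (by decide +kernel)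
      exact h (hB hy10 i hi)
    · refine ⟨rfl, by omega, ?_⟩
      obtain ⟨i, hi, h⟩ := feas_absurd [-10,-9,-4,0,1,5,6] C z hn ha hb (by decide +kernel)
      refine ⟨i, hi, ?_⟩
      have := hB hy10 i hi
      simp at this h
      omega

theorem T0.arith4' (T : T0 4 U y t s z f) (hy : 1 < y) (hy2 : y < 15) {π : Submodule F V}
    (hπ : π ∈ subs 3 U) (hs0 : s π ≠ 0) (hs1 : s π ≠ 1) :
    s π = -2 ∧ (y = 10 ∨ y = 11) ∧ ∃ σ ∈ cov π U, z σ = -5 := by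
  have hπ' := mem_subs.mp hπ
  have hm : ∀ σ ∈ cov π U, σ ∈ subs 4 U := fun σ h => mem_subs_of_cov h hπ'.2
  have hc := T.cc2 hπ'.1 (by rw [hπ'.2, T.hU])
  have hy' : y = 5 ∨ y = 6 ∨ y = 10 ∨ y = 11 := by
    obtain ⟨σ, hσ⟩ := exists_sub (A := U) (j := 4) (by rw [T.hU]; omega)
    obtain ⟨k, hk⟩ := T.dv hσ
    have := (mod4 hk).1
    omega
  have hs := T.hs π hπ
  refine arith4 (cov π U) z (by omega) (T.b1 π hπ) (T.b2 π hπ) ?_ hy' hs.1 (by linarith [hs.2])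
    hs0 hs1
  intro σ hσ
  obtain ⟨k, hk⟩ := T.dv (hm σ hσ)
  have := T.hz σ (hm σ hσ)
  exact ⟨(mod4 hk).2, this.1, by linarith [this.2]⟩

theorem T0.mid4 (T : T0 4 U y t s z f) : y ≤ 1 ∨ 15 ≤ y := by
  by_contra hc
  have hy1 : 1 < y := by omega
  have hy2 : y < 15 := by omega
  obtain ⟨π, hπ, h0, h1⟩ := T.F4 (by omega) (by omega)
  obtain ⟨hs, hy, σ, hσ, hz⟩ := T.arith4' hy1 hy2 hπ h0 h1
  have hσ' := mem_cov.mp hσ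
  have hσ4 : σ ∈ subs 4 U := mem_subs_of_cov hσ (mem_subs.mp hπ).2
  obtain ⟨l, hl, hl0⟩ := T.ex0plane hπ (by omega)
  have hlU := subs_trans hl (mem_subs.mp hπ).1
  have hlσ : l ≤ σ := (mem_subs.mp hl).1.trans hσ'.1
  have e1 := T.F1a l hlU σ hσ4 hlσ
  have e2 := T.F1b l hlU σ hσ4 hlσ
  have e3 := T.tsq hlU
  rw [hl0, hz] at e1 e2
  rw [hl0] at e3
  have e4 : ∑ π ∈ cov l σ, (-3) * s π ≤ ∑ π ∈ cov l σ, s π * (s π - 1) := by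
    apply Finset.sum_le_sum
    intro π' hπ'
    have hπU : π' ∈ subs 3 U := subs_trans (mem_subs_of_cov hπ' (mem_subs.mp hl).2)
      (mem_subs.mp hσ4).1
    by_cases a0 : s π' = 0
    · rw [a0]; norm_num
    by_cases a1 : s π' = 1
    · rw [a1]; norm_num
    rw [(T.arith4' hy1 hy2 hπU a0 a1).1]; norm_num
  rw [← Finset.mul_sum, e1] at e4
  rcases hy with rfl | rfl <;> omega

end
end GC

namespace GC
section
variable {F V : Type*} [Field F] [Fintype F] [AddCommGroup V] [Module F V] [Finite V]
variable {U : Submodule F V} {y : ℤ} {t s z f : Submodule F V → ℤ}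

def L5 : List ℤ := [-20,-15,-12,-11,-8,-3,0,1,4,9,12,13,16,21]

theorem arith5a {ι : Type*} (C : Finset ι) (z : ι → ℤ) {s : ℤ} (hn : C.card = 6)
    (ha : ∑ i ∈ C, z i = 5 * s) (hb : ∑ i ∈ C, z i * (z i - 1) = 5 * (5 + 1) * (s * (s - 1)))
    (hz : ∀ i ∈ C, z i ∈ L5) (h1 : -3 ≤ s) (h2 : s ≤ 4) : s % 3 ≠ 2 := by
  intro h
  have hs : s = -1 ∨ s = 2 := by omega
  have hb' : ∑ i ∈ C, z i * (z i - 1) = 60 := by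
    rw [hb]; rcases hs with rfl | rfl <;> norm_num
  have hz' : ∀ i ∈ C, z i ∈ ([-3,0,1,4] : List ℤ) := by
    intro i hi
    have h1 := Finset.single_le_sum (f := fun i => z i * (z i - 1))
      (fun i _ => zz_nonneg (z i)) hi
    rw [hb'] at h1
    have h2 := hz i hi
    simp only [L5, List.mem_cons, List.not_mem_nil, or_false] at h2 ⊢
    have h3 : z i ≤ 8 := by nlinarith
    have h4 : -7 ≤ z i := by nlinarith
    omega
  rcases hs with rfl | rfl
  · obtain ⟨i, hi, h⟩ := feas_absurd [-3,0,1,4] C z hn ha hb' (by decide +kernel)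
    exact h (hz' i hi)
  · obtain ⟨i, hi, h⟩ := feas_absurd [-3,0,1,4] C z hn ha hb' (by decide +kernel)
    exact h (hz' i hi)

theorem arith5b {ι : Type*} (C : Finset ι) (z : ι → ℤ) {s : ℤ} (hn : C.card = 6)
    (ha : ∑ i ∈ C, z i = 5 * s) (hb : ∑ i ∈ C, z i * (z i - 1) = 5 * (5 + 1) * (s * (s - 1)))
    (hz : ∀ i ∈ C, z i ∈ L5) (c : ℤ) (hc : ∀ i ∈ C, (z i * (z i - 1)) % 36 = c)
    (h1 : -3 ≤ s) (h2 : s ≤ 4) (hs0 : s ≠ 0) (hs1 : s ≠ 1) :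
    s = -3 ∧ ∃ i ∈ C, z i = 4 := by
  have h3 := arith5a C z hn ha hb hz h1 h2
  have h4 : s = -3 ∨ s = -2 ∨ s = 3 ∨ s = 4 := by omega
  have cl : ∀ i ∈ C, (c = 0 ∧ z i ∈ ([-8,0,1,9] : List ℤ)) ∨
      (c = 12 ∧ z i ∈ ([-12,-3,4,13] : List ℤ)) ∨
      (c = 24 ∧ z i ∈ ([-20,-15,-11,12,16,21] : List ℤ)) := by
    intro i hi
    have a := hz i hi
    have b := hc i hi
    generalize z i = v at *
    simp only [L5, List.mem_cons, List.not_mem_nil, or_false] at a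
    rcases a with rfl | rfl | rfl | rfl | rfl | rfl | rfl | rfl | rfl | rfl | rfl | rfl | rfl | rfl <;>
    norm_num at b <;> subst b <;> simp
  obtain ⟨i0, hi0⟩ : C.Nonempty := by rw [← Finset.card_pos]; omega
  rcases cl i0 hi0 with ⟨h, -⟩ | ⟨h, -⟩ | ⟨h, -⟩
  · exfalso
    have cl' : ∀ i ∈ C, z i ∈ ([-8,0,1,9] : List ℤ) := by
      intro i hi
      rcases cl i hi with ⟨h', a⟩ | ⟨h', a⟩ | ⟨h', a⟩
      · exact a
      · omega
      · omega
    rcases h4 with rfl | rfl | rfl | rfl <;>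
    · obtain ⟨i, hi, h⟩ := feas_absurd [-8,0,1,9] C z hn ha hb (by decide +kernel)
      exact h (cl' i hi)
  · have cl' : ∀ i ∈ C, z i ∈ ([-12,-3,4,13] : List ℤ) := by
      intro i hi
      rcases cl i hi with ⟨h', a⟩ | ⟨h', a⟩ | ⟨h', a⟩
      · omega
      · exact a
      · omega
    rcases h4 with rfl | rfl | rfl | rfl
    · refine ⟨rfl, ?_⟩
      obtain ⟨i, hi, h⟩ := feas_absurd [-12,-3,13] C z hn ha hb (by decide +kernel)
      refine ⟨i, hi, ?_⟩
      have := cl' i hi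
      simp at this h
      omega
    all_goals
      exfalso
      obtain ⟨i, hi, h⟩ := feas_absurd [-12,-3,4,13] C z hn ha hb (by decide +kernel)
      exact h (cl' i hi)
  · exfalso
    have cl' : ∀ i ∈ C, z i ∈ ([-20,-15,-11,12,16,21] : List ℤ) := by
      intro i hi
      rcases cl i hi with ⟨h', a⟩ | ⟨h', a⟩ | ⟨h', a⟩
      · omega
      · omega
      · exact a
    rcases h4 with rfl | rfl | rfl | rfl <;>
    · obtain ⟨i, hi, h⟩ := feas_absurd [-20,-15,-11,12,16,21] C z hn ha hb (by decide +kernel)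
      exact h (cl' i hi)

theorem T0.mid5 (T : T0 5 U y t s z f) : y ≤ 1 ∨ 24 ≤ y := by
  by_contra hc
  have hy1 : 1 < y := by omega
  have hy2 : y < 24 := by omega
  by_cases hy : y % 12 = 0 ∨ y % 12 = 1 ∨ y % 12 = 4 ∨ y % 12 = 9
  swap
  · have hz : ∀ σ ∈ subs 4 U, z σ ≠ 0 ∧ z σ ≠ 1 := by
      intro σ hσ
      obtain ⟨k, hk⟩ := T.dv hσ
      rcases mod5 hk with h | h
      · exact absurd h.1 hy
      · exact h.2
    have hs : ∀ π ∈ subs 3 U, s π ≠ 0 ∧ s π ≠ 1 := fun π hπ => T.lemA hz hπ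
    obtain ⟨l0, hl0, e0⟩ := T.ex0
    obtain ⟨l1, hl1, e1⟩ := T.ex1 (by omega)
    have a := T.lemB hs hl0
    have b := T.lemB hs hl1
    rw [e0] at a
    rw [e1] at b
    ring_nf at a b
    omega
  have hy' : 4 ≤ y ∧ y ≤ 21 := by omega
  have hzL : ∀ σ ∈ subs 4 U, z σ ∈ L5 := by
    intro σ hσ
    obtain ⟨k, hk⟩ := T.dv hσ
    have h1 := T.hz σ hσ
    rcases mod5 hk with h | h
    · have h2 := h.2
      simp only [L5, List.mem_cons, List.not_mem_nil, or_false]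
      omega
    · exact absurd hy h.1
  have hm : ∀ π ∈ subs 3 U, ∀ σ ∈ cov π U, σ ∈ subs 4 U :=
    fun π hπ σ h => mem_subs_of_cov h (mem_subs.mp hπ).2
  have hcard : ∀ π ∈ subs 3 U, (cov π U).card = 6 := by
    intro π hπ
    have hc := T.cc2 (mem_subs.mp hπ).1 (by rw [(mem_subs.mp hπ).2, T.hU])
    omega
  have hsr : ∀ π ∈ subs 3 U, -3 ≤ s π ∧ s π ≤ 4 := by
    intro π hπ
    have := T.hs π hπ
    omega
  have hs3 : ∀ π ∈ subs 3 U, s π % 3 ≠ 2 := fun π hπ =>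
    arith5a (cov π U) z (hcard π hπ) (T.b1 π hπ) (T.b2 π hπ)
      (fun σ hσ => hzL σ (hm π hπ σ hσ)) (hsr π hπ).1 (hsr π hπ).2
  have hs6 : ∀ π ∈ subs 3 U, s π * (s π - 1) = 6 * ((s π * (s π - 1)) / 6) := by
    intro π hπ
    have h1 := hs3 π hπ
    have h2 := hsr π hπ
    generalize s π = v at *
    obtain ⟨h2, h3⟩ := h2
    interval_cases v <;> simp_all
  obtain ⟨π, hπ, h0, h1⟩ := T.F4 (by omega) (by omega)
  obtain ⟨l, hl⟩ := exists_sub (A := π) (j := 2) (by rw [(mem_subs.mp hπ).2]; omega)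
  have hlU := subs_trans hl (mem_subs.mp hπ).1
  obtain ⟨c, hcc⟩ : ∃ c, ∀ σ ∈ cov π U, (z σ * (z σ - 1)) % 36 = c := by
    refine ⟨(6 * (∑ p ∈ pts l, t p * (t p - 1) - 5 * (5 - 1) * f l) - y * (y - 1)) % 36, ?_⟩
    intro σ hσ
    have hlσ : l ≤ σ := (mem_subs.mp hl).1.trans (mem_cov.mp hσ).1
    have e := T.F1b l hlU σ (hm π hπ σ hσ) hlσ
    rw [Finset.sum_congr rfl (fun π' hπ' => hs6 π' (subs_trans
      (mem_subs_of_cov hπ' (mem_subs.mp hl).2) (mem_cov.mp hσ).2.1)), ← Finset.mul_sum] at e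
    generalize z σ * (z σ - 1) = A at *
    generalize y * (y - 1) = B at *
    generalize ∑ p ∈ pts l, t p * (t p - 1) = D at *
    omega
  obtain ⟨hs, σ, hσ, hz⟩ := arith5b (cov π U) z (hcard π hπ) (T.b1 π hπ) (T.b2 π hπ)
      (fun σ hσ => hzL σ (hm π hπ σ hσ)) c hcc (hsr π hπ).1 (hsr π hπ).2 h0 h1
  have hy21 : y = 21 := by
    have := T.hs π hπ
    omega
  obtain ⟨l, hl, hl0⟩ := T.ex0plane hπ (by omega)
  have hlU := subs_trans hl (mem_subs.mp hπ).1
  have hlσ : l ≤ σ := (mem_subs.mp hl).1.trans (mem_cov.mp hσ).1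
  have e1 := T.F1a l hlU σ (hm π hπ σ hσ) hlσ
  rw [hl0, hz] at e1
  have hπc : π ∈ cov l σ := mem_cov.mpr ⟨(mem_subs.mp hl).1, (mem_cov.mp hσ).1, by
    rw [(mem_subs.mp hl).2, (mem_subs.mp hπ).2]⟩
  have hcl := T.cc2 hlσ (by rw [(mem_subs.mp hl).2, (mem_subs.mp (hm π hπ σ hσ)).2])
  have e2 : ∑ π' ∈ cov l σ, (1 - s π') ≥ 1 - s π := by
    apply Finset.single_le_sum (f := fun π' => 1 - s π') _ hπc
    intro π' hπ'
    have hπU : π' ∈ subs 3 U := subs_trans (mem_subs_of_cov hπ' (mem_subs.mp hl).2)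
      (mem_cov.mp hσ).2.1
    have := T.hs π' hπU
    omega
  rw [Finset.sum_sub_distrib, e1] at e2
  simp only [Finset.sum_const, nsmul_eq_mul, mul_one] at e2
  omega

end
end GC

namespace GC
section
variable {F V : Type*} [Field F] [Fintype F] [AddCommGroup V] [Module F V] [Finite V]
variable {U : Submodule F V} {y : ℤ} {t s z f : Submodule F V → ℤ}

def PatA (k : ℕ) (w : Submodule F V → ℝ) (U : Submodule F V) : Prop :=
  (∀ p ∈ pts U, w p = 0) ∨
  (∃ p0 ∈ pts U, ∀ p ∈ pts U, w p = if p = p0 then 1 else 0) ∨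
  (∃ H ≤ U, finrank F H + 1 = finrank F U ∧
    ∀ p ∈ pts U, (Fintype.card F : ℝ) ^ (k - 1) * w p = if p ≤ H then 0 else 1) ∨
  (∃ H ≤ U, finrank F H + 1 = finrank F U ∧ ∃ p0 ∈ pts U, ¬ p0 ≤ H ∧
    ∀ p ∈ pts U, (Fintype.card F : ℝ) ^ (k - 1) * w p =
      if p ≤ H then 0 else if p = p0 then 1 - (Fintype.card F : ℝ) ^ (k - 1) else 1)

def Pat (k : ℕ) (w : Submodule F V → ℝ) (U : Submodule F V) : Prop :=
  PatA k w U ∨ PatA k (comp k w) U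

theorem mem_line_left {p r : Submodule F V} (hp : p ∈ pts U) : p ∈ pts (p ⊔ r) :=
  mem_pts.mpr ⟨(mem_pts.mp hp).1, le_sup_left⟩

theorem mem_line_right {p r : Submodule F V} (hr : r ∈ pts U) : r ∈ pts (p ⊔ r) :=
  mem_pts.mpr ⟨(mem_pts.mp hr).1, le_sup_right⟩

theorem line_mem {p r : Submodule F V} (hp : p ∈ pts U) (hr : r ∈ pts U) (h : p ≠ r) :
    p ⊔ r ∈ subs 2 U := by
  rw [mem_pts] at hp hr
  exact mem_subs.mpr ⟨sup_le hp.2 hr.2, finrank_line hp.1 hr.1 h⟩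

theorem line_cov {p r : Submodule F V} (hp : p ∈ pts U) (hr : r ∈ pts U) (h : p ≠ r) :
    p ⊔ r ∈ cov p U := by
  rw [mem_pts] at hp hr
  exact mem_cov.mpr ⟨le_sup_left, sup_le hp.2 hr.2, by rw [finrank_line hp.1 hr.1 h, hp.1]⟩

theorem two_le_sum {ι : Type*} {C : Finset ι} {g : ι → ℤ} (h : ∀ i ∈ C, 0 ≤ g i) {a b : ι}
    (ha : a ∈ C) (hb : b ∈ C) (hab : a ≠ b) : g a + g b ≤ ∑ i ∈ C, g i := by
  rw [← Finset.sum_pair hab]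
  apply Finset.sum_le_sum_of_subset_of_nonneg
  · intro i hi; simp at hi; rcases hi with rfl | rfl <;> assumption
  · intro i hi _; exact h i hi

/-- sum equal to card with each term ≤ 1 -/
theorem all_one_of_sum {ι : Type*} {C : Finset ι} {g : ι → ℤ} (h : ∀ i ∈ C, g i ≤ 1)
    (hs : (C.card : ℤ) ≤ ∑ i ∈ C, g i) : ∀ i ∈ C, g i = 1 := by
  have h0 : ∑ i ∈ C, (1 - g i) = 0 := by
    apply le_antisymm
    · rw [Finset.sum_sub_distrib]; simp; exact hs
    · exact Finset.sum_nonneg (fun i hi => by linarith [h i hi])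
  have := (Finset.sum_eq_zero_iff_of_nonneg (fun i hi => by linarith [h i hi])).mp h0
  intro i hi
  linarith [this i hi]

theorem cpl' {q : ℤ} (hq : (Fintype.card F : ℤ) = q) {l : Submodule F V} (hl : finrank F l = 2) :
    ((pts l).card : ℤ) = q + 1 := by
  have := cp2 (q := (q : ℝ)) (by rw [← hq]; simp) hl
  exact_mod_cast this

theorem patA1 {q : ℤ} (hq : (Fintype.card F : ℤ) = q)
    (ht : ∀ p ∈ pts U, 0 ≤ t p ∧ t p ≤ 1)
    (hl : ∀ l ∈ subs 2 U, ∑ p ∈ pts l, t p = 1 ∨ ∑ p ∈ pts l, t p = q + 1)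
    {p0 : Submodule F V} (hp0 : p0 ∈ pts U) (h0 : t p0 = 0) :
    ∃ H ≤ U, finrank F H + 1 = finrank F U ∧ ∀ p ∈ pts U, t p = if p ≤ H then 1 else 0 := by
  have hsub : ∀ l ∈ subs 2 U, ∀ p ∈ pts l, p ∈ pts U := fun l hl p hp =>
    pts_mono (mem_subs.mp hl).1 hp
  obtain ⟨H, hH, hf, hh⟩ := hyper (U := U) (Z := fun p => t p = 1) (by
    intro p hp r hr hne h1 h2
    have hlm := line_mem hp hr hne
    have a := two_le_sum (fun i hi => (ht i (hsub _ hlm i hi)).1) (mem_line_left hp)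
      (mem_line_right hr) hne
    apply all_one_of_sum (fun i hi => (ht i (hsub _ hlm i hi)).2)
    rw [cpl' hq (mem_subs.mp hlm).2]
    rcases hl _ hlm with h | h
    · omega
    · rw [h]) (by
    intro p hp r hr hne
    have hlm := line_mem hp hr hne
    by_contra hc
    push Not at hc
    have : ∑ i ∈ pts (p ⊔ r), t i = 0 := Finset.sum_eq_zero (fun i hi => by
      have := ht i (hsub _ hlm i hi); have := hc i hi; omega)
    have hq0 : 0 < q := by rw [← hq]; exact_mod_cast Fintype.card_pos
    rcases hl _ hlm with h | h <;> omega) hp0 (by rw [h0]; norm_num)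
  refine ⟨H, hH, hf, fun p hp => ?_⟩
  by_cases h : p ≤ H
  · rw [if_pos h]; exact (hh p hp).mpr h
  · rw [if_neg h]
    have a : ¬ t p = 1 := fun h' => h ((hh p hp).mp h')
    have := ht p hp
    omega

theorem patA2 {q : ℤ} (hq : (Fintype.card F : ℤ) = q) {p0 : Submodule F V} (hp0 : p0 ∈ pts U)
    (ht : ∀ p ∈ pts U, p ≠ p0 → 0 ≤ t p ∧ t p ≤ 1) (h0 : t p0 = q)
    (hl : ∀ l ∈ subs 2 U, ∑ p ∈ pts l, t p = 1 ∨ ∑ p ∈ pts l, t p = q + 1) :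
    ∃ H ≤ U, finrank F H + 1 = finrank F U ∧ ¬ p0 ≤ H ∧
      ∀ p ∈ pts U, t p = if p ≤ H then 1 else if p = p0 then q else 0 := by
  have hsub : ∀ l ∈ subs 2 U, ∀ p ∈ pts l, p ∈ pts U := fun l hl p hp =>
    pts_mono (mem_subs.mp hl).1 hp
  have hq1 : 1 < q := by
    have := q_gt_one (F := F)
    rw [← hq]; exact_mod_cast this
  have hnn : ∀ p ∈ pts U, 0 ≤ t p := by
    intro p hp
    by_cases h : p = p0
    · rw [h, h0]; omega
    · exact (ht p hp h).1
  obtain ⟨H, hH, hf, hh⟩ := hyper (U := U) (Z := fun p => t p = 1) (by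
    intro p hp r hr hne h1 h2
    have hlm := line_mem hp hr hne
    have a := two_le_sum (fun i hi => hnn i (hsub _ hlm i hi)) (mem_line_left hp)
      (mem_line_right hr) hne
    have hs : ∑ i ∈ pts (p ⊔ r), t i = q + 1 := by
      rcases hl _ hlm with h | h
      · omega
      · exact h
    have hno : p0 ∉ pts (p ⊔ r) := by
      intro hc
      have e : ∑ i ∈ pts (p ⊔ r), t i = t p0 + ∑ i ∈ (pts (p ⊔ r)).erase p0, t i :=
        (Finset.add_sum_erase _ _ hc).symm
      have b := two_le_sum (C := (pts (p ⊔ r)).erase p0) (g := t)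
        (fun i hi => hnn i (hsub _ hlm i (Finset.mem_of_mem_erase hi)))
        (Finset.mem_erase.mpr ⟨fun h => by rw [h] at h1; omega, mem_line_left hp⟩)
        (Finset.mem_erase.mpr ⟨fun h => by rw [h] at h2; omega, mem_line_right hr⟩) hne
      omega
    apply all_one_of_sum (fun i hi => (ht i (hsub _ hlm i hi) (fun h => hno (h ▸ hi))).2)
    rw [cpl' hq (mem_subs.mp hlm).2, hs]) (by
    intro p hp r hr hne
    have hlm := line_mem hp hr hne
    by_contra hc
    push Not at hc
    have hz : ∀ i ∈ pts (p ⊔ r), i ≠ p0 → t i = 0 := fun i hi h => by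
      have := ht i (hsub _ hlm i hi) h; have := hc i hi; omega
    by_cases hin : p0 ∈ pts (p ⊔ r)
    · have e : ∑ i ∈ pts (p ⊔ r), t i = t p0 := Finset.sum_eq_single_of_mem p0 hin hz
      rcases hl _ hlm with h | h <;> omega
    · have : ∑ i ∈ pts (p ⊔ r), t i = 0 := Finset.sum_eq_zero (fun i hi =>
        hz i hi (fun h => hin (h ▸ hi)))
      rcases hl _ hlm with h | h <;> omega) hp0 (by rw [h0]; omega)
  refine ⟨H, hH, hf, fun hc => ?_, fun p hp => ?_⟩
  · have := (hh p0 hp0).mpr hc; omega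
  by_cases h : p ≤ H
  · rw [if_pos h]; exact (hh p hp).mpr h
  · rw [if_neg h]
    by_cases h' : p = p0
    · rw [if_pos h', h', h0]
    · rw [if_neg h']
      have a : ¬ t p = 1 := fun h' => h ((hh p hp).mp h')
      have := ht p hp h'
      omega

variable {q : ℤ}

/-- all lines through `p` are 0-lines if `t p = 0` -/
theorem T0.f0_of_t0 (T : T0 q U y t s z f) {p : Submodule F V} (hp : p ∈ pts U) (h : t p = 0)
    {l : Submodule F V} (hl : l ∈ cov p U) : f l = 0 := by
  have h1 := T.degU p hp
  rw [h, mul_zero] at h1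
  have hm : ∀ l ∈ cov p U, 0 ≤ f l := fun l hl => by
    rcases T.hf l (mem_subs_of_cov hl (mem_pts.mp hp).1) with h | h <;> omega
  exact (Finset.sum_eq_zero_iff_of_nonneg hm).mp h1 l hl

theorem T0.t0_of_f0 (T : T0 q U y t s z f) {p : Submodule F V} (hp : p ∈ pts U)
    (h : ∀ l ∈ cov p U, f l = 0) : t p = 0 := by
  have h1 := T.degU p hp
  rw [Finset.sum_eq_zero h] at h1
  have := T.q1
  have h2 : q ^ 2 + q + 1 ≠ 0 := by positivity
  rcases mul_eq_zero.mp h1.symm with h | h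
  · exact absurd h h2
  · exact h

theorem comp2 {w : Submodule F V → ℝ} (hq : (Fintype.card F : ℝ) = (q : ℝ)) (h1 : 1 < q) (p : Submodule F V) :
    comp 2 w p = 1 / ((q : ℝ) + 1) - w p := by
  have : (1:ℝ) < q := by exact_mod_cast h1
  have h2 : (q:ℝ) - 1 ≠ 0 := by linarith
  have h4 : (q:ℝ) + 1 ≠ 0 := by linarith
  rw [comp, hq]
  have h3 : (q:ℝ) ^ 2 - 1 = (q - 1) * (q + 1) := by ring
  rw [h3]
  field_simp

theorem T0.endcase (T : T0 q U y t s z f) {w : Submodule F V → ℝ} {κ : ℝ}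
    (hκ : (y : ℝ) = (q + 1) * κ) (hw : ∀ p ∈ pts U, (t p : ℝ) = κ + q * w p)
    (hy : y ≤ 1 ∨ q ^ 2 - 1 ≤ y) : Pat 2 w U := by
  have hq1 := T.q1
  have hq1' : (1:ℝ) < q := by exact_mod_cast hq1
  have hqR := T.hqR
  have hnn : ∀ l ∈ subs 2 U, ∀ p ∈ pts l, 0 ≤ t p ∧ t p ≤ q := fun l hl p hp =>
    T.ht p (pts_mono (mem_subs.mp hl).1 hp)
  have hsub : ∀ l ∈ subs 2 U, ∀ p ∈ pts l, p ∈ pts U := fun l hl p hp =>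
    pts_mono (mem_subs.mp hl).1 hp
  have hcv : ∀ l ∈ subs 2 U, ∀ p ∈ pts l, l ∈ cov p U := fun l hl p hp =>
    mem_cov.mpr ⟨(mem_pts.mp hp).2, (mem_subs.mp hl).1, by
      rw [(mem_subs.mp hl).2, (mem_pts.mp hp).1]⟩
  have hq0 : (q : ℝ) + 1 ≠ 0 := by linarith
  have hqn : (q : ℝ) ≠ 0 := by linarith
  have hy0 := T.hy
  have hcases : y = 0 ∨ y = 1 ∨ y = q ^ 2 ∨ y = q ^ 2 - 1 := by omega
  rcases hcases with hy | hy | hy | hy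
  · left; left
    have k0 : κ = 0 := by
      rw [hy] at hκ; push_cast at hκ
      exact (mul_eq_zero.mp hκ.symm).resolve_left hq0
    obtain ⟨l, hl, hl0⟩ := T.ex0
    have e := T.line l hl
    rw [hl0, hy] at e
    obtain ⟨p, hp⟩ := exists_pt (A := l) (by rw [(mem_subs.mp hl).2]; omega)
    have hp0 : t p = 0 := (Finset.sum_eq_zero_iff_of_nonneg (fun p hp => (hnn l hl p hp).1)).mp
      (by rw [e]; ring) p hp
    have hpU := hsub l hl p hp
    intro r hr
    have tr : t r = 0 := by
      by_cases h : p = r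
      · rw [← h, hp0]
      have hlm := line_mem hpU hr h
      have h2 := T.line _ hlm
      rw [T.f0_of_t0 hpU hp0 (line_cov hpU hr h), hy] at h2
      exact (Finset.sum_eq_zero_iff_of_nonneg (fun p hp => (hnn _ hlm p hp).1)).mp
        (by rw [h2]; ring) r (mem_line_right hr)
    have := hw r hr
    rw [tr, k0] at this
    push_cast at this
    have h3 : (q:ℝ) * w r = 0 := by linarith
    exact (mul_eq_zero.mp h3).resolve_left hqn
  · right; right; right; left
    obtain ⟨l, hl, hl0⟩ := T.ex0
    have e := T.line l hl
    rw [hl0, hy] at e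
    obtain ⟨p, hp, hp0⟩ : ∃ p ∈ pts l, t p = 0 := by
      by_contra hc
      push Not at hc
      have : ∑ p ∈ pts l, (1:ℤ) ≤ ∑ p ∈ pts l, t p := Finset.sum_le_sum (fun p hp => by
        have := hnn l hl p hp; have := hc p hp; omega)
      rw [e] at this
      simp at this
      have := T.cpl (mem_subs.mp hl).2
      omega
    have hpU := hsub l hl p hp
    obtain ⟨H, hH, hf, h⟩ := patA1 (t := t) T.hq (U := U) (by
      intro r hr
      refine ⟨(T.ht r hr).1, ?_⟩
      by_cases h : p = r
      · rw [← h, hp0]; norm_num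
      have hlm := line_mem hpU hr h
      have h2 := T.line _ hlm
      rw [T.f0_of_t0 hpU hp0 (line_cov hpU hr h), hy] at h2
      have := Finset.single_le_sum (fun p hp => (hnn _ hlm p hp).1) (mem_line_right (p := p) hr)
      omega) (by
      intro l hl
      rw [T.line l hl, hy]
      rcases T.hf l hl with h | h <;> rw [h]
      · left; ring
      · right; ring) hpU hp0
    refine ⟨H, hH, hf, fun p hp => ?_⟩
    rw [hqR, comp2 hqR hq1]
    have h3 := hw p hp
    rw [h p hp] at h3
    have k1 : κ = 1 / ((q:ℝ) + 1) := by
      rw [hy] at hκ; push_cast at hκ; field_simp; linarith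
    have : (q:ℝ) ^ (2 - 1) * (1 / ((q:ℝ) + 1) - w p) = 1 - (κ + q * w p) := by
      rw [k1]; norm_num; field_simp; ring
    rw [this, ← h3]
    split_ifs <;> norm_num
  · right; right; left
    have k1 : κ = (q:ℝ) ^ 2 / ((q:ℝ) + 1) := by
      rw [hy] at hκ; push_cast at hκ; field_simp; linarith
    have key : ∀ p ∈ pts U, t p = q ∨ t p = 0 := by
      intro p hp
      by_contra hc
      push Not at hc
      apply hc.2
      apply T.t0_of_f0 hp
      intro l hl
      have hlm := mem_subs_of_cov hl (mem_pts.mp hp).1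
      rcases T.hf l hlm with h | h
      · exact h
      exfalso
      have e := T.line l hlm
      rw [h, hy] at e
      have e2 : ∑ r ∈ pts l, (q - t r) = 0 := by
        rw [Finset.sum_sub_distrib, e, Finset.sum_const, nsmul_eq_mul, T.cpl (mem_subs.mp hlm).2]
        ring
      have := (Finset.sum_eq_zero_iff_of_nonneg (fun r hr => by
        linarith [(hnn l hlm r hr).2])).mp e2 p (mem_pts.mpr ⟨(mem_pts.mp hp).1, (mem_cov.mp hl).1⟩)
      omega
    obtain ⟨l, hl, hl0⟩ := T.ex0
    have e := T.line l hl
    rw [hl0, hy] at e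
    obtain ⟨p0, hp0l, hp0⟩ : ∃ p ∈ pts l, t p = 0 := by
      by_contra hc
      push Not at hc
      have : ∑ p ∈ pts l, t p = ∑ p ∈ pts l, q := Finset.sum_congr rfl (fun p hp =>
        (key p (hsub l hl p hp)).resolve_right (hc p hp))
      rw [this, Finset.sum_const, nsmul_eq_mul, T.cpl (mem_subs.mp hl).2] at e
      nlinarith
    have hpU := hsub l hl p0 hp0l
    refine ⟨p0, hpU, fun r hr => ?_⟩
    rw [comp2 hqR hq1]
    have h3 := hw r hr
    rw [k1] at h3
    have h4 : (q:ℝ) * (1 / ((q:ℝ) + 1) - w r) = q - t r := by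
      rw [h3]; field_simp; ring
    by_cases h : r = p0
    · rw [if_pos h]
      rw [h, hp0, ← h] at h4
      push_cast at h4
      apply mul_left_cancel₀ hqn
      linarith
    · rw [if_neg h]
      have h' : p0 ≠ r := fun e => h e.symm
      have hlm := line_mem hpU hr h'
      have h2 := T.line _ hlm
      rw [T.f0_of_t0 hpU hp0 (line_cov hpU hr h'), hy] at h2
      have e2 : ∑ r ∈ pts (p0 ⊔ r), (q - t r) = q := by
        rw [Finset.sum_sub_distrib, h2, Finset.sum_const, nsmul_eq_mul, T.cpl (mem_subs.mp hlm).2]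
        ring
      have e3 := two_le_sum (g := fun r => q - t r) (fun i hi => by linarith [(hnn _ hlm i hi).2])
        (mem_line_left (r := r) hpU) (mem_line_right (p := p0) hr) h'
      have e4 : t r = q := by
        have := (T.ht r hr).2
        omega
      rw [e4] at h4
      apply mul_left_cancel₀ hqn
      linarith
  · left; right; right; right
    have k1 : κ = (q:ℝ) - 1 := by
      rw [hy] at hκ; push_cast at hκ
      apply mul_left_cancel₀ hq0; linarith
    have lsum : ∀ l ∈ subs 2 U, ∑ p ∈ pts l, (q - t p) = q + 1 - q * f l := by
      intro l hl
      rw [Finset.sum_sub_distrib, T.line l hl, Finset.sum_const, nsmul_eq_mul,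
        T.cpl (mem_subs.mp hl).2, hy]
      ring
    have key : ∀ p ∈ pts U, 2 ≤ q - t p → t p = 0 := by
      intro p hp h2
      apply T.t0_of_f0 hp
      intro l hl
      have hlm := mem_subs_of_cov hl (mem_pts.mp hp).1
      rcases T.hf l hlm with h | h
      · exact h
      exfalso
      have e := lsum l hlm
      rw [h] at e
      have := Finset.single_le_sum (f := fun r => q - t r) (fun r hr => by
        linarith [(hnn l hlm r hr).2]) (mem_pts.mpr ⟨(mem_pts.mp hp).1, (mem_cov.mp hl).1⟩)
      linarith
    obtain ⟨p0, hpU, hp0⟩ : ∃ p ∈ pts U, t p = 0 := by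
      by_contra hc
      push Not at hc
      have hle : ∀ p ∈ pts U, q - t p ≤ 1 := by
        intro p hp
        by_contra h
        exact hc p hp (key p hp (by omega))
      obtain ⟨l, hl, hl1⟩ := T.ex1 (by nlinarith)
      obtain ⟨r, hrl, hr⟩ : ∃ r ∈ pts l, t r = q := by
        by_contra hc
        push Not at hc
        have : ∑ p ∈ pts l, (1:ℤ) ≤ ∑ p ∈ pts l, (q - t p) := Finset.sum_le_sum (fun p hp => by
          have := hnn l hl p hp; have := hc p hp; omega)
        rw [lsum l hl, hl1] at this
        simp at this
        have := T.cpl (mem_subs.mp hl).2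
        omega
      have hrU := hsub l hl r hrl
      have hd := T.degU r hrU
      obtain ⟨m, hm, hm0⟩ : ∃ m ∈ cov r U, f m = 0 := by
        by_contra hc
        push Not at hc
        rw [sum_all_one (fun m hm => (T.hf m (mem_subs_of_cov hm (mem_pts.mp hrU).1)).resolve_left
          (hc m hm)), T.cc4 (mem_pts.mp hrU).2 (by rw [(mem_pts.mp hrU).1, T.hU]), hr] at hd
        nlinarith
      have hm2 := mem_subs_of_cov hm (mem_pts.mp hrU).1
      have e := lsum m hm2
      rw [hm0] at e
      have := all_one_of_sum (g := fun p => q - t p) (fun i hi => hle i (hsub m hm2 i hi)) (by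
        rw [e, T.cpl (mem_subs.mp hm2).2]; linarith) r
        (mem_pts.mpr ⟨(mem_pts.mp hrU).1, (mem_cov.mp hm).1⟩)
      omega
    obtain ⟨H, hH, hf, hnot, h⟩ := patA2 (t := fun p => q - t p) T.hq hpU (by
      intro r hr hne
      refine ⟨by linarith [(T.ht r hr).2], ?_⟩
      have h' : p0 ≠ r := fun e => hne e.symm
      have hlm := line_mem hpU hr h'
      have h2 := lsum _ hlm
      rw [T.f0_of_t0 hpU hp0 (line_cov hpU hr h')] at h2
      have e3 := two_le_sum (g := fun r => q - t r) (fun i hi => by linarith [(hnn _ hlm i hi).2])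
        (mem_line_left (r := r) hpU) (mem_line_right (p := p0) hr) h'
      omega) (by omega) (by
      intro l hl
      rw [lsum l hl]
      rcases T.hf l hl with h | h <;> rw [h]
      · right; ring
      · left; ring)
    refine ⟨H, hH, hf, p0, hpU, hnot, fun p hp => ?_⟩
    rw [hqR]
    have h3 := hw p hp
    have h4 := h p hp
    have h5 : (t p : ℝ) = q - (if p ≤ H then 1 else if p = p0 then q else 0 : ℤ) := by
      rw [← h4]; push_cast; ring
    have : (q:ℝ) ^ (2 - 1) * w p = t p - κ := by
      rw [h3]; norm_num
    rw [this, h5, k1]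
    split_ifs <;> push_cast <;> ring

end
end GC

namespace GC
section
variable {F V : Type*} [Field F] [Fintype F] [AddCommGroup V] [Module F V] [Finite V]
variable {U : Submodule F V}

theorem mod7 {Y Z I : ℤ} (h : 45 * I + 15 * (Z - Y - 2) - 100 = 9 * Y ^ 2 + 3 * Y + 9 * Z ^ 2
    - 3 * Z - 4) : Z % 5 = 3 ∨ Z % 5 = 4 := by
  obtain ⟨a, r, h1, h2, h3⟩ : ∃ a r, Z = 5 * a + r ∧ 0 ≤ r ∧ r < 5 :=
    ⟨Z / 5, Z % 5, by omega, by omega, by omega⟩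
  obtain ⟨b, r', h1', h2', h3'⟩ : ∃ a r, Y = 5 * a + r ∧ 0 ≤ r ∧ r < 5 :=
    ⟨Y / 5, Y % 5, by omega, by omega, by omega⟩
  subst h1 h1'
  interval_cases r <;> interval_cases r' <;> ring_nf at h <;> omega

theorem type7 {w : Submodule F V → ℝ} (hL : LB 2 w) (hq : (Fintype.card F : ℤ) = 4)
    (hU : finrank F U = 5) {l0 : Submodule F V} (hl0 : l0 ∈ subs 2 U) (hz0 : wt w l0 = 0)
    (hd : ∀ p ∈ pts U, ∃ m : ℤ, (7 : ℝ) + 21 * m = wt w U + 84 * w p) : False := by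
  have hqR : (Fintype.card F : ℝ) = 4 := by exact_mod_cast hq
  obtain ⟨κ, hκ⟩ : ∃ κ : ℝ, wt w U = ((4:ℝ) ^ 2 + 4 + 1) * κ := ⟨wt w U / 21, by ring⟩
  have hm : ∀ p ∈ pts U, ∃ m : ℤ, κ + 4 * w p = m + 1 / 3 := by
    intro p hp
    obtain ⟨m, h⟩ := hd p hp
    exact ⟨m, by rw [hκ] at h; linarith⟩
  choose! m hm using hm
  have hsubp : ∀ {j : ℕ} {A : Submodule F V}, A ∈ subs j U → ∀ p ∈ pts A, p ∈ pts U :=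
    fun hA p hp => pts_mono (mem_subs.mp hA).1 hp
  have hf : ∀ l ∈ subs 2 U, ∃ f : ℤ, wt w l = f := by
    intro l hl
    rcases hL l (mem_subs.mp hl).2 with h | h
    · exact ⟨0, by rw [h]; simp⟩
    · exact ⟨1, by rw [h]; simp⟩
  choose! f hf using hf
  have tl : ∀ l ∈ subs 2 U, (∑ p ∈ pts l, m p : ℝ) = 5 * κ + 4 * f l - 5 / 3 := by
    intro l hl
    have h := tau1 w hqR κ (mem_subs.mp hl).2
    rw [Finset.sum_congr rfl (fun p hp => hm p (hsubp hl p hp)), Finset.sum_add_distrib,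
      Finset.sum_const, nsmul_eq_mul, cp2 hqR (mem_subs.mp hl).2, hf l hl] at h
    linarith
  obtain ⟨Y, hY⟩ : ∃ Y : ℤ, 5 * κ = Y + 2 / 3 := by
    refine ⟨∑ p ∈ pts l0, m p + 1, ?_⟩
    have := tl l0 hl0
    rw [← hf l0 hl0, hz0] at this
    push_cast
    linarith
  have hS : ∀ π ∈ subs 3 U, ∃ S : ℤ, wt w π - κ = S + 2 / 3 := by
    intro π hπ
    obtain ⟨p, hp⟩ := exists_pt (A := π) (by rw [(mem_subs.mp hπ).2]; omega)
    obtain ⟨d, hd, -⟩ := deg_int hL hp (r := 5) (by rw [hqR, (mem_subs.mp hπ).2]; norm_num)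
    refine ⟨d - m p - 1, ?_⟩
    have := hm p (hsubp hπ p hp)
    push_cast
    linarith
  choose! S hS using hS
  have hπm : ∀ l ∈ subs 2 U, ∀ B ≤ U, ∀ π ∈ cov l B, π ∈ subs 3 U := fun l hl B hB π hπ =>
    subs_trans (mem_subs_of_cov hπ (mem_subs.mp hl).2) hB
  have hSs : ∀ l ∈ subs 2 U, ∀ σ ∈ subs 4 U, l ≤ σ →
      (∑ π ∈ cov l σ, S π : ℝ) = wt w σ - 5 * κ + 4 * f l - 10 / 3 := by
    intro l hl σ hσ h
    have e := F1a w hqR κ (mem_subs.mp hl).2 (mem_subs.mp hσ).2 h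
    rw [Finset.sum_congr rfl (fun π hπ => hS π (hπm l hl σ (mem_subs.mp hσ).1 π hπ)),
      Finset.sum_add_distrib,
      Finset.sum_const, nsmul_eq_mul, cc2 hqR h (by rw [(mem_subs.mp hl).2, (mem_subs.mp hσ).2]),
      hf l hl] at e
    linarith
  have hZ : ∀ σ ∈ subs 4 U, ∃ Z : ℤ, wt w σ - 5 * κ = Z + 1 / 3 := by
    intro σ hσ
    obtain ⟨l, hl⟩ := exists_sub (A := σ) (j := 2) (by rw [(mem_subs.mp hσ).2]; omega)
    have e := hSs l (subs_trans hl (mem_subs.mp hσ).1) σ hσ (mem_subs.mp hl).1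
    refine ⟨∑ π ∈ cov l σ, S π - 4 * f l + 3, ?_⟩
    push_cast
    linarith
  choose! Z hZ using hZ
  have hZ5 : ∀ σ ∈ subs 4 U, Z σ % 5 = 3 ∨ Z σ % 5 = 4 := by
    intro σ hσ
    obtain ⟨l, hl⟩ := exists_sub (A := σ) (j := 2) (by rw [(mem_subs.mp hσ).2]; omega)
    have hlU := subs_trans hl (mem_subs.mp hσ).1
    have hlσ := (mem_subs.mp hl).1
    have e1 := hSs l hlU σ hσ hlσ
    have e2 := tl l hlU
    have e3 := F1b hL hqR κ (mem_subs.mp hl).2 (mem_subs.mp hσ).2 hlσ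
    have e4 : ∑ π ∈ cov l σ, (wt w π - κ) * (wt w π - κ - 1) =
        ∑ π ∈ cov l σ, (S π : ℝ) ^ 2 + 1 / 3 * ∑ π ∈ cov l σ, (S π : ℝ) - 10 / 9 := by
      rw [Finset.sum_congr rfl (g := fun π => (S π : ℝ) ^ 2 + 1 / 3 * S π + (- 2 / 9)) (fun π hπ => by
          rw [hS π (hπm l hlU σ (mem_subs.mp hσ).1 π hπ)]; ring),
        Finset.sum_add_distrib, Finset.sum_add_distrib, ← Finset.mul_sum, Finset.sum_const,
        nsmul_eq_mul, cc2 hqR hlσ (by rw [(mem_subs.mp hl).2, (mem_subs.mp hσ).2])]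
      ring
    have e5 : ∑ p ∈ pts l, (κ + 4 * w p) * (κ + 4 * w p - 1) =
        ∑ p ∈ pts l, (m p : ℝ) ^ 2 - 1 / 3 * ∑ p ∈ pts l, (m p : ℝ) - 10 / 9 := by
      rw [Finset.sum_congr rfl (g := fun p => (m p : ℝ) ^ 2 + (- 1 / 3) * m p + (- 2 / 9))
        (fun p hp => by rw [hm p (hsubp hlU p hp)]; ring),
        Finset.sum_add_distrib, Finset.sum_add_distrib, ← Finset.mul_sum, Finset.sum_const,
        nsmul_eq_mul, cp2 hqR (mem_subs.mp hl).2]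
      ring
    have e6 : wt w σ - (4 + 1) * κ = Z σ + 1 / 3 := by rw [← hZ σ hσ]; ring
    have e7 : (4 + 1) * κ = Y + 2 / 3 := by rw [← hY]; ring
    rw [hf l hlU, e4, e5, e1, e2, e6, e7, hZ σ hσ, hY] at e3
    apply mod7 (Y := Y) (I := ∑ π ∈ cov l σ, (S π) ^ 2 + ∑ p ∈ pts l, (m p) ^ 2 - 12 * f l)
    have : (((45 * (∑ π ∈ cov l σ, (S π) ^ 2 + ∑ p ∈ pts l, (m p) ^ 2 - 12 * f l)
      + 15 * (Z σ - Y - 2) - 100 : ℤ)) : ℝ) = ((9 * Y ^ 2 + 3 * Y + 9 * Z σ ^ 2 - 3 * Z σ - 4 : ℤ) : ℝ) := by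
      push_cast
      linear_combination 9 * e3
    exact_mod_cast this
  have hS4 : ∀ π ∈ subs 3 U, 4 ≤ (S π) ^ 2 := by
    intro π hπ
    have hπ' := mem_subs.mp hπ
    have hm : ∀ σ ∈ cov π U, σ ∈ subs 4 U := fun σ h => mem_subs_of_cov h hπ'.2
    have hc := cc2 hqR hπ'.1 (by rw [hπ'.2, hU])
    have e1 := b1 w hqR κ hπ'.2 hU hπ'.1 hκ
    have e2 := b2 hL hqR κ hπ'.2 hU hπ'.1 hκ
    have e6 : ∀ σ ∈ cov π U, wt w σ - (4 + 1) * κ = Z σ + 1 / 3 := fun σ h => by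
      rw [← hZ σ (hm σ h)]; ring
    rw [Finset.sum_congr rfl e6, Finset.sum_add_distrib, Finset.sum_const, nsmul_eq_mul, hc,
      hS π hπ] at e1
    rw [Finset.sum_congr rfl (g := fun σ => (Z σ : ℝ) ^ 2 + (- 1 / 3) * Z σ + (- 2 / 9)) (fun σ h => by
      rw [e6 σ h]; ring), Finset.sum_add_distrib, Finset.sum_add_distrib, ← Finset.mul_sum,
      Finset.sum_const, nsmul_eq_mul, hc, hS π hπ] at e2
    have f1 : ∑ σ ∈ cov π U, Z σ = 4 * S π + 1 := by
      have : ((∑ σ ∈ cov π U, Z σ : ℤ) : ℝ) = ((4 * S π + 1 : ℤ) : ℝ) := by push_cast; linarith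
      exact_mod_cast this
    have f2 : ∑ σ ∈ cov π U, (Z σ + 1) * (Z σ - 3) = 20 * S π ^ 2 - 20 := by
      have : ((∑ σ ∈ cov π U, (Z σ + 1) * (Z σ - 3) : ℤ) : ℝ) = ((20 * S π ^ 2 - 20 : ℤ) : ℝ) := by
        push_cast
        rw [Finset.sum_congr rfl (g := fun σ => (Z σ : ℝ) ^ 2 + (- 2) * Z σ + (- 3))
          (fun σ _ => by ring), Finset.sum_add_distrib, Finset.sum_add_distrib, ← Finset.mul_sum,
          Finset.sum_const, nsmul_eq_mul, hc]
        linear_combination e2 - 5 / 3 * e1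
      exact_mod_cast this
    have nn : ∀ σ ∈ cov π U, 0 ≤ (Z σ + 1) * (Z σ - 3) := by
      intro σ h
      have := hZ5 σ (hm σ h)
      rcases le_or_gt (Z σ) (-1) with h | h
      · nlinarith
      · have : 3 ≤ Z σ := by omega
        nlinarith
    have f3 := Finset.sum_nonneg nn
    rw [f2] at f3
    by_contra hlt
    have hS1 : S π ≤ 1 := by nlinarith
    have hS1' : -1 ≤ S π := by nlinarith
    have hS0 : S π ≠ 0 := by intro h; rw [h] at f3; norm_num at f3
    have hsq : S π ^ 2 = 1 := by
      have : S π = 1 ∨ S π = -1 := by omega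
      rcases this with h | h <;> rw [h] <;> norm_num
    rw [hsq] at f2
    have f4 := (Finset.sum_eq_zero_iff_of_nonneg nn).mp (by rw [f2]; norm_num)
    have f5 : ∀ σ ∈ cov π U, Z σ = 4 * ((Z σ + 1) / 4) + (-1) := by
      intro σ h
      rcases mul_eq_zero.mp (f4 σ h) with h | h <;> omega
    rw [Finset.sum_congr rfl f5, Finset.sum_add_distrib, ← Finset.mul_sum, Finset.sum_const,
      nsmul_eq_mul] at f1
    have hc' : ((cov π U).card : ℤ) = 5 := by
      have : ((cov π U).card : ℝ) = (5:ℤ) := by rw [hc]; norm_num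
      exact_mod_cast this
    rw [hc'] at f1
    omega
  have hl' := mem_subs.mp hl0
  have hc := cc3 hqR hl'.1 (by rw [hl'.2, hU])
  have e1 := F3 w hqR κ hl'.2 hU hl'.1 hκ
  have e2 := L0 hL hqR κ hl'.2 hU hl'.1 hκ
  have hSm := fun π hπ => hS π (hπm l0 hl0 U le_rfl π hπ)
  rw [Finset.sum_congr rfl hSm, Finset.sum_add_distrib, Finset.sum_const, nsmul_eq_mul, hc,
    hz0] at e1
  rw [Finset.sum_congr rfl (g := fun σ => (S σ : ℝ) ^ 2 + (4 / 3) * S σ + (4 / 9)) (fun σ h => by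
      rw [hSm σ h]; ring), Finset.sum_add_distrib, Finset.sum_add_distrib, ← Finset.mul_sum,
      Finset.sum_const, nsmul_eq_mul, hc, hz0] at e2
  have e3 : ∑ π ∈ cov l0 U, (4:ℝ) ≤ ∑ π ∈ cov l0 U, (S π : ℝ) ^ 2 :=
    Finset.sum_le_sum (fun π hπ => by exact_mod_cast hS4 π (hπm l0 hl0 U le_rfl π hπ))
  rw [Finset.sum_const, nsmul_eq_mul, hc] at e3
  have e4 := sq_sum_le_card_mul_sum_sq (s := pts l0) (f := fun p => κ + 4 * w p)
  have e5 : ∑ p ∈ pts l0, (κ + 4 * w p) * (κ + 4 * w p - 1) =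
      ∑ p ∈ pts l0, (κ + 4 * w p) ^ 2 - ∑ p ∈ pts l0, (κ + 4 * w p) := by
    rw [← Finset.sum_sub_distrib]
    exact Finset.sum_congr rfl (fun p _ => by ring)
  rw [cp2 hqR hl'.2, tau1 w hqR κ hl'.2, hz0] at e4
  rw [e5, tau1 w hqR κ hl'.2, hz0] at e2
  have e6 := (wt_range hL U (r := 85) (t := 341) (by rw [hU, hqR]; norm_num)
    (by rw [hU, hqR]; norm_num)).2
  rw [hκ] at e6
  nlinarith

theorem Pat_comp {k : ℕ} {w : Submodule F V → ℝ} (h : Pat k (comp k w) U) : Pat k w U := by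
  rcases h with h | h
  · exact Or.inr h
  · rw [comp_comp] at h; exact Or.inl h

theorem type0 {w : Submodule F V → ℝ} (hL : LB 2 w) {q : ℤ}
    (hq : (Fintype.card F : ℤ) = q) (hq' : q = 2 ∨ q = 3 ∨ q = 4 ∨ q = 5)
    (hU : finrank F U = 5) (hd : ∀ p ∈ pts U, ∃ m : ℤ,
      ((q:ℝ) ^ 2 + q + 1) * m = wt w U + (q ^ 3 + q ^ 2 + q) * w p) : Pat 2 w U := by
  have h0 : (q:ℝ) ^ 2 + q + 1 ≠ 0 := by
    rcases hq' with rfl | rfl | rfl | rfl <;> norm_num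
  obtain ⟨y, t, s, z, f, T, h1, h2, -⟩ := exists_T0 hL hq hU
    (κ := wt w U / ((q:ℝ) ^ 2 + q + 1)) (mul_div_cancel₀ _ h0).symm (by
    intro p hp
    obtain ⟨m, hm⟩ := hd p hp
    refine mem_ZR.mpr ⟨m, ?_⟩
    apply mul_left_cancel₀ h0
    rw [hm, mul_add, mul_div_cancel₀ _ h0]
    ring)
  apply T.endcase h1 h2
  rcases hq' with rfl | rfl | rfl | rfl
  · have := T.mid2; omega
  · have := T.mid3; omega
  · have := T.mid4; omega
  · have := T.mid5; omega

theorem wt_comp5 {w : Submodule F V → ℝ} {q : ℤ}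
    (hq : (Fintype.card F : ℤ) = q) (hU : finrank F U = 5) (p : Submodule F V) :
    wt (comp 2 w) U + ((q:ℝ) ^ 3 + q ^ 2 + q) * comp 2 w p =
      q ^ 3 + q ^ 2 + q + 1 - (wt w U + ((q:ℝ) ^ 3 + q ^ 2 + q) * w p) := by
  have hqR : (Fintype.card F : ℝ) = (q : ℝ) := by rw [← hq]; simp
  have h1 : (1:ℝ) < q := by rw [← hqR]; exact q_gt_one
  have h1' : 1 < q := by exact_mod_cast h1
  have hc : ((pts U).card : ℝ) = (q:ℝ) ^ 4 + q ^ 3 + q ^ 2 + q + 1 :=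
    card_pts_eq hqR (by rw [hU]; ring)
  have : wt (comp 2 w) U = ((q:ℝ) ^ 4 + q ^ 3 + q ^ 2 + q + 1) / (q + 1) - wt w U := by
    simp only [wt]
    rw [Finset.sum_congr rfl (fun p _ => comp2 hqR h1' p), Finset.sum_sub_distrib,
      Finset.sum_const, nsmul_eq_mul, hc]
    ring
  rw [this, comp2 hqR h1']
  have : (q:ℝ) + 1 ≠ 0 := by linarith
  field_simp
  ring

theorem no0 {k : ℕ} (hk : 1 ≤ k) (hU : k < finrank F U) {w : Submodule F V → ℝ} (hL : LB k w)
    (h : ∀ l ∈ subs k U, wt w l ≠ 0) : Pat k w U := by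
  right; left
  apply uniq hk hU
  intro S hS hk'
  rw [wt_comp (by omega) w hk', (hL S hk').resolve_left (h S (mem_subs.mpr ⟨hS, hk'⟩))]
  norm_num

theorem main5 {w : Submodule F V → ℝ} (hL : LB 2 w) {q : ℤ}
    (hq : (Fintype.card F : ℤ) = q) (hq' : q = 2 ∨ q = 3 ∨ q = 4 ∨ q = 5)
    (hU : finrank F U = 5) : Pat 2 w U := by
  by_cases h0 : ∃ l ∈ subs 2 U, wt w l = 0
  swap
  · push Not at h0
    exact no0 (by norm_num) (by omega) hL h0
  by_cases h1 : ∃ l ∈ subs 2 U, wt (comp 2 w) l = 0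
  swap
  · push Not at h1
    exact Pat_comp (no0 (by norm_num) (by omega) (LB_comp (by norm_num) hL) h1)
  obtain ⟨l, hl, hl0⟩ := h0
  obtain ⟨l', hl', hl0'⟩ := h1
  obtain ⟨d0, hdv, hd⟩ := type_dvd hL hq hU hl hl0
  have c0 : (∃ a, d0 = (q ^ 2 + q + 1) * a) → Pat 2 w U := by
    rintro ⟨a, ha⟩
    apply type0 hL hq hq' hU
    intro p hp
    obtain ⟨m, hm⟩ := hd p hp
    refine ⟨a + m, ?_⟩
    rw [← hm, ha]; push_cast; ring
  have c1 : (∃ a, d0 = (q ^ 2 + q + 1) * a + 1) → Pat 2 w U := by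
    rintro ⟨a, ha⟩
    apply Pat_comp
    apply type0 (LB_comp (by norm_num) hL) hq hq' hU
    intro p hp
    obtain ⟨m, hm⟩ := hd p hp
    refine ⟨q - a - m, ?_⟩
    rw [wt_comp5 hq hU, ← hm, ha]; push_cast; ring
  have pr : ∀ P : ℕ, P.Prime → (q ^ 2 + q + 1 = P) → Pat 2 w U := by
    intro P hP e
    rw [e] at hdv
    rcases (Nat.prime_iff_prime_int.mp hP).dvd_or_dvd hdv with ⟨a, h⟩ | ⟨a, h⟩
    · exact c0 ⟨a, by rw [e, h]⟩
    · exact c1 ⟨a, by rw [e, ← h]; ring⟩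
  rcases hq' with rfl | rfl | rfl | rfl
  · exact pr 7 (by norm_num) (by norm_num)
  · exact pr 13 (by norm_num) (by norm_num)
  · have : d0 % 21 = 0 ∨ d0 % 21 = 1 ∨ d0 % 21 = 7 ∨ d0 % 21 = 15 := by
      obtain ⟨c, hc⟩ := hdv
      obtain ⟨a, r, h1, h2, h3⟩ : ∃ a r, d0 = 21 * a + r ∧ 0 ≤ r ∧ r < 21 :=
        ⟨d0 / 21, d0 % 21, by omega, by omega, by omega⟩
      subst h1
      interval_cases r <;> ring_nf at hc <;> omega
    rcases this with h | h | h | h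
    · exact c0 ⟨d0 / 21, by omega⟩
    · exact c1 ⟨d0 / 21, by omega⟩
    · exfalso
      apply type7 hL hq hU hl hl0
      intro p hp
      obtain ⟨m, hm⟩ := hd p hp
      have : (d0 : ℝ) = 21 * (d0 / 21 : ℤ) + 7 := by
        have : d0 = 21 * (d0 / 21) + 7 := by omega
        exact_mod_cast this
      refine ⟨m + d0 / 21, ?_⟩
      rw [this] at hm
      push_cast at hm ⊢
      linarith
    · exfalso
      apply type7 (LB_comp (by norm_num) hL) hq hU hl' hl0'
      intro p hp
      obtain ⟨m, hm⟩ := hd p hp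
      have : (d0 : ℝ) = 21 * (d0 / 21 : ℤ) + 15 := by
        have : d0 = 21 * (d0 / 21) + 15 := by omega
        exact_mod_cast this
      have e := wt_comp5 (w := w) hq hU p
      refine ⟨3 - m - d0 / 21, ?_⟩
      rw [← hm, this] at e
      push_cast at e ⊢
      linarith
  · exact pr 31 (by norm_num) (by norm_num)

end
end GC

namespace GC
section
variable {F V : Type*} [Field F] [Fintype F] [AddCommGroup V] [Module F V] [Finite V]
variable {U : Submodule F V}

theorem core4 {w : Submodule F V → ℝ} (hL : LB 2 w) (hq : (Fintype.card F : ℤ) = 2)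
    {y z : ℤ} {t f : Submodule F V → ℤ}
    (hyz : (y = 0 ∨ y = 1) ∧ (z = 0 ∨ z = 1))
    (hw : ∀ p ∈ pts U, (t p : ℝ) = y / 3 + 2 * w p)
    (ht : ∀ p ∈ pts U, 0 ≤ t p ∧ t p ≤ 2)
    (hf : ∀ l ∈ subs 2 U, f l = 0 ∨ f l = 1)
    (line : ∀ l ∈ subs 2 U, ∑ p ∈ pts l, t p = y + 2 * f l)
    (deg : ∀ p ∈ pts U, ∑ l ∈ cov p U, f l = z + 3 * t p)
    (hc7 : ∀ p ∈ pts U, ((cov p U).card : ℤ) = 7)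
    {l0 : Submodule F V} (hl0 : l0 ∈ subs 2 U) (h0 : f l0 = 0) : Pat 2 w U := by
  have hqR : (Fintype.card F : ℝ) = ((2:ℤ):ℝ) := by rw [← hq]; simp
  have hnn : ∀ l ∈ subs 2 U, ∀ p ∈ pts l, 0 ≤ t p ∧ t p ≤ 2 := fun l hl p hp =>
    ht p (pts_mono (mem_subs.mp hl).1 hp)
  have hsub : ∀ l ∈ subs 2 U, ∀ p ∈ pts l, p ∈ pts U := fun l hl p hp =>
    pts_mono (mem_subs.mp hl).1 hp
  have hm2 : ∀ p ∈ pts U, ∀ l ∈ cov p U, l ∈ subs 2 U := fun p hp l hl =>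
    mem_subs_of_cov hl (mem_pts.mp hp).1
  have hpl : ∀ p ∈ pts U, ∀ l ∈ cov p U, p ∈ pts l := fun p hp l hl =>
    mem_pts.mpr ⟨(mem_pts.mp hp).1, (mem_cov.mp hl).1⟩
  have all0 : ∀ p ∈ pts U, z + 3 * t p = 0 → ∀ l ∈ cov p U, f l = 0 := by
    intro p hp h
    have h1 := deg p hp
    rw [h] at h1
    exact (Finset.sum_eq_zero_iff_of_nonneg (fun l hl => by
      rcases hf l (hm2 p hp l hl) with h | h <;> omega)).mp h1
  have all1 : ∀ p ∈ pts U, 7 ≤ z + 3 * t p → ∀ l ∈ cov p U, f l = 1 := by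
    intro p hp h
    apply all_one_of_sum (fun l hl => by
      rcases hf l (hm2 p hp l hl) with h | h <;> omega)
    rw [hc7 p hp, deg p hp]; exact h
  have ex0 : ∀ p ∈ pts U, z + 3 * t p < 7 → ∃ l ∈ cov p U, f l = 0 := by
    intro p hp h
    by_contra hc
    push Not at hc
    have := deg p hp
    rw [sum_all_one (fun l hl => (hf l (hm2 p hp l hl)).resolve_left (hc l hl)), hc7 p hp] at this
    omega
  have ex1 : ∀ p ∈ pts U, 0 < z + 3 * t p → ∃ l ∈ cov p U, f l = 1 := by
    intro p hp h
    by_contra hc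
    push Not at hc
    have := deg p hp
    rw [Finset.sum_eq_zero (fun l hl => (hf l (hm2 p hp l hl)).resolve_right (hc l hl))] at this
    omega
  have hcl : ∀ l ∈ subs 2 U, ((pts l).card : ℤ) = 3 := fun l hl => cpl' hq (mem_subs.mp hl).2
  have e0 := line l0 hl0
  rw [h0] at e0
  obtain ⟨p, hpl0, hp0⟩ : ∃ p ∈ pts l0, t p = 0 := by
    by_contra hc
    push Not at hc
    have : ∑ p ∈ pts l0, (1:ℤ) ≤ ∑ p ∈ pts l0, t p := Finset.sum_le_sum (fun p hp => by
      have := hnn l0 hl0 p hp; have := hc p hp; omega)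
    rw [e0] at this
    simp at this
    have := hcl l0 hl0
    omega
  have hpU := hsub l0 hl0 p hpl0
  have other : ∀ r ∈ pts U, ∀ p ∈ pts U, p ≠ r → t p + t r ≤ y + 2 * f (p ⊔ r) := by
    intro r hr p hp h
    rw [← line _ (line_mem hp hr h)]
    exact two_le_sum (fun i hi => (hnn _ (line_mem hp hr h) i hi).1) (mem_line_left hp)
      (mem_line_right hr) h
  have point : ∀ p ∈ pts U, ∀ l ∈ cov p U, t p ≤ y + 2 * f l := by
    intro p hp l hl
    rw [← line l (hm2 p hp l hl)]
    exact Finset.single_le_sum (fun i hi => (hnn _ (hm2 p hp l hl) i hi).1) (hpl p hp l hl)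
  obtain ⟨hy, hz⟩ := hyz
  rcases hy with hy | hy <;> rcases hz with hz | hz
  · left; left
    intro r hr
    have tr : t r = 0 := by
      by_cases h : p = r
      · rw [← h, hp0]
      have h1 := other r hr p hpU h
      rw [all0 p hpU (by omega) _ (line_cov hpU hr h)] at h1
      have := (ht r hr).1
      omega
    have := hw r hr
    rw [tr, hy] at this
    push_cast at this
    linarith
  · left; right; left
    have t02 : ∀ r ∈ pts U, t r ≠ 1 := by
      intro r hr h1
      obtain ⟨l, hl, hl'⟩ := ex0 r hr (by omega)
      have := point r hr l hl
      omega
    obtain ⟨l, hl, hl1⟩ := ex1 p hpU (by omega)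
    have hl2 := hm2 p hpU l hl
    have e1 := line l hl2
    rw [hl1] at e1
    obtain ⟨p0, hp0l, hp02⟩ : ∃ r ∈ pts l, t r ≠ 0 := by
      by_contra hc
      push Not at hc
      rw [Finset.sum_eq_zero hc] at e1
      omega
    have hp0U := hsub l hl2 p0 hp0l
    have ht2 : t p0 = 2 := by
      have := t02 p0 hp0U; have := ht p0 hp0U; omega
    refine ⟨p0, hp0U, fun r hr => ?_⟩
    have h3 := hw r hr
    rw [hy] at h3
    by_cases h : r = p0
    · rw [if_pos h]
      rw [h, ht2] at h3
      push_cast at h3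
      rw [h]
      linarith
    · rw [if_neg h]
      have h1 := other r hr p0 hp0U (fun e => h e.symm)
      rw [all1 p0 hp0U (by omega) _ (line_cov hp0U hr (fun e => h e.symm))] at h1
      have : t r = 0 := by have := (ht r hr).1; omega
      rw [this] at h3
      push_cast at h3
      linarith
  · right; right; right; left
    obtain ⟨H, hH, hf, h⟩ := patA1 (t := t) hq (U := U) (by
      intro r hr
      refine ⟨(ht r hr).1, ?_⟩
      by_contra hc
      obtain ⟨l, hl, hl'⟩ := ex0 r hr (by have := ht r hr; omega)
      have := point r hr l hl
      omega) (by
      intro l hl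
      rw [line l hl, hy]
      rcases hf l hl with h | h <;> rw [h]
      · left; ring
      · right; ring) hpU hp0
    refine ⟨H, hH, hf, fun p hp => ?_⟩
    rw [hqR, comp2 hqR (by norm_num)]
    have h3 := hw p hp
    rw [h p hp, hy] at h3
    push_cast at h3 ⊢
    split_ifs with hh <;> simp only [hh] at h3 <;> norm_num at h3 ⊢ <;> linarith
  · right; right; right; right
    obtain ⟨p0, hp0U, hp02⟩ : ∃ r ∈ pts U, t r = 2 := by
      by_contra hc
      push Not at hc
      obtain ⟨l, hl, hl1⟩ := ex1 p hpU (by omega)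
      have hl2 := hm2 p hpU l hl
      have e1 := line l hl2
      rw [hl1] at e1
      have := all_one_of_sum (g := t) (fun i hi => by
        have := hc i (hsub l hl2 i hi); have := hnn l hl2 i hi; omega) (by
        rw [e1, hcl l hl2]; omega) p (hpl p hpU l hl)
      omega
    obtain ⟨H, hH, hf, hnot, h⟩ := patA2 (t := t) hq hp0U (by
      intro r hr hne
      refine ⟨(ht r hr).1, ?_⟩
      have h1 := other r hr p0 hp0U (fun e => hne e.symm)
      rw [all1 p0 hp0U (by omega) _ (line_cov hp0U hr (fun e => hne e.symm))] at h1
      omega) hp02 (by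
      intro l hl
      rw [line l hl, hy]
      rcases hf l hl with h | h <;> rw [h]
      · left; ring
      · right; ring)
    refine ⟨H, hH, hf, p0, hp0U, hnot, fun p hp => ?_⟩
    rw [hqR, comp2 hqR (by norm_num)]
    have h3 := hw p hp
    rw [h p hp, hy] at h3
    push_cast at h3 ⊢
    split_ifs with hh h4 <;> simp only [hh] at h3
    · norm_num at h3 ⊢; linarith
    · rw [if_neg (by simp), if_pos h4] at h3; norm_num at h3 ⊢; linarith
    · rw [if_neg (by simp), if_neg h4] at h3; norm_num at h3 ⊢; linarith

theorem half4 {w : Submodule F V → ℝ} (hL : LB 2 w) (hq : (Fintype.card F : ℤ) = 2)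
    (hU : finrank F U = 4) (hx : wt w U < 3) {l0 : Submodule F V} (hl0 : l0 ∈ subs 2 U)
    (hz0 : wt w l0 = 0) : Pat 2 w U := by
  have hqR : (Fintype.card F : ℝ) = (2:ℝ) := by exact_mod_cast hq
  have hsub : ∀ {j : ℕ} {A : Submodule F V}, A ∈ subs j U → ∀ p ∈ pts A, p ∈ pts U :=
    fun hA p hp => pts_mono (mem_subs.mp hA).1 hp
  obtain ⟨p0, hp0⟩ := exists_pt (A := l0) (by rw [(mem_subs.mp hl0).2]; omega)
  have hp0U := hsub hl0 p0 hp0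
  have hdiff : ∀ p ∈ pts U, ∃ m : ℤ, (m : ℝ) = 2 * (w p - w p0) := fun p hp =>
    mdiff hL hqR (by omega) hp hp0U
  choose! m hm using hdiff
  have hM : ∃ M : ℤ, (M : ℝ) = - 6 * w p0 := by
    refine ⟨∑ p ∈ pts l0, m p, ?_⟩
    push_cast
    rw [Finset.sum_congr rfl (fun p hp => hm p (hsub hl0 p hp)), ← Finset.mul_sum,
      Finset.sum_sub_distrib, Finset.sum_const, nsmul_eq_mul, cp2 hqR (mem_subs.mp hl0).2]
    have : ∑ p ∈ pts l0, w p = 0 := hz0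
    rw [this]; ring
  obtain ⟨M, hM⟩ := hM
  obtain ⟨y, hy⟩ : ∃ y, y = M % 3 := ⟨_, rfl⟩
  have ht : ∀ p ∈ pts U, ∃ t : ℤ, (t : ℝ) = y / 3 + 2 * w p := by
    intro p hp
    refine ⟨m p - M / 3, ?_⟩
    have : (M : ℝ) = 3 * (M / 3 : ℤ) + y := by
      have : M = 3 * (M / 3) + y := by omega
      exact_mod_cast this
    push_cast
    rw [hm p hp]
    linarith
  choose! t ht using ht
  have hf : ∀ l ∈ subs 2 U, ∃ f : ℤ, (f : ℝ) = wt w l ∧ (f = 0 ∨ f = 1) := by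
    intro l hl
    rcases hL l (mem_subs.mp hl).2 with h | h
    · exact ⟨0, by rw [h]; simp, Or.inl rfl⟩
    · exact ⟨1, by rw [h]; simp, Or.inr rfl⟩
  choose! f hf hf01 using hf
  have hr7 : (7:ℝ) * ((Fintype.card F : ℝ) - 1) = (Fintype.card F : ℝ) ^ (finrank F U - 1) - 1 := by
    rw [hU, hqR]; norm_num
  obtain ⟨d0, hd0, -⟩ := deg_int hL hp0U hr7
  obtain ⟨z, hz⟩ : ∃ z : ℤ, (z : ℝ) = wt w U - y := by
    refine ⟨d0 - 3 * t p0, ?_⟩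
    push_cast
    rw [ht p0 hp0U, hd0]; ring
  have hd : ∀ p ∈ pts U, ((z + 3 * t p : ℤ) : ℝ) = wt w U + (7 - 1) * w p := by
    intro p hp
    push_cast
    rw [hz, ht p hp]; ring
  have hdr : ∀ p ∈ pts U, 0 ≤ z + 3 * t p ∧ z + 3 * t p ≤ 7 := by
    intro p hp
    obtain ⟨d, h1, h2, h3⟩ := deg_int hL hp hr7
    rw [← hd p hp] at h1
    have h4 : d = z + 3 * t p := by exact_mod_cast h1
    have h5 : d ≤ 7 := by exact_mod_cast h3
    omega
  have hS : ∀ π ∈ subs 3 U, ∃ S : ℤ, wt w π - y / 3 = S := by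
    intro π hπ
    obtain ⟨p, hp⟩ := exists_pt (A := π) (by rw [(mem_subs.mp hπ).2]; omega)
    obtain ⟨d, hd, -⟩ := deg_int hL hp (r := 3) (by rw [hqR, (mem_subs.mp hπ).2]; norm_num)
    refine ⟨d - t p, ?_⟩
    have := ht p (hsub hπ p hp)
    push_cast
    linarith
  choose! S hS using hS
  have hmod : ∃ k, y * (y - 1) + z * (z - 1) = 3 * k := by
    have e := F1b hL hqR (y / 3 : ℝ) (mem_subs.mp hl0).2 hU (mem_subs.mp hl0).1
    refine ⟨∑ π ∈ cov l0 U, S π * (S π - 1) + ∑ p ∈ pts l0, t p * (t p - 1)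
      - 2 * f l0, ?_⟩
    have e6 : wt w U - (2 + 1) * ((y:ℝ) / 3) = z := by rw [hz]; ring
    have e7 : (2 + 1) * ((y:ℝ) / 3) = y := by ring
    have e4 : ∑ π ∈ cov l0 U, (wt w π - (y:ℝ) / 3) * (wt w π - (y:ℝ) / 3 - 1) =
        ∑ π ∈ cov l0 U, (S π : ℝ) * (S π - 1) := Finset.sum_congr rfl (fun π hπ => by
      rw [hS π (mem_subs_of_cov hπ (mem_subs.mp hl0).2)])
    have e5 : ∑ p ∈ pts l0, ((y:ℝ) / 3 + 2 * w p) * ((y:ℝ) / 3 + 2 * w p - 1) =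
        ∑ p ∈ pts l0, (t p : ℝ) * (t p - 1) := Finset.sum_congr rfl (fun p hp => by
      rw [ht p (hsub hl0 p hp)])
    rw [e4, e5, ← hf l0 hl0, e6, e7] at e
    have : ((y * (y - 1) + z * (z - 1) : ℤ) : ℝ) = ((3 * (∑ π ∈ cov l0 U, S π * (S π - 1) +
        ∑ p ∈ pts l0, t p * (t p - 1) - 2 * f l0) : ℤ) : ℝ) := by
      push_cast
      linarith
    exact_mod_cast this
  have hrange := (wt_range hL U hr7 (t := 15) (by rw [hU, hqR]; norm_num)).1
  have hx0 : -1 < y + z := by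
    have : (-1:ℝ) < y + z := by rw [hz]; linarith
    exact_mod_cast this
  have hx3 : y + z < 3 := by
    have : (y:ℝ) + z < 3 := by rw [hz]; linarith
    exact_mod_cast this
  have hyz : (y = 0 ∨ y = 1) ∧ (z = 0 ∨ z = 1) := by
    obtain ⟨k, hk⟩ := hmod
    have h1 : 0 ≤ y := by omega
    have h2 : y < 3 := by omega
    have h3 : -2 ≤ z := by omega
    have h4 : z ≤ 2 := by omega
    clear hy hS hf01 hdr hd
    interval_cases y <;> interval_cases z <;> omega
  have htr : ∀ p ∈ pts U, 0 ≤ t p ∧ t p ≤ 2 := by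
    intro p hp
    have := hdr p hp
    omega
  refine core4 hL hq hyz ht htr hf01 ?_ ?_ ?_ hl0 ?_
  · intro l hl
    have e := tau1 w hqR (y / 3 : ℝ) (mem_subs.mp hl).2
    rw [← Finset.sum_congr rfl (fun p hp => ht p (hsub hl p hp)), ← hf l hl] at e
    have : ((∑ p ∈ pts l, t p : ℤ) : ℝ) = ((y + 2 * f l : ℤ) : ℝ) := by
      push_cast
      linarith
    exact_mod_cast this
  · intro p hp
    have e := line_sum w hp hr7
    rw [← hd p hp, ← Finset.sum_congr rfl (fun l hl => hf l (mem_subs_of_cov hl (mem_pts.mp hp).1))] at e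
    exact_mod_cast e
  · intro p hp
    have := cov_card_eq (r := 7) (mem_pts.mp hp).2 (by rw [(mem_pts.mp hp).1]; exact hr7)
    have h : ((cov p U).card : ℝ) = ((7:ℤ):ℝ) := by rw [this]; norm_num
    exact_mod_cast h
  · have := hf l0 hl0
    rw [hz0] at this
    exact_mod_cast this

theorem main4 {w : Submodule F V → ℝ} (hL : LB 2 w) (hq : (Fintype.card F : ℤ) = 2)
    (hU : finrank F U = 4) : Pat 2 w U := by
  have hqR : (Fintype.card F : ℝ) = ((2:ℤ):ℝ) := by rw [← hq]; simp
  by_cases h0 : ∃ l ∈ subs 2 U, wt w l = 0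
  swap
  · push Not at h0
    exact no0 (by norm_num) (by omega) hL h0
  by_cases h1 : ∃ l ∈ subs 2 U, wt (comp 2 w) l = 0
  swap
  · push Not at h1
    exact Pat_comp (no0 (by norm_num) (by omega) (LB_comp (by norm_num) hL) h1)
  obtain ⟨l, hl, hl0⟩ := h0
  obtain ⟨l', hl', hl0'⟩ := h1
  have hc : ((pts U).card : ℝ) = 15 := card_pts_eq hqR (by rw [hU]; norm_num)
  have : wt (comp 2 w) U = 5 - wt w U := by
    simp only [wt]
    rw [Finset.sum_congr rfl (fun p _ => comp2 hqR (by norm_num) p), Finset.sum_sub_distrib,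
      Finset.sum_const, nsmul_eq_mul, hc]
    norm_num
  rcases lt_or_ge (wt w U) 3 with h | h
  · exact half4 hL hq hU h hl hl0
  · exact Pat_comp (half4 (LB_comp (by norm_num) hL) hq hU (by linarith) hl' hl0')

end
end GC

namespace GC
section
variable {F V : Type*} [Field F] [Fintype F] [AddCommGroup V] [Module F V] [Finite V]
variable {U : Submodule F V}

variable {W : Submodule F V}

theorem Q_gt {k : ℕ} (hk : 2 ≤ k) : 1 < (Fintype.card F : ℝ) ^ (k - 1) :=
  one_lt_pow₀ (q_gt_one (F := F)) (by omega)

theorem comm3 {m : ℕ} (hm : 4 ≤ m) (hW : m ≤ finrank F W) {a b c : Submodule F V}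
    (ha : a ∈ pts W) (hb : b ∈ pts W) (hc : c ∈ pts W) :
    ∃ U ≤ W, finrank F U = m ∧ a ∈ pts U ∧ b ∈ pts U ∧ c ∈ pts U := by
  rw [mem_pts] at ha hb hc
  have h1 : finrank F ↥(a ⊔ b ⊔ c) ≤ m := by
    have e1 := Submodule.finrank_add_le_finrank_add_finrank a b
    have e2 := Submodule.finrank_add_le_finrank_add_finrank (a ⊔ b) c
    omega
  obtain ⟨U, h2, h3, h4⟩ := exists_between (sup_le (sup_le ha.2 hb.2) hc.2) h1 hW
  refine ⟨U, h3, h4, mem_pts.mpr ⟨ha.1, ?_⟩, mem_pts.mpr ⟨hb.1, ?_⟩, mem_pts.mpr ⟨hc.1, ?_⟩⟩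
  · exact le_trans (le_trans le_sup_left le_sup_left) h2
  · exact le_trans (le_trans le_sup_right le_sup_left) h2
  · exact le_trans le_sup_right h2

/-- in a hyperplane-type pattern, zero set is the hyperplane -/
theorem PatA_zero {k : ℕ} (hk : 2 ≤ k) {w : Submodule F V → ℝ} (h : PatA k w U)
    {p0 : Submodule F V} (hp0 : p0 ∈ pts U) (h0 : w p0 ≠ 0) (h1 : w p0 ≠ 1) :
    ∃ H ≤ U, finrank F H + 1 = finrank F U ∧ (∀ p ∈ pts U, (w p = 0 ↔ p ≤ H)) ∧
      ((∀ p ∈ pts U, w p ≠ 0 → (Fintype.card F : ℝ) ^ (k - 1) * w p = 1) ∨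
       (∃ p1 ∈ pts U, (Fintype.card F : ℝ) ^ (k - 1) * w p1 = 1 - (Fintype.card F : ℝ) ^ (k - 1) ∧
        ∀ p ∈ pts U, p ≠ p1 → w p ≠ 0 → (Fintype.card F : ℝ) ^ (k - 1) * w p = 1)) := by
  have hQ := Q_gt (F := F) hk
  have z : ∀ p, w p = 0 ↔ (Fintype.card F : ℝ) ^ (k - 1) * w p = 0 := by
    intro p
    constructor
    · intro h; rw [h, mul_zero]
    · intro h; exact (mul_eq_zero.mp h).resolve_left (by linarith)
  rcases h with h | ⟨p1, hp1, h⟩ | ⟨H, hH, hf, h⟩ | ⟨H, hH, hf, p1, hp1, hn, h⟩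
  · exact absurd (h p0 hp0) h0
  · have := h p0 hp0
    split_ifs at this <;> contradiction
  · refine ⟨H, hH, hf, ?_, Or.inl ?_⟩
    · intro p hp
      rw [z, h p hp]; split_ifs with hh <;> simp [hh]
    · intro p hp hne
      rw [ne_eq, z] at hne
      rw [h p hp] at hne ⊢
      split_ifs at hne ⊢ <;> simp_all
  · refine ⟨H, hH, hf, ?_, Or.inr ⟨p1, hp1, ?_, ?_⟩⟩
    · intro p hp
      rw [z, h p hp]; split_ifs with hh h3
      · simp [hh]
      · simp only [hh, iff_false]; intro h4; linarith
      · simp [hh]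
    · rw [h p1 hp1, if_neg hn, if_pos rfl]
    · intro p hp hne1 hne
      rw [ne_eq, z] at hne
      rw [h p hp] at hne ⊢
      rw [if_neg hne1] at hne ⊢
      split_ifs at hne ⊢ <;> simp_all

theorem liftA {k m : ℕ} (hk : 2 ≤ k) (hm : 4 ≤ m) (hW : m ≤ finrank F W)
    {w : Submodule F V → ℝ} (h : ∀ U ≤ W, finrank F U = m → PatA k w U) : PatA k w W := by
  have hQ := Q_gt (F := F) hk
  by_cases h1 : ∃ p ∈ pts W, w p = 1
  · obtain ⟨p, hp, hp1⟩ := h1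
    right; left
    refine ⟨p, hp, fun r hr => ?_⟩
    obtain ⟨U, hU, hf, hpU, -, hrU⟩ := comm3 hm hW hp hp hr
    rcases h U hU hf with h | ⟨p1, hp1', h⟩ | ⟨H, hH, hf, h⟩ | ⟨H, hH, hf, p1, hp1', hn, h⟩
    · have := h p hpU; rw [hp1] at this; norm_num at this
    · have := h p hpU
      split_ifs at this with e
      · rw [h r hrU, e]
      · rw [this] at hp1; norm_num at hp1
    · exfalso
      have := h p hpU
      rw [hp1] at this
      split_ifs at this <;> linarith
    · exfalso
      have := h p hpU
      rw [hp1] at this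
      split_ifs at this <;> linarith
  push Not at h1
  by_cases h0 : ∃ p ∈ pts W, w p ≠ 0
  swap
  · push Not at h0; exact Or.inl h0
  obtain ⟨p0, hp0, hp00⟩ := h0
  obtain ⟨H, hH, hfH, hz⟩ := hyper (U := W) (Z := fun p => w p = 0) (by
    intro p hp r hr hne hp' hr' s hs
    obtain ⟨U, hU, hf, hpU, hrU, h0U⟩ := comm3 hm hW hp hr hp0
    obtain ⟨H, hH, -, hz, -⟩ := PatA_zero hk (h U hU hf) h0U hp00 (h1 p0 hp0)
    have hsU : s ∈ pts U := pts_mono (sup_le (mem_pts.mp hpU).2 (mem_pts.mp hrU).2) hs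
    rw [hz s hsU]
    exact (mem_pts.mp hs).2.trans (sup_le ((hz p hpU).mp hp') ((hz r hrU).mp hr'))) (by
    intro p hp r hr hne
    obtain ⟨U, hU, hf, hpU, hrU, h0U⟩ := comm3 hm hW hp hr hp0
    obtain ⟨H, hH, hfH, hz, -⟩ := PatA_zero hk (h U hU hf) h0U hp00 (h1 p0 hp0)
    have hle : p ⊔ r ≤ U := sup_le (mem_pts.mp hpU).2 (mem_pts.mp hrU).2
    have e1 := Submodule.finrank_sup_add_finrank_inf_eq (p ⊔ r) H
    rw [finrank_line (mem_pts.mp hp).1 (mem_pts.mp hr).1 hne] at e1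
    have e2 : finrank F ↥((p ⊔ r) ⊔ H) ≤ finrank F U := Submodule.finrank_mono (sup_le hle hH)
    obtain ⟨s, hs⟩ := exists_pt (A := (p ⊔ r) ⊓ H) (by omega)
    rw [mem_pts] at hs
    refine ⟨s, mem_pts.mpr ⟨hs.1, hs.2.trans inf_le_left⟩, ?_⟩
    exact (hz s (mem_pts.mpr ⟨hs.1, (hs.2.trans inf_le_left).trans hle⟩)).mpr
      (hs.2.trans inf_le_right)) hp0 hp00
  right; right
  by_cases h2 : ∃ p ∈ pts W, (Fintype.card F : ℝ) ^ (k - 1) * w p = 1 - (Fintype.card F : ℝ) ^ (k - 1)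
  · right
    obtain ⟨p1, hp1, hp1'⟩ := h2
    have hne : w p1 ≠ 0 := by intro h; rw [h] at hp1'; linarith
    refine ⟨H, hH, hfH, p1, hp1, fun hc => hne ((hz p1 hp1).mpr hc), fun p hp => ?_⟩
    split_ifs with e1 e2
    · rw [(hz p hp).mpr e1, mul_zero]
    · rw [e2, hp1']
    · obtain ⟨U, hU, hf, hpU, -, h1U⟩ := comm3 hm hW hp hp hp1
      have hpne : w p ≠ 0 := fun hc => e1 ((hz p hp).mp hc)
      obtain ⟨-, -, -, -, h3 | ⟨p2, hp2, h3, h4⟩⟩ := PatA_zero hk (h U hU hf) hpU hpne (h1 p hp)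
      · exact h3 p hpU hpne
      · have : p1 = p2 := by
          by_contra hc
          have := h4 p1 h1U hc hne
          linarith
        exact h4 p hpU (this ▸ e2) hpne
  · left
    push Not at h2
    refine ⟨H, hH, hfH, fun p hp => ?_⟩
    split_ifs with e1
    · rw [(hz p hp).mpr e1, mul_zero]
    · obtain ⟨U, hU, hf, hpU, -, -⟩ := comm3 hm hW hp hp hp
      have hpne : w p ≠ 0 := fun hc => e1 ((hz p hp).mp hc)
      obtain ⟨-, -, -, -, h3 | ⟨p2, hp2, h3, h4⟩⟩ := PatA_zero hk (h U hU hf) hpU hpne (h1 p hp)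
      · exact h3 p hpU hpne
      · exact absurd h3 (h2 p2 (pts_mono hU hp2))

theorem PatA_int {k : ℕ} {w : Submodule F V → ℝ} (h : PatA k w U)
    {p : Submodule F V} (hp : p ∈ pts U) : ∃ n : ℤ, (Fintype.card F : ℝ) ^ (k - 1) * w p = n := by
  have c1 : ((Fintype.card F : ℤ) ^ (k - 1) : ℤ) = (Fintype.card F : ℝ) ^ (k - 1) := by
    push_cast; rfl
  rcases h with h | ⟨p1, hp1, h⟩ | ⟨H, hH, hf, h⟩ | ⟨H, hH, hf, p1, hp1', hn, h⟩
  · exact ⟨0, by rw [h p hp]; simp⟩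
  · rw [h p hp]
    split_ifs
    · exact ⟨(Fintype.card F : ℤ) ^ (k - 1), by rw [c1, mul_one]⟩
    · exact ⟨0, by simp⟩
  · rw [h p hp]
    split_ifs
    · exact ⟨0, by simp⟩
    · exact ⟨1, by simp⟩
  · rw [h p hp]
    split_ifs
    · exact ⟨0, by simp⟩
    · exact ⟨1 - (Fintype.card F : ℤ) ^ (k - 1), by rw [← c1]; push_cast; rfl⟩
    · exact ⟨1, by simp⟩

theorem not_both {k : ℕ} (hk : 2 ≤ k) {w : Submodule F V → ℝ} {p : Submodule F V} {a b : ℤ}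
    (h1 : (Fintype.card F : ℝ) ^ (k - 1) * w p = a)
    (h2 : (Fintype.card F : ℝ) ^ (k - 1) * comp k w p = b) : False := by
  have hQ := Q_gt (F := F) hk
  have hq := q_gt_one (F := F)
  have e : (Fintype.card F : ℝ) ^ k = (Fintype.card F : ℝ) ^ (k - 1) * Fintype.card F := by
    rw [← pow_succ]; congr 1; omega
  have hpos : 0 < (Fintype.card F : ℝ) ^ k - 1 := by rw [e]; nlinarith
  have h3 : (Fintype.card F : ℝ) ^ (k - 1) * (((Fintype.card F : ℝ) - 1) / ((Fintype.card F : ℝ) ^ k - 1))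
      = ((a + b : ℤ) : ℝ) := by
    push_cast
    rw [← h1, ← h2, comp]; ring
  rw [← mul_div_assoc, div_eq_iff (by linarith)] at h3
  have h4 : (0:ℝ) < ((a + b : ℤ) : ℝ) := by
    by_contra hc
    have : ((a + b : ℤ) : ℝ) * ((Fintype.card F : ℝ) ^ k - 1) ≤ 0 :=
      mul_nonpos_of_nonpos_of_nonneg (by linarith) hpos.le
    nlinarith
  have h5 : ((a + b : ℤ) : ℝ) < 1 := by
    by_contra hc
    have : (1:ℝ) * ((Fintype.card F : ℝ) ^ k - 1) ≤ ((a + b : ℤ) : ℝ) * ((Fintype.card F : ℝ) ^ k - 1) :=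
      mul_le_mul_of_nonneg_right (by linarith) hpos.le
    rw [← h3, e] at this
    linarith
  have h4' : 0 < a + b := by exact_mod_cast h4
  have h5' : a + b < 1 := by exact_mod_cast h5
  omega

theorem lift {k m : ℕ} (hk : 2 ≤ k) (hm : 4 ≤ m) (hW : m ≤ finrank F W)
    {w : Submodule F V → ℝ} (h : ∀ U ≤ W, finrank F U = m → Pat k w U) : Pat k w W := by
  obtain ⟨p0, hp0⟩ := exists_pt (A := W) (by omega)
  have main : ∀ w : Submodule F V → ℝ, (∀ U ≤ W, finrank F U = m → Pat k w U) →
      (∃ n : ℤ, (Fintype.card F : ℝ) ^ (k - 1) * w p0 = n) → Pat k w W := by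
    intro w h hint
    left
    have h1 : ∀ U ≤ W, finrank F U = m → ∀ p ∈ pts U,
        (∃ n : ℤ, (Fintype.card F : ℝ) ^ (k - 1) * w p = n) → PatA k w U := by
      rintro U hU hf p hp ⟨n, hn⟩
      rcases h U hU hf with h2 | h2
      · exact h2
      · obtain ⟨b, hb⟩ := PatA_int h2 hp
        exact (not_both hk hn hb).elim
    refine liftA hk hm hW (fun U hU hf => ?_)
    obtain ⟨p, hp⟩ := exists_pt (A := U) (by omega)
    obtain ⟨U', hU', hf', hpU', h0U', -⟩ := comm3 hm hW (pts_mono hU hp) hp0 hp0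
    exact h1 U hU hf p hp (PatA_int (h1 U' hU' hf' p0 h0U' hint) hpU')
  obtain ⟨U, hU, hf, h0U, -, -⟩ := comm3 hm hW hp0 hp0 hp0
  rcases h U hU hf with h2 | h2
  · exact main w h (PatA_int h2 h0U)
  · refine Pat_comp (main _ (fun U hU hf => ?_) (PatA_int h2 h0U))
    apply Pat_comp
    rw [comp_comp]; exact h U hU hf

theorem main2 {w : Submodule F V → ℝ} (hL : LB 2 w)
    {q : ℤ} (hq : (Fintype.card F : ℤ) = q) (hq' : q = 2 ∨ q = 3 ∨ q = 4 ∨ q = 5)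
    (hU : 5 ≤ finrank F W) : Pat 2 w W :=
  lift le_rfl (by norm_num) hU (fun _ _ hf => main5 hL hq hq' hf)

end
end GC

namespace GC
section
variable {F V : Type*} [Field F] [Fintype F] [AddCommGroup V] [Module F V] [Finite V]
variable {U : Submodule F V}

variable {W : Submodule F V}

theorem wt_delta (p0 S : Submodule F V) (hp0 : finrank F p0 = 1) :
    wt (fun p => if p = p0 then (1:ℝ) else 0) S = if p0 ≤ S then 1 else 0 := by
  simp only [wt]
  rw [Finset.sum_ite_eq' (pts S) p0 (fun _ => (1:ℝ))]
  simp only [mem_pts, hp0, true_and]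

theorem wt_off {k : ℕ} (hk : 1 ≤ k) {H S : Submodule F V} (hH : H ≤ U)
    (hf : finrank F H + 1 = finrank F U) (hS : S ≤ U) (hSk : finrank F S = k) :
    wt (fun p => if p ≤ H then (0:ℝ) else 1 / (Fintype.card F : ℝ) ^ (k - 1)) S =
      if S ≤ H then 0 else 1 := by
  have hq := q_gt_one (F := F)
  split_ifs with h
  · exact Finset.sum_eq_zero (fun p hp => if_pos ((mem_pts.mp hp).2.trans h))
  · have hSH : finrank F ↥(S ⊓ H) = k - 1 := by
      have e1 := Submodule.finrank_sup_add_finrank_inf_eq S H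
      have e2 : finrank F ↥(S ⊔ H) ≤ finrank F U := Submodule.finrank_mono (sup_le hS hH)
      have e3 : finrank F H < finrank F ↥(S ⊔ H) := by
        apply Submodule.finrank_lt_finrank_of_lt
        exact lt_of_le_of_ne le_sup_right (fun hc => h (by rw [hc]; exact le_sup_left))
      omega
    have e : wt (fun p => if p ≤ H then (0:ℝ) else 1 / (Fintype.card F : ℝ) ^ (k - 1)) S =
        ∑ p ∈ pts S \ pts (S ⊓ H), 1 / (Fintype.card F : ℝ) ^ (k - 1) := by
      simp only [wt]
      rw [← Finset.sum_sdiff (pts_mono (inf_le_left : S ⊓ H ≤ S)),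
        Finset.sum_eq_zero (s := pts (S ⊓ H)), add_zero]
      · refine Finset.sum_congr rfl (fun p hp => ?_)
        rw [if_neg]
        intro hc
        rw [Finset.mem_sdiff, mem_pts, mem_pts] at hp
        exact hp.2 ⟨hp.1.1, le_inf hp.1.2 hc⟩
      · intro p hp
        exact if_pos ((mem_pts.mp hp).2.trans inf_le_right)
    have c1 := card_pts S
    have c2 := card_pts (S ⊓ H)
    rw [hSH] at c2
    rw [hSk] at c1
    have c3 : ((pts S \ pts (S ⊓ H)).card : ℝ) = (pts S).card - (pts (S ⊓ H)).card := by
      rw [Finset.card_sdiff_of_subset (pts_mono inf_le_left), Nat.cast_sub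
        (Finset.card_le_card (pts_mono inf_le_left))]
    rw [e, Finset.sum_const, nsmul_eq_mul, c3]
    have e' : (Fintype.card F : ℝ) ^ k = (Fintype.card F : ℝ) ^ (k - 1) * Fintype.card F := by
      rw [← pow_succ]; congr 1; omega
    have hQ : 0 < (Fintype.card F : ℝ) ^ (k - 1) := by positivity
    rw [mul_one_div, div_eq_one_iff_eq hQ.ne']
    rw [e'] at c1
    have : ((Fintype.card F : ℝ) - 1) ≠ 0 := by linarith
    apply mul_right_cancel₀ this
    linarith

theorem wt_sub (a b : Submodule F V → ℝ) (S : Submodule F V) :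
    wt (fun p => a p - b p) S = wt a S - wt b S := by
  simp only [wt]; rw [Finset.sum_sub_distrib]

theorem wt_congr {a b : Submodule F V → ℝ} (h : ∀ p ∈ pts U, a p = b p) {S : Submodule F V}
    (hS : S ≤ U) : wt a S = wt b S :=
  Finset.sum_congr rfl (fun p hp => h p (pts_mono hS hp))

def TrA (k : ℕ) (f : Submodule F V → ℝ) (U : Submodule F V) : Prop :=
  (∀ S ∈ subs k U, f S = 0) ∨
  (∃ p0 ∈ pts U, ∀ S ∈ subs k U, f S = if p0 ≤ S then 1 else 0) ∨
  (∃ H ≤ U, finrank F H + 1 = finrank F U ∧ ∀ S ∈ subs k U, f S = if S ≤ H then 0 else 1) ∨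
  (∃ H ≤ U, finrank F H + 1 = finrank F U ∧ ∃ p0 ∈ pts U, ¬ p0 ≤ H ∧
    ∀ S ∈ subs k U, f S = (if S ≤ H then 0 else 1) - (if p0 ≤ S then 1 else 0))

theorem pat_eq3 {k : ℕ} {w : ℝ} {P : Prop} (h : (Fintype.card F : ℝ) ^ (k - 1) * w = if P then 0 else 1) :
    w = if P then 0 else 1 / (Fintype.card F : ℝ) ^ (k - 1) := by
  have hq := q_gt_one (F := F)
  have hQ : 0 < (Fintype.card F : ℝ) ^ (k - 1) := by positivity
  rw [eq_comm] at h
  split_ifs at h ⊢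
  · have := h.symm; simpa [hQ.ne'] using this
  · rw [h]; field_simp

theorem TrA_of_PatA {k : ℕ} (hk : 1 ≤ k) {w : Submodule F V → ℝ} (h : PatA k w U) :
    TrA k (wt w) U := by
  have hq := q_gt_one (F := F)
  have hQ : 0 < (Fintype.card F : ℝ) ^ (k - 1) := by positivity
  rcases h with h | ⟨p1, hp1, h⟩ | ⟨H, hH, hf, h⟩ | ⟨H, hH, hf, p1, hp1, hn, h⟩
  · left
    intro S hS
    exact Finset.sum_eq_zero (fun p hp => h p (pts_mono (mem_subs.mp hS).1 hp))
  · right; left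
    refine ⟨p1, hp1, fun S hS => ?_⟩
    rw [wt_congr h (mem_subs.mp hS).1, wt_delta _ _ (mem_pts.mp hp1).1]
  · right; right; left
    refine ⟨H, hH, hf, fun S hS => ?_⟩
    rw [wt_congr (fun p hp => pat_eq3 (h p hp)) (mem_subs.mp hS).1,
      wt_off hk hH hf (mem_subs.mp hS).1 (mem_subs.mp hS).2]
  · right; right; right
    refine ⟨H, hH, hf, p1, hp1, hn, fun S hS => ?_⟩
    rw [← wt_delta _ _ (mem_pts.mp hp1).1, ← wt_off hk hH hf (mem_subs.mp hS).1 (mem_subs.mp hS).2,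
      ← wt_sub]
    refine wt_congr (fun p hp => ?_) (mem_subs.mp hS).1
    have := h p hp
    by_cases e : p = p1
    · subst e
      rw [if_neg hn, if_pos rfl] at this
      rw [if_neg hn, if_pos rfl]
      field_simp
      linarith
    · rw [if_neg e] at this ⊢
      rw [sub_zero]
      exact pat_eq3 this

theorem PatA_of_TrA {k : ℕ} (hk : 1 ≤ k) (hU : k < finrank F U) {w : Submodule F V → ℝ}
    (h : TrA k (wt w) U) : PatA k w U := by
  have hq := q_gt_one (F := F)
  have hQ : 0 < (Fintype.card F : ℝ) ^ (k - 1) := by positivity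
  rcases h with h | ⟨p1, hp1, h⟩ | ⟨H, hH, hf, h⟩ | ⟨H, hH, hf, p1, hp1, hn, h⟩
  · left
    exact uniq hk hU (fun S h1 h2 => h S (mem_subs.mpr ⟨h1, h2⟩))
  · right; left
    refine ⟨p1, hp1, fun p hp => ?_⟩
    have := uniq (u := fun p => w p - if p = p1 then 1 else 0) hk hU (fun S h1 h2 => by
      rw [wt_sub, wt_delta _ _ (mem_pts.mp hp1).1, h S (mem_subs.mpr ⟨h1, h2⟩), sub_self]) p hp
    linarith
  · right; right; left
    refine ⟨H, hH, hf, fun p hp => ?_⟩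
    have := uniq (u := fun p => w p - if p ≤ H then (0:ℝ) else 1 / (Fintype.card F : ℝ) ^ (k - 1))
      hk hU (fun S h1 h2 => by
      rw [wt_sub, wt_off hk hH hf h1 h2, h S (mem_subs.mpr ⟨h1, h2⟩), sub_self]) p hp
    rw [sub_eq_zero.mp this]
    split_ifs
    · simp
    · field_simp
  · right; right; right
    refine ⟨H, hH, hf, p1, hp1, hn, fun p hp => ?_⟩
    have := uniq (u := fun p => w p - ((if p ≤ H then (0:ℝ) else 1 / (Fintype.card F : ℝ) ^ (k - 1))
      - (if p = p1 then 1 else 0)))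
      hk hU (fun S h1 h2 => by
      rw [wt_sub, wt_sub, wt_off hk hH hf h1 h2, wt_delta _ _ (mem_pts.mp hp1).1,
        h S (mem_subs.mpr ⟨h1, h2⟩), sub_self]) p hp
    rw [sub_eq_zero.mp this]
    by_cases e : p = p1
    · subst e
      rw [if_neg hn, if_pos rfl, if_neg hn, if_pos rfl]
      field_simp
    · rw [if_neg e, if_neg e]
      split_ifs
      · simp
      · field_simp; simp

/-- duality -/
noncomputable def perp (U : Submodule F V) (T : Submodule F (Dual F U)) : Submodule F V :=
  T.dualCoannihilator.map U.subtype

theorem perp_le (T : Submodule F (Dual F U)) : perp U T ≤ U := by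
  simpa [perp] using Submodule.map_subtype_le U _

theorem perp_anti (T T' : Submodule F (Dual F U)) : perp U T ≤ perp U T' ↔ T' ≤ T := by
  rw [perp, perp, Submodule.map_le_map_iff_of_injective U.injective_subtype]
  constructor
  · intro h
    have := Submodule.dualAnnihilator_anti h
    rwa [Subspace.dualCoannihilator_dualAnnihilator_eq,
      Subspace.dualCoannihilator_dualAnnihilator_eq] at this
  · exact fun h => Submodule.dualCoannihilator_anti h

theorem perp_finrank (T : Submodule F (Dual F U)) : finrank F (perp U T) + finrank F T = finrank F U := by
  rw [perp, Submodule.finrank_map_subtype_eq, add_comm]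
  exact Subspace.finrank_add_finrank_dualCoannihilator_eq T

theorem perp_surj {A : Submodule F V} (hA : A ≤ U) : ∃ T : Submodule F (Dual F U), perp U T = A := by
  refine ⟨(A.comap U.subtype).dualAnnihilator, ?_⟩
  rw [perp, Subspace.dualAnnihilator_dualCoannihilator_eq, Submodule.map_comap_subtype]
  exact inf_eq_right.mpr hA

end
end GC

namespace GC
section
variable {F V : Type*} [Field F] [Fintype F] [AddCommGroup V] [Module F V] [Finite V]
variable {U : Submodule F V}


theorem dual_pat [Finite (Dual F U)] {k : ℕ} (hk : 1 ≤ k) (hU : finrank F U = k + 2)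
    {w : Submodule F V → ℝ} {v : Submodule F (Dual F U) → ℝ}
    (hv : ∀ T : Submodule F (Dual F U), finrank F T = 2 → wt v T = wt w (perp U T))
    (h : PatA 2 v ⊤) : Pat k w U := by
  have hfd : finrank F (⊤ : Submodule F (Dual F U)) = k + 2 := by
    rw [finrank_top, Subspace.dual_finrank_eq, hU]
  have key : ∀ S ∈ subs k U, ∃ T ∈ subs 2 (⊤ : Submodule F (Dual F U)), perp U T = S ∧
      wt w S = wt v T := by
    intro S hS
    rw [mem_subs] at hS
    obtain ⟨T, hT⟩ := perp_surj hS.1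
    have := perp_finrank T
    rw [hT, hS.2, hU] at this
    have hT2 : finrank F T = 2 := by omega
    exact ⟨T, mem_subs.mpr ⟨le_top, hT2⟩, hT, by rw [hv T hT2, hT]⟩
  have hyp : ∀ p : Submodule F (Dual F U), finrank F p = 1 →
      finrank F (perp U p) + 1 = finrank F U := by
    intro p hp
    have := perp_finrank p
    omega
  have pt : ∀ H : Submodule F (Dual F U), finrank F H + 1 =
      finrank F (⊤ : Submodule F (Dual F U)) → perp U H ∈ pts U := by
    intro H hH
    have := perp_finrank H
    exact mem_pts.mpr ⟨by omega, perp_le H⟩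
  have hc : ∀ S ∈ subs k U, wt (comp k w) S = 1 - wt w S := fun S hS =>
    wt_comp (by omega) w (mem_subs.mp hS).2
  rcases TrA_of_PatA (by norm_num) h with h | ⟨p1, hp1, h⟩ | ⟨H, hH, hf, h⟩ | ⟨H, hH, hf, p1, hp1, hn, h⟩
  · left
    refine PatA_of_TrA hk (by omega) (Or.inl fun S hS => ?_)
    obtain ⟨T, hT, -, e⟩ := key S hS
    rw [e, h T hT]
  · right
    refine PatA_of_TrA hk (by omega) (Or.inr (Or.inr (Or.inl ⟨perp U p1, perp_le _,
      hyp p1 (mem_pts.mp hp1).1, fun S hS => ?_⟩)))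
    obtain ⟨T, hT, rfl, e⟩ := key S hS
    rw [hc _ hS, e, h T hT]
    simp only [perp_anti]
    split_ifs <;> norm_num
  · right
    refine PatA_of_TrA hk (by omega) (Or.inr (Or.inl ⟨perp U H, pt H hf, fun S hS => ?_⟩))
    obtain ⟨T, hT, rfl, e⟩ := key S hS
    rw [hc _ hS, e, h T hT]
    simp only [perp_anti]
    split_ifs <;> norm_num
  · left
    refine PatA_of_TrA hk (by omega) (Or.inr (Or.inr (Or.inr ⟨perp U p1, perp_le _,
      hyp p1 (mem_pts.mp hp1).1, perp U H, pt H hf, ?_, fun S hS => ?_⟩)))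
    · rw [perp_anti]; exact hn
    obtain ⟨T, hT, rfl, e⟩ := key S hS
    rw [e, h T hT]
    simp only [perp_anti]
    split_ifs <;> norm_num

theorem main_k {k : ℕ} (hk : 3 ≤ k) {w : Submodule F V → ℝ} (hL : LB k w)
    {q : ℤ} (hq : (Fintype.card F : ℤ) = q) (hq' : q = 2 ∨ q = 3 ∨ q = 4 ∨ q = 5)
    (hU : finrank F U = k + 2) : Pat k w U := by
  have : Finite (Dual F U) := Module.finite_of_finite F
  have hq1 := q_gt_one (F := F)
  have hqp : (0:ℝ) < Fintype.card F := by linarith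
  obtain ⟨v, hv⟩ : ∃ v : Submodule F (Dual F U) → ℝ, v = fun φ =>
    (wt w (perp U φ) - wt w U / (Fintype.card F + 1)) / Fintype.card F := ⟨_, rfl⟩
  have hw : ∀ T : Submodule F (Dual F U), finrank F T = 2 → wt v T = wt w (perp U T) := by
    intro T hT
    have hf := perp_finrank T
    have e1 : ∑ φ ∈ pts T, wt w (perp U φ) = ∑ H ∈ cov (perp U T) U, wt w H := by
      refine Finset.sum_bij (fun φ _ => perp U φ) ?_ ?_ ?_ (fun _ _ => rfl)
      · intro φ hφ
        rw [mem_pts] at hφ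
        have := perp_finrank φ
        exact mem_cov.mpr ⟨(perp_anti _ _).mpr hφ.2, perp_le _, by omega⟩
      · intro a _ b _ hab
        exact le_antisymm ((perp_anti _ _).mp hab.ge) ((perp_anti _ _).mp hab.le)
      · intro H hH
        rw [mem_cov] at hH
        obtain ⟨φ, rfl⟩ := perp_surj hH.2.1
        have := perp_finrank φ
        exact ⟨φ, mem_pts.mpr ⟨by omega, (perp_anti _ _).mp hH.1⟩, rfl⟩
    have c1 : ((cov (perp U T) U).card : ℝ) = Fintype.card F + 1 := by
      apply cov_card_eq (perp_le T)
      rw [show finrank F U - finrank F (perp U T) = 2 by omega]; ring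
    have c2 : ((pts T).card : ℝ) = Fintype.card F + 1 := by
      have := card_pts T
      rw [hT] at this
      apply mul_right_cancel₀ (b := (Fintype.card F : ℝ) - 1) (by linarith)
      rw [this]; ring
    rw [cov_sum w (perp_le T), c1] at e1
    rw [hv]
    simp only [wt] at e1 ⊢
    rw [← Finset.sum_div, Finset.sum_sub_distrib, e1, Finset.sum_const, nsmul_eq_mul, c2]
    field_simp
    ring
  have hLv : LB 2 v := by
    intro T hT
    rw [hw T hT]
    have := perp_finrank T
    exact hL _ (by omega)
  rcases main2 hLv hq hq' (W := ⊤) (by rw [finrank_top, Subspace.dual_finrank_eq]; omega) with h | h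
  · exact dual_pat (by omega) hU hw h
  · refine Pat_comp (dual_pat (by omega) hU (fun T hT => ?_) h)
    have := perp_finrank T
    rw [wt_comp (by norm_num) v hT, wt_comp (by omega) w (by omega), hw T hT]

theorem main_all {k : ℕ} (hk : 2 ≤ k) {w : Submodule F V → ℝ} (hL : LB k w)
    {q : ℤ} (hq : (Fintype.card F : ℤ) = q) (hq' : q = 2 ∨ q = 3 ∨ q = 4 ∨ q = 5)
    (hU : k + 2 ≤ finrank F U) (hn : 5 ≤ finrank F U ∨ (finrank F U = 4 ∧ q = 2)) : Pat k w U := by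
  rcases hk.eq_or_lt with rfl | hk3
  · rcases hn with hn | ⟨h4, rfl⟩
    · exact main2 hL hq hq' hn
    · exact main4 hL hq h4
  · exact lift hk (by omega) hU (fun W _ hf => main_k hk3 hL hq hq' hf)

end

section
variable {F : Type*} [Field F] [Fintype F] {n k : ℕ}

theorem triv_aux {g : Gr F n k → Bool} (hk : 1 ≤ k) {f : Submodule F (Fin n → F) → ℝ}
    (hg : ∀ S : Gr F n k, f S.val = if g S then (1:ℝ) else 0) (h : TrA k f ⊤) :
    GrTrivial g := by
  have hm : ∀ S : Gr F n k, S.val ∈ subs k (⊤ : Submodule F (Fin n → F)) := fun S =>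
    mem_subs.mpr ⟨le_top, S.prop⟩
  have htop : finrank F (⊤ : Submodule F (Fin n → F)) = n := by simp
  rcases h with h | ⟨p1, hp1, h⟩ | ⟨H, hH, hf, h⟩ | ⟨H, hH, hf, p1, hp1, hn, h⟩
  · right; left
    intro S
    have := h _ (hm S)
    rw [hg] at this
    cases hS : g S <;> simp_all
  · left; right; left
    refine ⟨p1, (mem_pts.mp hp1).1, fun S => ?_⟩
    have := h _ (hm S)
    rw [hg] at this
    by_cases h2 : p1 ≤ S.val <;> cases hS : g S <;> simp_all
  · right; right; right; left
    refine ⟨H, by omega, fun S => ?_⟩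
    have := h _ (hm S)
    rw [hg] at this
    by_cases h2 : S.val ≤ H <;> cases hS : g S <;> simp_all
  · right; right; right; right
    refine ⟨p1, H, (mem_pts.mp hp1).1, by omega, hn, fun S => ?_⟩
    have := h _ (hm S)
    rw [hg] at this
    by_cases h1 : p1 ≤ S.val
    · by_cases h2 : S.val ≤ H
      · exact absurd (h1.trans h2) hn
      · cases hS : g S <;> simp_all
    · by_cases h2 : S.val ≤ H <;> cases hS : g S <;> simp_all

theorem triv_not {g : Gr F n k → Bool} (h : GrTrivial (fun S => !(g S))) : GrTrivial g := by
  rcases h with h | h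
  · exact Or.inr h
  · left; simpa using h

theorem final (hq : Fintype.card F ∈ ({2, 3, 4, 5} : Set ℕ))
    (hk : 2 ≤ k) (hnk : 2 ≤ n - k)
    (hn : 5 ≤ n ∨ (n = 4 ∧ Fintype.card F = 2)) (f : Gr F n k → Bool) (hf : GrDegOne f) :
    GrTrivial f := by
  obtain ⟨c, C, hC⟩ := hf
  have hq1 := q_gt_one (F := F)
  have hQ : 1 < (Fintype.card F : ℝ) ^ k := one_lt_pow₀ hq1 (by omega)
  obtain ⟨w, hw⟩ : ∃ w : Submodule F (Fin n → F) → ℝ, w = fun p =>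
    C p + c * (((Fintype.card F : ℝ) - 1) / ((Fintype.card F : ℝ) ^ k - 1)) := ⟨_, rfl⟩
  have hwt : ∀ S : Gr F n k, wt w S.val = if f S then (1:ℝ) else 0 := by
    intro S
    rw [hC S]
    have e1 : ∑ᶠ p ∈ {p : Submodule F (Fin n → F) | finrank F p = 1},
            C p * (if p ≤ S.val then (1 : ℝ) else 0) = ∑ p ∈ pts S.val, C p := by
      rw [finsum_mem_eq_sum_of_inter_support_eq (t := pts S.val)]
      · refine Finset.sum_congr rfl (fun p hp => ?_)
        rw [if_pos (mem_pts.mp hp).2, mul_one]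
      · ext p
        simp only [Set.mem_inter_iff, Set.mem_ofPred_eq, Function.mem_support, Finset.mem_coe, mem_pts]
        constructor
        · rintro ⟨h1, h2⟩
          refine ⟨⟨h1, ?_⟩, h2⟩
          by_contra hc
          rw [if_neg hc, mul_zero] at h2
          exact h2 rfl
        · rintro ⟨⟨h1, -⟩, h2⟩
          exact ⟨h1, h2⟩
    have c1 := card_pts S.val
    rw [show finrank F S.val = k from S.prop] at c1
    rw [e1, hw]
    simp only [wt]
    rw [Finset.sum_add_distrib, Finset.sum_const, nsmul_eq_mul]
    have h0 : (Fintype.card F : ℝ) ^ k - 1 ≠ 0 := by linarith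
    have : ((pts S.val).card : ℝ) * (c * (((Fintype.card F : ℝ) - 1) / ((Fintype.card F : ℝ) ^ k - 1)))
        = c * ((((pts S.val).card : ℝ) * ((Fintype.card F : ℝ) - 1)) / ((Fintype.card F : ℝ) ^ k - 1)) := by
      ring
    rw [this, c1, div_self h0]
    ring
  have hL : LB k w := by
    intro S hS
    rw [hwt ⟨S, hS⟩]
    split_ifs <;> simp
  have htop : finrank F (⊤ : Submodule F (Fin n → F)) = n := by simp
  have hq' : (Fintype.card F : ℤ) = 2 ∨ (Fintype.card F : ℤ) = 3 ∨ (Fintype.card F : ℤ) = 4 ∨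
      (Fintype.card F : ℤ) = 5 := by
    simp only [Set.mem_insert_iff, Set.mem_singleton_iff] at hq
    omega
  rcases main_all (U := ⊤) hk hL rfl hq' (by omega) (by omega) with h | h
  · exact triv_aux (by omega) hwt (TrA_of_PatA (by omega) h)
  · refine triv_not (triv_aux (by omega) (f := wt (comp k w)) ?_ (TrA_of_PatA (by omega) h))
    intro S
    rw [wt_comp (by omega) w S.prop, hwt]
    cases f S <;> simp

end
end GC

/-- For `q ∈ {2,3,4,5}`, `k, n−k ≥ 2`, and either `n ≥ 5` or
(`n = 4` and `q = 2`), every Boolean degree 1 function on `J_q(n,k)` is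
trivial. -/
theorem grassmann_classification (F : Type*) [Field F] [Fintype F] (n k : ℕ)
    (hq : Fintype.card F ∈ ({2, 3, 4, 5} : Set ℕ))
    (hk : 2 ≤ k) (hnk : 2 ≤ n - k)
    (hn : 5 ≤ n ∨ (n = 4 ∧ Fintype.card F = 2)) :
    ∀ f : Gr F n k → Bool, GrDegOne f → GrTrivial f := by
  exact fun f hf => GC.final hq hk hnk hn f hf
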